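/- Let (X, 𝓑(X), μ) be a σ-finite measure space and T_1, …, T_d : X → X commuting invertible measure-preserving transformations. For p ∈ (3/2, 4) and r ∈ (2, ∞) there exists a constant C_{p,r} > 0 independent of d such that for all f ∈ L^p(X), ‖ V_r(𝓐_N f : N ∈ ℕ) ‖_{L^p(X)} ≤ C_{p,r} ‖f‖_{L^p(X)}. Moreover, for all p ∈ (1, ∞) and r ∈ (2, ∞) there exists a constant C_{p,r} > 0 independent of d such that for all f ∈ L^p(X), ‖ V_r(𝓐_{2^n} f : n ∈ ℕ₀) ‖_{L^p(X)} ≤ C_{p,r} ‖f‖_{L^p(X)}. -/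

import Mathlib

open MeasureTheory ENNReal

/-- The `r`-variation seminorm of a sequence `n ↦ a n`, `n ∈ ℕ₀`. -/
noncomputable def varSeqSem (r : ℝ) (a : ℕ → ℂ) : ℝ≥0∞ :=
  ⨆ (J : ℕ) (u : Fin (J + 1) → ℕ) (_ : StrictMono u),
    (∑ j : Fin J, (‖a (u j.succ) - a (u j.castSucc)‖₊ : ℝ≥0∞) ^ r) ^ (1 / r)

/-- The ergodic Hardy–Littlewood averaging operator over cubes, for a measure-preserving
`ℤ^d`-action `T`: `𝓐_N f(x) = (2N+1)^{-d} Σ_{|y|_∞ ≤ N} f(T_y x)`. -/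
noncomputable def ergAvg {X : Type*} (d : ℕ) (T : (Fin d → ℤ) → X → X) (N : ℕ)
    (f : X → ℂ) (x : X) : ℂ :=
  (((2 * N + 1) ^ d : ℕ) : ℂ)⁻¹ *
    ∑ y ∈ Finset.Icc (fun _ => -(N : ℤ) : Fin d → ℤ) (fun _ => (N : ℤ)), f (T y x)

/-- The `L^p(X,μ)` norm (for finite `p`) of a nonnegative (ℝ≥0∞-valued) function. -/
noncomputable def lpMeas {X : Type*} [MeasurableSpace X] (μ : Measure X) (p : ℝ)
    (g : X → ℝ≥0∞) : ℝ≥0∞ :=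
  (∫⁻ x, g x ^ p ∂μ) ^ (1 / p)

namespace DF
open Finset

section nm
variable {Ω : Type*} [Fintype Ω]

/-- discrete Lp norm -/
noncomputable def nm (p : ℝ) (f : Ω → ℝ) : ℝ := (∑ x, |f x| ^ p) ^ (1 / p)

lemma nm_nonneg (p : ℝ) (f : Ω → ℝ) : 0 ≤ nm p f := by unfold nm; positivity

lemma nm_rpow {p : ℝ} (hp : 0 < p) (f : Ω → ℝ) : nm p f ^ p = ∑ x, |f x| ^ p := by
  unfold nm
  rw [← Real.rpow_mul (by positivity), one_div, inv_mul_cancel₀ hp.ne', Real.rpow_one]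

lemma nm_le_iff {p : ℝ} (hp : 0 < p) {f : Ω → ℝ} {c : ℝ} (hc : 0 ≤ c) :
    nm p f ≤ c ↔ ∑ x, |f x| ^ p ≤ c ^ p := by
  rw [← nm_rpow hp, Real.rpow_le_rpow_iff (nm_nonneg _ _) hc hp]

lemma nm_mono {p : ℝ} (hp : 0 < p) {f g : Ω → ℝ} (h : ∀ x, |f x| ≤ g x) : nm p f ≤ nm p g := by
  unfold nm
  refine Real.rpow_le_rpow (by positivity) (sum_le_sum fun x _ => ?_) (by positivity)
  exact Real.rpow_le_rpow (abs_nonneg _) ((h x).trans (le_abs_self _)) hp.le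

lemma nm_add {p : ℝ} (hp : 1 ≤ p) (f g : Ω → ℝ) : nm p (fun x => f x + g x) ≤ nm p f + nm p g :=
  Real.Lp_add_le _ _ _ hp

lemma nm_zero {p : ℝ} (hp : 0 < p) : nm p (fun _ : Ω => (0:ℝ)) = 0 := by
  unfold nm; simp [Real.zero_rpow hp.ne', hp.ne']

lemma nm_sum {p : ℝ} (hp : 1 ≤ p) {ι : Type*} (s : Finset ι) (f : ι → Ω → ℝ) :
    nm p (fun x => ∑ i ∈ s, f i x) ≤ ∑ i ∈ s, nm p (f i) := by
  classical
  induction s using Finset.induction_on with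
  | empty => simp [nm_zero (lt_of_lt_of_le one_pos hp)]
  | insert a s ha ih =>
    simp only [sum_insert ha]
    exact (nm_add hp _ _).trans (by gcongr)

lemma nm_smul {p : ℝ} (hp : 0 < p) {c : ℝ} (hc : 0 ≤ c) (f : Ω → ℝ) :
    nm p (fun x => c * f x) = c * nm p f := by
  unfold nm
  simp only [abs_mul, abs_of_nonneg hc]
  simp_rw [Real.mul_rpow hc (abs_nonneg _)]
  rw [← mul_sum, Real.mul_rpow (by positivity) (by positivity), ← Real.rpow_mul hc,
    mul_one_div_cancel hp.ne', Real.rpow_one]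

lemma nm_equiv (p : ℝ) (e : Ω ≃ Ω) (f : Ω → ℝ) : nm p (fun x => f (e x)) = nm p f := by
  unfold nm
  rw [Equiv.sum_comp e (fun x => |f x| ^ p)]

lemma holder {p q : ℝ} (h : p.HolderConjugate q) (f g : Ω → ℝ) :
    ∑ x, f x * g x ≤ nm p f * nm q g := Real.inner_le_Lp_mul_Lq _ _ _ h

/-- converse of Hölder -/
lemma dual_bound {p q : ℝ} (h : p.HolderConjugate q) {f : Ω → ℝ} (hf : ∀ x, 0 ≤ f x) {c : ℝ}
    (hc : 0 ≤ c) (H : ∀ g : Ω → ℝ, (∀ x, 0 ≤ g x) → ∑ x, f x * g x ≤ c * nm q g) :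
    nm p f ≤ c := by
  have hp := h.pos
  have hq := h.symm.pos
  have h1 := H (fun x => f x ^ (p - 1)) (fun x => Real.rpow_nonneg (hf x) _)
  have e1 : ∑ x, f x * f x ^ (p - 1) = nm p f ^ p := by
    rw [nm_rpow hp]
    refine sum_congr rfl fun x _ => ?_
    rw [abs_of_nonneg (hf x)]
    rcases (hf x).eq_or_lt with h0 | h0
    · rw [← h0, Real.zero_rpow hp.ne']; simp
    · rw [← Real.rpow_one_add' (hf x) (by linarith)]; congr 1; ring
  have e2 : nm q (fun x => f x ^ (p - 1)) = nm p f ^ (p - 1) := by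
    have : p / q = p - 1 := by rw [h.symm.conjugate_eq] ; field_simp [h.symm.sub_one_ne_zero]; ring
    rw [← this]
    unfold nm
    rw [← Real.rpow_mul (by positivity)]
    congr 1
    · refine sum_congr rfl fun x _ => ?_
      rw [abs_of_nonneg (Real.rpow_nonneg (hf x) _), abs_of_nonneg (hf x), ← Real.rpow_mul (hf x)]
      congr 1; field_simp
    · field_simp
  rw [e1, e2] at h1
  rcases (nm_nonneg p f).eq_or_lt with h0 | h0
  · rw [← h0]; exact hc
  · have : nm p f ^ p = nm p f * nm p f ^ (p - 1) := by
      rw [← Real.rpow_one_add' h0.le (by linarith)]; congr 1; ring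
    rw [this] at h1
    exact le_of_mul_le_mul_right h1 (by positivity)

end nm

section sqn
variable {Ω κ : Type*} [Fintype κ]

/-- pointwise l2 norm -/
noncomputable def sqn (h : κ → Ω → ℂ) (x : Ω) : ℝ := √(∑ k, ‖h k x‖ ^ 2)

lemma sqn_nonneg (h : κ → Ω → ℂ) (x : Ω) : 0 ≤ sqn h x := Real.sqrt_nonneg _

lemma sqn_sq (h : κ → Ω → ℂ) (x : Ω) : sqn h x ^ 2 = ∑ k, ‖h k x‖ ^ 2 :=
  Real.sq_sqrt (by positivity)

lemma sqn_eq_norm (h : κ → Ω → ℂ) (x : Ω) :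
    sqn h x = ‖(WithLp.toLp 2 (fun k => h k x) : EuclideanSpace ℂ κ)‖ := by
  rw [EuclideanSpace.norm_eq]; rfl

lemma sqn_add (h g : κ → Ω → ℂ) (x : Ω) : sqn (fun k x => h k x + g k x) x ≤ sqn h x + sqn g x := by
  simp only [sqn_eq_norm]
  exact norm_add_le (WithLp.toLp 2 (fun k => h k x) : EuclideanSpace ℂ κ) (WithLp.toLp 2 (fun k => g k x))

lemma sqn_sum {ι : Type*} (s : Finset ι) (h : ι → κ → Ω → ℂ) (x : Ω) :
    sqn (fun k x => ∑ i ∈ s, h i k x) x ≤ ∑ i ∈ s, sqn (h i) x := by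
  classical
  induction s using Finset.induction_on with
  | empty => simp [sqn]
  | insert a s ha ih =>
    simp only [sum_insert ha]
    exact (sqn_add _ _ _).trans (by gcongr)

lemma le_sqn (h : κ → Ω → ℂ) (k : κ) (x : Ω) : ‖h k x‖ ≤ sqn h x := by
  apply Real.le_sqrt_of_sq_le
  exact single_le_sum (f := fun k => ‖h k x‖ ^ 2) (fun _ _ => by positivity) (mem_univ k)

lemma sqn_mono {h g : κ → Ω → ℂ} {x : Ω} (H : ∀ k, ‖h k x‖ ≤ ‖g k x‖) : sqn h x ≤ sqn g x := by
  unfold sqn; gcongr with k; exact H k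

lemma sqn_neg (h : κ → Ω → ℂ) (x : Ω) : sqn (fun k x => - h k x) x = sqn h x := by
  simp [sqn]

lemma sqn_sub (h g : κ → Ω → ℂ) (x : Ω) : sqn (fun k x => h k x - g k x) x ≤ sqn h x + sqn g x := by
  have := sqn_add h (fun k x => - g k x) x
  simpa only [sqn_neg, ← sub_eq_add_neg] using this

lemma sqn_unit (f : Ω → ℂ) (x : Ω) : sqn (fun (_ : Unit) => f) x = ‖f x‖ := by
  simp [sqn]

end sqn

section VDom

/-- `w` dominates the `r`-variation of `a` on indices `< L` -/
def VDom (r : ℝ) (a : ℕ → ℂ) (L : ℕ) (w : ℝ) : Prop :=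
  0 ≤ w ∧ ∀ (J : ℕ) (u : ℕ → ℕ), Monotone u → u J < L →
    ∑ j ∈ range J, ‖a (u (j + 1)) - a (u j)‖ ^ r ≤ w ^ r

lemma VDom.mono {r : ℝ} (hr : 0 ≤ r) {a : ℕ → ℂ} {L : ℕ} {w w' : ℝ} (h : VDom r a L w) (hw : w ≤ w') :
    VDom r a L w' :=
  ⟨h.1.trans hw, fun J u hu hL => (h.2 J u hu hL).trans (Real.rpow_le_rpow h.1 hw hr)⟩

lemma VDom.add {r : ℝ} (hr : 1 ≤ r) {a b : ℕ → ℂ} {L : ℕ} {w v : ℝ} (h : VDom r a L w)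
    (h' : VDom r b L v) : VDom r (fun n => a n + b n) L (w + v) := by
  have hr0 : 0 < r := by linarith
  refine ⟨add_nonneg h.1 h'.1, fun J u hu hL => ?_⟩
  have h1 := Real.rpow_le_rpow (by positivity) (h.2 J u hu hL) (by positivity : 0 ≤ 1 / r)
  have h2 := Real.rpow_le_rpow (by positivity) (h'.2 J u hu hL) (by positivity : 0 ≤ 1 / r)
  rw [← Real.rpow_mul h.1, mul_one_div_cancel hr0.ne', Real.rpow_one] at h1
  rw [← Real.rpow_mul h'.1, mul_one_div_cancel hr0.ne', Real.rpow_one] at h2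
  have h3 := Real.Lp_add_le_of_nonneg (range J) (f := fun j => ‖a (u (j + 1)) - a (u j)‖)
    (g := fun j => ‖b (u (j + 1)) - b (u j)‖) hr (fun _ _ => norm_nonneg _) (fun _ _ => norm_nonneg _)
  have h4 := h3.trans (add_le_add h1 h2)
  have h5 := Real.rpow_le_rpow (by positivity) h4 hr0.le
  rw [← Real.rpow_mul (by positivity), one_div_mul_cancel hr0.ne', Real.rpow_one] at h5
  refine le_trans ?_ h5
  gcongr with j
  calc _ = ‖(a (u (j + 1)) - a (u j)) + (b (u (j + 1)) - b (u j))‖ := by congr 1; ring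
    _ ≤ _ := norm_add_le _ _

lemma VDom.zero {r : ℝ} (hr : 0 < r) (c : ℂ) (L : ℕ) : VDom r (fun _ => c) L 0 :=
  ⟨le_rfl, fun J u _ _ => by simp [Real.zero_rpow hr.ne']⟩

lemma VDom.sum {r : ℝ} (hr : 1 ≤ r) {ι : Type*} (s : Finset ι) {a : ι → ℕ → ℂ} {L : ℕ} {w : ι → ℝ}
    (h : ∀ i ∈ s, VDom r (a i) L (w i)) : VDom r (fun n => ∑ i ∈ s, a i n) L (∑ i ∈ s, w i) := by
  classical
  induction s using Finset.induction_on with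
  | empty => simpa using VDom.zero (by linarith) 0 L
  | insert i s hi ih =>
    simp only [sum_insert hi]
    exact (h i (mem_insert_self _ _)).add hr (ih fun j hj => h j (mem_insert_of_mem hj))

lemma VDom.smul {r : ℝ} {a : ℕ → ℂ} {L : ℕ} {w : ℝ} (h : VDom r a L w) (c : ℂ) :
    VDom r (fun n => c * a n) L (‖c‖ * w) := by
  refine ⟨mul_nonneg (norm_nonneg _) h.1, fun J u hu hL => ?_⟩
  simp_rw [← mul_sub, norm_mul]
  simp_rw [Real.mul_rpow (norm_nonneg c) (norm_nonneg _)]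
  rw [← mul_sum, Real.mul_rpow (norm_nonneg c) h.1]
  gcongr
  exact h.2 J u hu hL

lemma VDom.congr {r : ℝ} {a b : ℕ → ℂ} {L : ℕ} {w : ℝ} (h : VDom r a L w)
    (H : ∀ n < L, a n = b n) : VDom r b L w := by
  refine ⟨h.1, fun J u hu hL => ?_⟩
  rw [← sum_congr rfl fun j hj => ?_]
  · exact h.2 J u hu hL
  · have := mem_range.1 hj
    rw [H _ ((hu (by omega)).trans_lt hL), H _ ((hu (by omega)).trans_lt hL)]

lemma VDom.comp {r : ℝ} {a : ℕ → ℂ} {L L' : ℕ} {w : ℝ} (h : VDom r a L w) (φ : ℕ → ℕ)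
    (hφ : Monotone φ) (hL : ∀ n < L', φ n < L) : VDom r (fun n => a (φ n)) L' w :=
  ⟨h.1, fun J u hu hJ => h.2 J (fun j => φ (u j)) (hφ.comp hu) (hL _ hJ)⟩

/-- l^r sums are dominated by l^2 sums -/
lemma sum_rpow_le_sq {ι : Type*} (s : Finset ι) {r : ℝ} (hr : 2 ≤ r) {f : ι → ℝ} (hf : ∀ i, 0 ≤ f i)
    {w : ℝ} (hw : 0 ≤ w) (h : ∑ i ∈ s, f i ^ 2 ≤ w ^ 2) : ∑ i ∈ s, f i ^ r ≤ w ^ r := by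
  have key : ∀ i ∈ s, f i ^ r ≤ w ^ (r - 2) * f i ^ 2 := by
    intro i hi
    have h1 : f i ≤ w := by
      have := (single_le_sum (f := fun i => f i ^ 2) (fun _ _ => by positivity) hi).trans h
      exact (sq_le_sq₀ (hf i) hw).1 this
    rcases (hf i).eq_or_lt with h0 | h0
    · rw [← h0, Real.zero_rpow (by linarith)]; simp
    · have : f i ^ r = f i ^ (r - 2) * f i ^ 2 := by
        rw [← Real.rpow_natCast, ← Real.rpow_add h0]; norm_num
      rw [this]
      gcongr
  calc _ ≤ ∑ i ∈ s, w ^ (r - 2) * f i ^ 2 := sum_le_sum key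
    _ = w ^ (r - 2) * ∑ i ∈ s, f i ^ 2 := by rw [mul_sum]
    _ ≤ w ^ (r - 2) * w ^ 2 := by gcongr
    _ = w ^ r := by
      rcases hw.eq_or_lt with h0 | h0
      · rw [← h0, Real.zero_rpow (by linarith : r ≠ 0)]; simp
      · rw [← Real.rpow_natCast, ← Real.rpow_add h0]; norm_num

/-- step functions: `β` evaluated on a monotone index with `l^2` bounded values -/
lemma VDom.of_sq {r : ℝ} (hr : 2 ≤ r) {a : ℕ → ℂ} {L : ℕ} (φ : ℕ → ℕ) (hφ : Monotone φ) (β : ℕ → ℂ)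
    (ha : ∀ n < L, a n = β (φ n)) (s : Finset ℕ) (hs : ∀ n < L, φ n ∈ s) {w : ℝ} (hw : 0 ≤ w)
    (h : 4 * ∑ i ∈ s, ‖β i‖ ^ 2 ≤ w ^ 2) : VDom r a L w := by
  refine ⟨hw, fun J u hu hL => sum_rpow_le_sq _ hr (fun _ => norm_nonneg _) hw (le_trans ?_ h)⟩
  have hlt : ∀ j ≤ J, u j < L := fun j hj => (hu hj).trans_lt hL
  set v := fun j => φ (u j) with hv
  have hvm : Monotone v := hφ.comp hu
  have e : ∀ j ∈ range J, ‖a (u (j + 1)) - a (u j)‖ ^ 2 ≤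
      if v j < v (j + 1) then 2 * ‖β (v (j+1))‖ ^ 2 + 2 * ‖β (v j)‖ ^ 2 else 0 := by
    intro j hj
    have hj := mem_range.1 hj
    rw [ha _ (hlt _ hj), ha _ (hlt _ hj.le)]
    split_ifs with hc
    · have := norm_sub_le (β (v (j+1))) (β (v j))
      have h0 := norm_nonneg (β (v (j+1)) - β (v j))
      calc _ ≤ (‖β (v (j+1))‖ + ‖β (v j)‖) ^ 2 := by gcongr
        _ ≤ _ := by nlinarith [sq_nonneg (‖β (v (j+1))‖ - ‖β (v j)‖)]
    · have : v (j+1) = v j := le_antisymm (not_lt.1 hc) (hvm (Nat.le_succ j))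
      simp only [hv] at this
      simp [this]
  refine (sum_le_sum e).trans ?_
  rw [← sum_filter]
  set t := (range J).filter fun j => v j < v (j + 1)
  have b1 : ∑ j ∈ t, ‖β (v j)‖ ^ 2 ≤ ∑ i ∈ s, ‖β i‖ ^ 2 := by
    rw [← sum_image (f := fun i => ‖β i‖ ^ 2) (g := v)]
    · refine sum_le_sum_of_subset_of_nonneg ?_ fun _ _ _ => by positivity
      intro i hi
      obtain ⟨j, hj, rfl⟩ := mem_image.1 hi
      exact hs _ (hlt _ (mem_range.1 (mem_filter.1 hj).1).le)
    · intro i hi j hj hij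
      by_contra hne
      rcases lt_or_gt_of_ne hne with hl | hl
      · have := (mem_filter.1 hi).2; have := hvm (show i + 1 ≤ j by omega); omega
      · have := (mem_filter.1 hj).2; have := hvm (show j + 1 ≤ i by omega); omega
  have b2 : ∑ j ∈ t, ‖β (v (j+1))‖ ^ 2 ≤ ∑ i ∈ s, ‖β i‖ ^ 2 := by
    rw [← sum_image (f := fun i => ‖β i‖ ^ 2) (g := fun j => v (j+1))]
    · refine sum_le_sum_of_subset_of_nonneg ?_ fun _ _ _ => by positivity
      intro i hi
      obtain ⟨j, hj, rfl⟩ := mem_image.1 hi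
      exact hs _ (hlt _ (mem_range.1 (mem_filter.1 hj).1))
    · intro i hi j hj hij
      simp only at hij
      by_contra hne
      rcases lt_or_gt_of_ne hne with hl | hl
      · have := (mem_filter.1 hj).2; have := hvm (show i + 1 ≤ j by omega); omega
      · have := (mem_filter.1 hi).2; have := hvm (show j + 1 ≤ i by omega); omega
  rw [sum_add_distrib, ← mul_sum, ← mul_sum]
  linarith

end VDom
end DF

namespace DF
open Finset

set_option linter.unusedSectionVars false
set_option linter.unusedSimpArgs false
set_option linter.unusedVariables false

section scalar

lemma absorb_pt {p a c f g : ℝ} (ha : 0 < a) (hap : a ≤ p) (hc : 0 < c) (hf : 0 ≤ f) (hg : 0 ≤ g) :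
    c * (f ^ (p - a) * g ^ a) ≤ c * ((2 * c) ^ (1 / a)) ^ (p - a) * g ^ p + f ^ p / 2 := by
  set l := (2 * c) ^ (1 / a) with hl
  have hlp : 0 < l := by positivity
  have hla : l ^ a = 2 * c := by
    rw [hl, ← Real.rpow_mul (by positivity), one_div_mul_cancel ha.ne', Real.rpow_one]
  have hp : 0 < p := by linarith
  rcases le_total f (l * g) with h | h
  · have h1 : f ^ (p - a) * g ^ a ≤ l ^ (p - a) * g ^ p := by
      calc _ ≤ (l * g) ^ (p - a) * g ^ a := by gcongr
        _ = l ^ (p - a) * (g ^ (p - a) * g ^ a) := by rw [Real.mul_rpow hlp.le hg]; ring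
        _ = _ := by rw [← Real.rpow_add' hg (by linarith)]; congr 2; ring
    have := mul_le_mul_of_nonneg_left h1 hc.le
    have h3 : 0 ≤ f ^ p := by positivity
    linarith
  · have h1 : f ^ (p - a) * (l * g) ^ a ≤ f ^ p := by
      calc _ ≤ f ^ (p - a) * f ^ a := by gcongr
        _ = _ := by rw [← Real.rpow_add' hf (by linarith)]; congr 1; ring
    rw [Real.mul_rpow hlp.le hg, hla] at h1
    have : 0 ≤ c * l ^ (p - a) * g ^ p := by positivity
    linarith

lemma absorb {Ω : Type*} [Fintype Ω] {p a c : ℝ} (ha : 0 < a) (hap : a ≤ p) (hc : 0 < c) {f g : Ω → ℝ}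
    (hf : ∀ x, 0 ≤ f x) (hg : ∀ x, 0 ≤ g x)
    (h : ∑ x, f x ^ p ≤ c * ∑ x, f x ^ (p - a) * g x ^ a) :
    ∑ x, f x ^ p ≤ 2 * (c * ((2 * c) ^ (1 / a)) ^ (p - a)) * ∑ x, g x ^ p := by
  rw [mul_sum] at h
  have := h.trans (sum_le_sum fun x _ => absorb_pt ha hap hc (hf x) (hg x))
  rw [sum_add_distrib, ← mul_sum, ← sum_div] at this
  linarith

lemma tangent {q a b : ℝ} (hq : 1 ≤ q) (ha : 0 ≤ a) (hb : 0 ≤ b) :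
    b ^ q + q * b ^ (q - 1) * (a - b) ≤ a ^ q := by
  rcases hb.eq_or_lt with rfl | hb
  · rw [Real.zero_rpow (by linarith)]
    rcases hq.eq_or_lt with rfl | hq
    · simp
    · rw [Real.zero_rpow (by linarith)]; simp; positivity
  · have h0 : -1 ≤ a / b - 1 := by
      have : 0 ≤ a / b := by positivity
      linarith
    have h := one_add_mul_self_le_rpow_one_add (s := a / b - 1) h0 hq
    rw [add_sub_cancel, Real.div_rpow ha hb.le, le_div_iff₀ (by positivity)] at h
    calc _ = (1 + q * (a / b - 1)) * b ^ q := by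
          have : b ^ q = b ^ (q - 1) * b := by
            rw [← Real.rpow_add_one hb.ne']; congr 1; ring
          rw [this]; field_simp
      _ ≤ _ := h

lemma slope_lb {p s t A : ℝ} (hp : 1 < p) (hp2 : p ≤ 2) (hs : 0 ≤ s) (hst : s ≤ t) (htA : t ≤ A) :
    (p - 1) * A ^ (p - 2) * (t - s) ≤ t ^ (p - 1) - s ^ (p - 1) := by
  have hm : MonotoneOn (fun t : ℝ => t ^ (p - 1) - (p - 1) * A ^ (p - 2) * t) (Set.Icc 0 A) := by
    have hd : ∀ x ∈ interior (Set.Icc 0 A), HasDerivAt (fun t : ℝ => t ^ (p - 1) - (p - 1) * A ^ (p - 2) * t)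
        ((p - 1) * x ^ (p - 1 - 1) - (p - 1) * A ^ (p - 2)) x := by
      intro x hx
      rw [interior_Icc] at hx
      have h1 := Real.hasDerivAt_rpow_const (x := x) (p := p - 1) (Or.inl hx.1.ne')
      have h2 := (hasDerivAt_id x).const_mul ((p - 1) * A ^ (p - 2))
      convert! h1.sub h2 using 1
      simp
    refine monotoneOn_of_deriv_nonneg (convex_Icc 0 A) ?_ ?_ ?_
    · refine ContinuousOn.sub (fun x hx => ?_) (by fun_prop)
      exact (Real.continuousAt_rpow_const _ _ (Or.inr (by linarith))).continuousWithinAt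
    · exact fun x hx => (hd x hx).differentiableAt.differentiableWithinAt
    · intro x hx
      rw [(hd x hx).deriv]
      rw [interior_Icc] at hx
      have : A ^ (p - 2) ≤ x ^ (p - 2) := Real.rpow_le_rpow_of_nonpos hx.1 hx.2.le (by linarith)
      rw [show p - 1 - 1 = p - 2 by ring]
      nlinarith
  have := hm ⟨hs, hst.trans htA⟩ ⟨hs.trans hst, htA⟩ hst
  simp only at this
  linarith

lemma taylor {p a b A : ℝ} (hp : 1 < p) (hp2 : p ≤ 2) (ha : 0 ≤ a) (hb : 0 ≤ b) (haA : a ≤ A)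
    (hbA : b ≤ A) :
    a ^ p + p * a ^ (p - 1) * (b - a) + p * (p - 1) / 2 * (b - a) ^ 2 * A ^ (p - 2) ≤ b ^ p := by
  set h : ℝ → ℝ := fun b => b ^ p - (a ^ p + p * a ^ (p - 1) * (b - a) + p * (p - 1) / 2 * (b - a) ^ 2 * A ^ (p - 2))
  have hd : ∀ x : ℝ, HasDerivAt h (p * x ^ (p - 1) - (p * a ^ (p - 1) + p * (p - 1) * (x - a) * A ^ (p - 2))) x := by
    intro x
    have h1 := Real.hasDerivAt_rpow_const (x := x) (p := p) (Or.inr hp.le)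
    have h2 := ((hasDerivAt_id x).sub_const a)
    have h3 := (h2.const_mul (p * a ^ (p - 1))).const_add (a ^ p)
    have h4 := ((h2.pow 2).const_mul (p * (p - 1) / 2)).mul_const (A ^ (p - 2))
    have := h1.sub (h3.add h4)
    convert! this using 1
    simp only [id, mul_one]; push_cast; rw [pow_one]; ring
  have ha0 : h a = 0 := by simp [h]
  suffices 0 ≤ h b by simp only [h] at this; linarith
  rw [← ha0]
  have hcont : Continuous h := continuous_iff_continuousAt.2 fun x => (hd x).continuousAt
  rcases le_total a b with hab | hab
  · refine monotoneOn_of_deriv_nonneg (convex_Icc a b) hcont.continuousOn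
      (fun x _ => (hd x).differentiableAt.differentiableWithinAt) ?_ ⟨le_rfl, hab⟩ ⟨hab, le_rfl⟩ hab
    intro x hx
    rw [interior_Icc] at hx
    rw [(hd x).deriv]
    have := slope_lb hp hp2 ha hx.1.le (hx.2.le.trans hbA)
    nlinarith
  · refine antitoneOn_of_deriv_nonpos (convex_Icc b a) hcont.continuousOn
      (fun x _ => (hd x).differentiableAt.differentiableWithinAt) ?_ ⟨le_rfl, hab⟩ ⟨hab, le_rfl⟩ hab
    intro x hx
    rw [interior_Icc] at hx
    rw [(hd x).deriv]
    have := slope_lb hp hp2 (hb.trans hx.1.le) hx.2.le haA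
    nlinarith

end scalar

section mart
variable {Ω α : Type} [Fintype Ω]

/-- measurability at level `n` -/
def Ms (π : ℕ → Ω → α) (n : ℕ) {β : Type} (g : Ω → β) : Prop := ∀ x y, π n x = π n y → g x = g y

def Refi (π : ℕ → Ω → α) : Prop := ∀ n x y, π (n + 1) x = π (n + 1) y → π n x = π n y

open Classical in
/-- conditional expectation -/
noncomputable def E (π : ℕ → Ω → α) (n : ℕ) (f : Ω → ℝ) (x : Ω) : ℝ :=
  (∑ y with π n y = π n x, f y) / (#{y | π n y = π n x} : ℝ)

structure Mart (π : ℕ → Ω → α) (X : ℕ → Ω → ℝ) : Prop where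
  ad : ∀ n, Ms π n (X n)
  st : ∀ n (w : Ω → ℝ), Ms π n w → ∑ x, w x * (X (n + 1) x - X n x) = 0

lemma Ms.succ {π : ℕ → Ω → α} (hπ : Refi π) {n : ℕ} {β : Type} {g : Ω → β} (h : Ms π n g) :
    Ms π (n + 1) g := fun x y hxy => h x y (hπ n x y hxy)

lemma E_ms (π : ℕ → Ω → α) (n : ℕ) (f : Ω → ℝ) : Ms π n (E π n f) := by
  intro x y h
  unfold E; rw [h]

lemma E_int (π : ℕ → Ω → α) (n : ℕ) (f w : Ω → ℝ) (hw : Ms π n w) :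
    ∑ x, w x * E π n f x = ∑ x, w x * f x := by
  classical
  have h1 : ∀ x, w x * E π n f x = ∑ y, if π n y = π n x then w y * f y / (#{z | π n z = π n y} : ℝ) else 0 := by
    intro x
    rw [E, mul_div_assoc', mul_sum, sum_div, sum_filter]
    refine sum_congr rfl fun y _ => ?_
    split_ifs with h
    · rw [hw x y h.symm, h]
    · rfl
  simp_rw [h1]
  rw [sum_comm]
  refine sum_congr rfl fun y _ => ?_
  rw [← sum_filter, sum_const, nsmul_eq_mul]
  have : univ.filter (fun x => π n y = π n x) = univ.filter (fun z => π n z = π n y) :=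
    filter_congr fun _ _ => eq_comm
  rw [this]
  have : (#{z | π n z = π n y} : ℝ) ≠ 0 := by
    simp only [ne_eq, Nat.cast_eq_zero, card_eq_zero]
    exact Finset.Nonempty.ne_empty ⟨y, by simp⟩
  field_simp

lemma E_mart {π : ℕ → Ω → α} (hπ : Refi π) (f : Ω → ℝ) : Mart π (fun n => E π n f) where
  ad n := E_ms π n f
  st n w hw := by
    simp_rw [mul_sub, sum_sub_distrib]
    rw [E_int _ _ _ _ (hw.succ hπ), E_int _ _ _ _ hw, sub_self]

lemma E_nonneg (π : ℕ → Ω → α) (n : ℕ) {f : Ω → ℝ} (hf : ∀ x, 0 ≤ f x) (x : Ω) : 0 ≤ E π n f x := by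
  unfold E
  exact div_nonneg (sum_nonneg fun _ _ => hf _) (by positivity)

lemma E_sub (π : ℕ → Ω → α) (n : ℕ) (f g : Ω → ℝ) (x : Ω) :
    E π n (fun x => f x - g x) x = E π n f x - E π n g x := by
  unfold E; rw [sum_sub_distrib, sub_div]

lemma E_inj (π : ℕ → Ω → α) {n : ℕ} (h : Function.Injective (π n)) (f : Ω → ℝ) : E π n f = f := by
  classical
  ext x
  have : ({y | π n y = π n x} : Finset Ω) = {x} := by ext; simp [h.eq_iff]
  simp [E, this]

/-- running maximum -/
noncomputable def rmx (a : ℕ → ℝ) : ℕ → ℝ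
  | 0 => |a 0|
  | n + 1 => max (rmx a n) |a (n + 1)|

lemma rmx_mono (a : ℕ → ℝ) : Monotone (rmx a) := monotone_nat_of_le_succ fun _ => le_max_left _ _

lemma le_rmx_self (a : ℕ → ℝ) (n : ℕ) : |a n| ≤ rmx a n := by
  cases n with
  | zero => exact le_rfl
  | succ n => exact le_max_right _ _

lemma le_rmx (a : ℕ → ℝ) {k n : ℕ} (h : k ≤ n) : |a k| ≤ rmx a n := (le_rmx_self a k).trans (rmx_mono a h)

lemma rmx_nonneg (a : ℕ → ℝ) (n : ℕ) : 0 ≤ rmx a n := (abs_nonneg _).trans (le_rmx_self a n)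

lemma rmx_attained (a : ℕ → ℝ) (n : ℕ) : ∃ k ≤ n, rmx a n = |a k| := by
  induction n with
  | zero => exact ⟨0, le_rfl, rfl⟩
  | succ n ih =>
    rcases le_total (rmx a n) |a (n+1)| with h | h
    · exact ⟨n + 1, le_rfl, max_eq_right h⟩
    · obtain ⟨k, hk, e⟩ := ih
      exact ⟨k, by omega, (max_eq_left h).trans e⟩

lemma rmx_ms {π : ℕ → Ω → α} (hπ : Refi π) {X : ℕ → Ω → ℝ} (hX : ∀ n, Ms π n (X n)) (n : ℕ) :
    Ms π n (fun x => rmx (fun k => X k x) n) := by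
  induction n with
  | zero => intro x y h; simp only [rmx, hX 0 x y h]
  | succ n ih => intro x y h; simp only [rmx, hX (n+1) x y h, (ih.succ hπ) x y h]

lemma doob {p : ℝ} (hp : 1 < p) : ∃ C : ℝ, 0 < C ∧ ∀ (Ω α : Type) (_ : Fintype Ω) (π : ℕ → Ω → α)
    (_ : Refi π) (Y : ℕ → Ω → ℝ) (_ : Mart π Y) (_ : ∀ n x, 0 ≤ Y n x) (N : ℕ),
    ∑ x, rmx (fun k => Y k x) N ^ p ≤ C * ∑ x, Y N x ^ p := by
  have hp1 : 0 < p - 1 := by linarith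
  refine ⟨2 * (p / (p - 1) * ((2 * (p / (p - 1))) ^ (1 / (1:ℝ))) ^ (p - 1)), by positivity, ?_⟩
  intro Ω α _ π hπ Y hY hY0 N
  refine absorb one_pos hp.le (by positivity) (fun x => rmx_nonneg _ _) (fun x => hY0 N x) ?_
  simp only [Real.rpow_one]
  set m : ℕ → Ω → ℝ := fun n x => rmx (fun k => Y k x) n with hm
  have key : ∀ n, 0 ≤ ∑ x, (p / (p - 1) * (m n x ^ (p - 1) * Y n x) - m n x ^ p) := by
    intro n
    induction n with
    | zero =>
      refine sum_nonneg fun x _ => ?_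
      have e : m 0 x = Y 0 x := by simp [hm, rmx, abs_of_nonneg (hY0 0 x)]
      have e2 : Y 0 x ^ (p - 1) * Y 0 x = Y 0 x ^ p := by
        nth_rewrite 2 [← Real.rpow_one (Y 0 x)]
        rw [← Real.rpow_add' (hY0 0 x) (by linarith)]; congr 1; ring
      rw [e, e2]
      have h1 : 1 ≤ p / (p - 1) := by rw [le_div_iff₀ hp1]; linarith
      have h2 : 0 ≤ Y 0 x ^ p := Real.rpow_nonneg (hY0 0 x) p
      nlinarith
    | succ n ih =>
      have hw : Ms π n (fun x => p / (p - 1) * m n x ^ (p - 1)) := by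
        intro x y h
        simp only [hm, rmx_ms hπ hY.ad n x y h]
      have h0 := hY.st n _ hw
      have : ∑ x, (p / (p - 1) * (m n x ^ (p - 1) * Y n x) - m n x ^ p) +
          ∑ x, p / (p - 1) * m n x ^ (p - 1) * (Y (n + 1) x - Y n x) ≤
          ∑ x, (p / (p - 1) * (m (n+1) x ^ (p - 1) * Y (n+1) x) - m (n+1) x ^ p) := by
        rw [← sum_add_distrib]
        refine sum_le_sum fun x _ => ?_
        have hmn : 0 ≤ m n x := rmx_nonneg _ _
        have hms : m (n+1) x = max (m n x) (Y (n+1) x) := by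
          simp only [hm, rmx, abs_of_nonneg (hY0 (n+1) x)]
        rcases le_total (Y (n+1) x) (m n x) with h | h
        · rw [hms, max_eq_left h]; linarith
        · rw [hms, max_eq_right h]
          have hy := hY0 (n+1) x
          set y := Y (n+1) x
          have e2 : y ^ (p - 1) * y = y ^ p := by
            nth_rewrite 2 [← Real.rpow_one y]
            rw [← Real.rpow_add' hy (by linarith)]; congr 1; ring
          have e3 : m n x ^ p = m n x ^ (p - 1) * m n x := by
            nth_rewrite 3 [← Real.rpow_one (m n x)]
            rw [← Real.rpow_add' hmn (by linarith)]; congr 1; ring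
          have ht := tangent hp.le hy hmn
          rw [e2]
          have : p / (p - 1) * y ^ p - y ^ p = y ^ p / (p - 1) := by field_simp; ring
          rw [this]
          have : p / (p - 1) * (m n x ^ (p - 1) * Y n x) - m n x ^ p +
            p / (p - 1) * m n x ^ (p - 1) * (y - Y n x) = (p * m n x ^ (p - 1) * y - (p - 1) * m n x ^ p) / (p - 1) := by
            field_simp; ring
          rw [this]
          gcongr
          nlinarith
      linarith
  have := key N
  rw [sum_sub_distrib, ← mul_sum] at this
  linarith

open Classical in
/-- held process -/
noncomputable def hold (J : ℕ → Prop) (a : ℕ → ℝ) : ℕ → ℝ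
  | 0 => a 0
  | n + 1 => if J n then a (n + 1) else hold J a n

noncomputable def ss (J : ℕ → Prop) (a : ℕ → ℝ) (n : ℕ) : ℝ :=
  ∑ k ∈ range n, (hold J a (k + 1) - hold J a k) ^ 2

lemma ss_nonneg (J : ℕ → Prop) (a : ℕ → ℝ) (n : ℕ) : 0 ≤ ss J a n := sum_nonneg fun _ _ => sq_nonneg _

lemma hold_attained (J : ℕ → Prop) (a : ℕ → ℝ) (n : ℕ) : ∃ k ≤ n, hold J a n = a k := by
  induction n with
  | zero => exact ⟨0, le_rfl, rfl⟩
  | succ n ih =>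
    unfold hold
    split_ifs
    · exact ⟨n+1, le_rfl, rfl⟩
    · obtain ⟨k, hk, e⟩ := ih; exact ⟨k, by omega, e⟩

lemma hold_le (J : ℕ → Prop) (a : ℕ → ℝ) {k n : ℕ} (h : k ≤ n) : |hold J a k| ≤ rmx a n := by
  obtain ⟨i, hi, e⟩ := hold_attained J a k
  rw [e]; exact le_rmx a (by omega)

lemma hold_sub (J : ℕ → Prop) (a b : ℕ → ℝ) (n : ℕ) :
    hold J (fun k => a k - b k) n = hold J a n - hold J b n := by
  induction n with
  | zero => rfl
  | succ n ih =>
    simp only [hold]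
    split_ifs <;> simp [ih]

lemma hold_ms {π : ℕ → Ω → α} (hπ : Refi π) {X : ℕ → Ω → ℝ} (hX : ∀ n, Ms π n (X n))
    {J : Ω → ℕ → Prop} (hJ : ∀ n, Ms π (n + 1) (fun x => J x n)) (n : ℕ) :
    Ms π n (fun x => hold (J x) (fun k => X k x) n) := by
  induction n with
  | zero => intro x y h; simp only [hold, hX 0 x y h]
  | succ n ih =>
    intro x y h
    have h1 := hJ n x y h
    have h2 := hX (n+1) x y h
    have h3 := (ih.succ hπ) x y h
    simp only at h1 h2 h3
    by_cases hj : J y n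
    · have : J x n := by rw [h1]; exact hj
      simp only [hold, if_pos hj, if_pos this, h2]
    · have : ¬ J x n := by rw [h1]; exact hj
      simp only [hold, if_neg hj, if_neg this, h3]

lemma ss_ms {π : ℕ → Ω → α} (hπ : Refi π) {X : ℕ → Ω → ℝ} (hX : ∀ n, Ms π n (X n))
    {J : Ω → ℕ → Prop} (hJ : ∀ n, Ms π (n + 1) (fun x => J x n)) (n : ℕ) :
    Ms π n (fun x => ss (J x) (fun k => X k x) n) := by
  induction n with
  | zero => intro x y h; simp [ss]
  | succ n ih =>
    intro x y h
    have h3 := (ih.succ hπ) x y h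
    have h4 := hold_ms hπ hX hJ (n+1) x y h
    have h5 := ((hold_ms hπ hX hJ n).succ hπ) x y h
    simp only [ss] at h3 h4 h5 ⊢
    rw [sum_range_succ, sum_range_succ, h3, h4, h5]

lemma burk_low {p : ℝ} (hp : 1 < p) (hp2 : p ≤ 2) : ∃ C : ℝ, 0 < C ∧ ∀ (Ω α : Type) (_ : Fintype Ω) (π : ℕ → Ω → α)
    (_ : Refi π) (Y : ℕ → Ω → ℝ) (_ : Mart π Y) (_ : ∀ n x, 0 ≤ Y n x) (J : Ω → ℕ → Prop)
    (_ : ∀ n, Ms π (n + 1) (fun x => J x n)) (N : ℕ),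
    ∑ x, √(ss (J x) (fun k => Y k x) N) ^ p ≤ C * ∑ x, Y N x ^ p := by
  obtain ⟨C, hC, hD⟩ := doob hp
  have hc : 0 < p * (p - 1) / 2 := by nlinarith
  refine ⟨C + 1 / (p * (p - 1) / 2), by positivity, ?_⟩
  intro Ω α _ π hπ Y hY hY0 J hJ N
  set A : Ω → ℝ := fun x => rmx (fun k => Y k x) N with hA
  set H : ℕ → Ω → ℝ := fun n x => hold (J x) (fun k => Y k x) n with hH
  have hH0 : ∀ n x, 0 ≤ H n x := by
    intro n x
    obtain ⟨k, -, e⟩ := hold_attained (J x) (fun k => Y k x) n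
    simp only [hH, e]; exact hY0 k x
  have hHA : ∀ n ≤ N, ∀ x, H n x ≤ A x := fun n hn x => (le_abs_self _).trans (hold_le _ _ hn)
  have hYA : ∀ n ≤ N, ∀ x, Y n x ≤ A x := fun n hn x => (le_abs_self _).trans (le_rmx (fun k => Y k x) hn)
  have key : ∀ n ≤ N, ∑ x, p * (p - 1) / 2 * ss (J x) (fun k => Y k x) n * A x ^ (p - 2) ≤
      ∑ x, (H n x ^ p + p * H n x ^ (p - 1) * (Y n x - H n x)) := by
    intro n
    induction n with
    | zero =>
      intro _
      refine sum_le_sum fun x _ => ?_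
      have : H 0 x = Y 0 x := rfl
      rw [this]; simp [ss]; exact Real.rpow_nonneg (hY0 0 x) p
    | succ n ih =>
      intro hn
      have ih := ih (by omega)
      have hw : Ms π n (fun x => p * H n x ^ (p - 1)) := by
        intro x y h
        simp only [hH, hold_ms hπ hY.ad hJ n x y h]
      have h0 := hY.st n _ hw
      have h1 : ∀ x, p * (p - 1) / 2 * (H (n+1) x - H n x) ^ 2 * A x ^ (p - 2) +
          (H n x ^ p + p * H n x ^ (p - 1) * (Y n x - H n x)) + p * H n x ^ (p - 1) * (Y (n+1) x - Y n x) ≤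
          H (n+1) x ^ p + p * H (n+1) x ^ (p - 1) * (Y (n+1) x - H (n+1) x) := by
        intro x
        by_cases hj : J x n
        · have e : H (n+1) x = Y (n+1) x := by simp [hH, hold, hj]
          rw [e]
          have := taylor hp hp2 (hH0 n x) (hY0 (n+1) x) (hHA n (by omega) x) (hYA (n+1) hn x)
          simp only [sub_self, mul_zero, add_zero]
          linarith
        · have e : H (n+1) x = H n x := by simp [hH, hold, hj]
          rw [e]; simp only [sub_self]; ring_nf; rfl
      have h2 := sum_le_sum (s := univ) fun x _ => h1 x
      rw [sum_add_distrib, sum_add_distrib, h0] at h2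
      have h3 : ∑ x, p * (p - 1) / 2 * ss (J x) (fun k => Y k x) (n+1) * A x ^ (p - 2) =
        ∑ x, p * (p - 1) / 2 * (H (n+1) x - H n x) ^ 2 * A x ^ (p - 2) +
        ∑ x, p * (p - 1) / 2 * ss (J x) (fun k => Y k x) n * A x ^ (p - 2) := by
        rw [← sum_add_distrib]
        refine sum_congr rfl fun x _ => ?_
        rw [ss, sum_range_succ, ← ss]; ring
      linarith
  have h1 := (key N le_rfl).trans (sum_le_sum fun x _ => tangent hp.le (hY0 N x) (hH0 N x))
  have h2 := hD Ω α _ π hπ Y hY hY0 N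
  have h3 : ∀ x, √(ss (J x) (fun k => Y k x) N) ^ p ≤ A x ^ p + ss (J x) (fun k => Y k x) N * A x ^ (p - 2) := by
    intro x
    have hs := ss_nonneg (J x) (fun k => Y k x) N
    have hA0 : 0 ≤ A x := rmx_nonneg _ _
    rcases le_total (√(ss (J x) (fun k => Y k x) N)) (A x) with h | h
    · have := Real.rpow_le_rpow (Real.sqrt_nonneg _) h (by linarith : 0 ≤ p)
      have : 0 ≤ ss (J x) (fun k => Y k x) N * A x ^ (p - 2) := by positivity
      linarith
    · rcases hA0.eq_or_lt with h0 | h0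
      · have : ss (J x) (fun k => Y k x) N = 0 := by
          refine sum_eq_zero fun k hk => ?_
          have hk := mem_range.1 hk
          have a1 := hold_le (J x) (fun k => Y k x) (show k + 1 ≤ N by omega)
          have a2 := hold_le (J x) (fun k => Y k x) (show k ≤ N by omega)
          change _ ≤ A x at a1 a2
          rw [← h0, abs_nonpos_iff] at a1 a2
          simp [a1, a2]
        rw [this, Real.sqrt_zero, Real.zero_rpow (by linarith)]
        simp; positivity
      · have : √(ss (J x) (fun k => Y k x) N) ^ p ≤ ss (J x) (fun k => Y k x) N * A x ^ (p - 2) := by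
          set s := √(ss (J x) (fun k => Y k x) N) with hs'
          have hs0 : 0 < s := h0.trans_le h
          rw [← Real.sq_sqrt hs, ← hs']
          calc s ^ p = s ^ 2 * s ^ (p - 2) := by
                rw [← Real.rpow_natCast, ← Real.rpow_add hs0]; congr 1; push_cast; ring
            _ ≤ _ := by
                exact mul_le_mul_of_nonneg_left (Real.rpow_le_rpow_of_nonpos h0 h (by linarith)) (sq_nonneg _)
        have : 0 ≤ A x ^ p := by positivity
        linarith
  have h4 := sum_le_sum (s := univ) fun x _ => h3 x
  rw [sum_add_distrib] at h4
  have h5 : ∑ x, p * (p - 1) / 2 * ss (J x) (fun k => Y k x) N * A x ^ (p - 2) =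
      p * (p - 1) / 2 * ∑ x, ss (J x) (fun k => Y k x) N * A x ^ (p - 2) := by
    rw [mul_sum]; exact sum_congr rfl fun x _ => by ring
  rw [h5, ← le_div_iff₀' hc] at h1
  calc _ ≤ _ := h4
    _ ≤ C * ∑ x, Y N x ^ p + (∑ x, Y N x ^ p) / (p * (p - 1) / 2) := add_le_add h2 h1
    _ = _ := by ring

lemma burk_high {p : ℝ} (hp2 : 2 ≤ p) : ∃ C : ℝ, 0 < C ∧ ∀ (Ω α : Type) (_ : Fintype Ω) (π : ℕ → Ω → α)
    (_ : Refi π) (Y : ℕ → Ω → ℝ) (_ : Mart π Y) (_ : ∀ n x, 0 ≤ Y n x) (J : Ω → ℕ → Prop)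
    (_ : ∀ n, Ms π (n + 1) (fun x => J x n)) (N : ℕ),
    ∑ x, √(ss (J x) (fun k => Y k x) N) ^ p ≤ C * ∑ x, Y N x ^ p := by
  obtain ⟨C, hC, hD⟩ := doob (show 1 < p by linarith)
  refine ⟨2 * (4 * p * ((2 * (4 * p)) ^ (1 / (2:ℝ))) ^ (p - 2)) * C, by positivity, ?_⟩
  intro Ω α _ π hπ Y hY hY0 J hJ N
  set A : Ω → ℝ := fun x => rmx (fun k => Y k x) N with hA
  set H : ℕ → Ω → ℝ := fun n x => hold (J x) (fun k => Y k x) n with hH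
  set s : ℕ → Ω → ℝ := fun n x => ss (J x) (fun k => Y k x) n with hs
  set w : ℕ → Ω → ℝ := fun n x => s n x ^ (p / 2 - 1) with hw
  have hs0 : ∀ n x, 0 ≤ s n x := fun n x => ss_nonneg _ _ _
  have hA0 : ∀ x, 0 ≤ A x := fun x => rmx_nonneg _ _
  have hw0 : ∀ n x, 0 ≤ w n x := fun n x => Real.rpow_nonneg (hs0 n x) _
  have hHA : ∀ n ≤ N, ∀ x, |H n x| ≤ A x := fun n hn x => (hold_le _ _ hn)
  have hYA : ∀ n ≤ N, ∀ x, |Y n x| ≤ A x := fun n hn x => (le_rmx (fun k => Y k x) hn)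
  have hss : ∀ n x, s (n+1) x = s n x + (H (n+1) x - H n x) ^ 2 := by
    intro n x; simp only [hs, ss, sum_range_succ]; rfl
  have hwm : ∀ n x, w n x ≤ w (n+1) x := by
    intro n x
    refine Real.rpow_le_rpow (hs0 n x) ?_ (by linarith)
    rw [hss]; nlinarith [sq_nonneg (H (n+1) x - H n x)]
  have pt : ∀ x, ∀ n ≤ N, ∑ k ∈ range n, (w (k+1) x * (s (k+1) x - s k x) + 2 * w k x * H k x * (Y (k+1) x - Y k x)) ≤
      w n x * (2 * H n x * Y n x - H n x ^ 2) + 7 * w n x * A x ^ 2 := by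
    intro x n
    induction n with
    | zero =>
      intro _
      have : H 0 x = Y 0 x := rfl
      rw [this]; simp only [range_zero, sum_empty]
      have := hw0 0 x
      have h1 : 0 ≤ 7 * w 0 x * A x ^ 2 := by positivity
      nlinarith [mul_nonneg this (sq_nonneg (Y 0 x))]
    | succ n ih =>
      intro hn
      rw [sum_range_succ]
      have ih := ih (by omega)
      have e : 2 * H (n+1) x * Y (n+1) x - H (n+1) x ^ 2 - (2 * H n x * Y n x - H n x ^ 2) =
          2 * H n x * (Y (n+1) x - Y n x) + (H (n+1) x - H n x) ^ 2 := by
        by_cases hj : J x n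
        · have e : H (n+1) x = Y (n+1) x := by simp [hH, hold, hj]
          rw [e]; ring
        · have e : H (n+1) x = H n x := by simp [hH, hold, hj]
          rw [e]; ring
      have hd : s (n+1) x - s n x = (H (n+1) x - H n x) ^ 2 := by rw [hss]; ring
      have a1 := abs_le.1 (hHA n (by omega) x)
      have a2 := abs_le.1 (hHA (n+1) hn x)
      have a3 := abs_le.1 (hYA (n+1) hn x)
      have b1 : (H (n+1) x - H n x) ^ 2 ≤ 4 * A x ^ 2 := by nlinarith
      have b2 : -(2 * H (n+1) x * Y (n+1) x - H (n+1) x ^ 2) ≤ 3 * A x ^ 2 := by nlinarith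
      have b3 : 0 ≤ (w (n+1) x - w n x) * (7 * A x ^ 2 - ((H (n+1) x - H n x) ^ 2 - (2 * H (n+1) x * Y (n+1) x - H (n+1) x ^ 2))) :=
        mul_nonneg (sub_nonneg.2 (hwm n x)) (by linarith)
      rw [hd]
      have ew := congrArg (fun t => w n x * t) e
      linarith
  have h1 : ∀ x, s N x ^ (p / 2) ≤ ∑ k ∈ range N, p / 2 * (w (k+1) x * (s (k+1) x - s k x)) := by
    intro x
    have : s N x ^ (p / 2) = ∑ k ∈ range N, (s (k+1) x ^ (p / 2) - s k x ^ (p / 2)) := by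
      rw [sum_range_sub (fun k => s k x ^ (p / 2))]
      have : s 0 x = 0 := by simp [hs, ss]
      rw [this, Real.zero_rpow (by linarith)]; ring
    rw [this]
    refine sum_le_sum fun k _ => ?_
    have := tangent (show 1 ≤ p / 2 by linarith) (hs0 k x) (hs0 (k+1) x)
    simp only [hw]
    linarith
  have h2 : ∑ x, ∑ k ∈ range N, 2 * w k x * H k x * (Y (k+1) x - Y k x) = 0 := by
    rw [sum_comm]
    refine sum_eq_zero fun k _ => hY.st k (fun x => 2 * w k x * H k x) ?_
    intro x y h
    simp only [hw, hs, hH, hold_ms hπ hY.ad hJ k x y h, ss_ms hπ hY.ad hJ k x y h]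
  have h3 : ∀ x, √(s N x) ^ p = s N x ^ (p / 2) := by
    intro x
    rw [Real.sqrt_eq_rpow, ← Real.rpow_mul (hs0 N x)]; congr 1; ring
  have h4 : ∀ x, √(s N x) ^ (p - 2) = w N x := by
    intro x
    rw [Real.sqrt_eq_rpow, ← Real.rpow_mul (hs0 N x)]; congr 1; ring
  have h5 : ∑ x, √(s N x) ^ p ≤ 4 * p * ∑ x, √(s N x) ^ (p - 2) * A x ^ (2:ℝ) := by
    have e1 : ∑ x, √(s N x) ^ p ≤ p / 2 * ∑ x, ∑ k ∈ range N, (w (k+1) x * (s (k+1) x - s k x)) := by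
      rw [mul_sum]
      refine sum_le_sum fun x _ => ?_
      rw [h3, mul_sum]; exact h1 x
    have e2 : ∑ x, ∑ k ∈ range N, (w (k+1) x * (s (k+1) x - s k x)) ≤ ∑ x, 8 * (w N x * A x ^ 2) := by
      have := sum_le_sum (s := univ) fun x _ => pt x N le_rfl
      simp only [sum_add_distrib, h2, add_zero] at this ⊢
      refine this.trans ?_
      rw [← sum_add_distrib]
      refine sum_le_sum fun x _ => ?_
      have : 2 * H N x * Y N x - H N x ^ 2 ≤ A x ^ 2 := by
        have a3 := abs_le.1 (hYA N le_rfl x)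
        nlinarith [sq_nonneg (H N x - Y N x)]
      nlinarith [hw0 N x]
    rw [← mul_sum] at e2
    simp only [h4, Real.rpow_two]
    nlinarith
  have h6 := absorb (by norm_num) hp2 (by positivity) (fun x => Real.sqrt_nonneg _) hA0 h5
  refine h6.trans ?_
  rw [mul_assoc _ C]
  gcongr
  exact hD Ω α _ π hπ Y hY hY0 N

end mart
end DF

namespace DF
open Finset
set_option linter.unusedVariables false

lemma nm_of_sum {Ω : Type} [Fintype Ω] {p C : ℝ} (hp : 0 < p) (hC : 0 ≤ C) {g h : Ω → ℝ}
    (hg : ∀ x, 0 ≤ g x) (hh : ∀ x, 0 ≤ h x) (H : ∑ x, g x ^ p ≤ C * ∑ x, h x ^ p) :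
    nm p g ≤ C ^ (1 / p) * nm p h := by
  rw [nm_le_iff hp (mul_nonneg (by positivity) (nm_nonneg _ _)), Real.mul_rpow (by positivity) (nm_nonneg _ _),
    ← Real.rpow_mul hC, one_div_mul_cancel hp.ne', Real.rpow_one, nm_rpow hp]
  simpa only [abs_of_nonneg (hg _), abs_of_nonneg (hh _)] using H

lemma burk {p : ℝ} (hp : 1 < p) : ∃ C : ℝ, 0 < C ∧ ∀ (Ω α : Type) (_ : Fintype Ω) (π : ℕ → Ω → α)
    (_ : Refi π) (Y : ℕ → Ω → ℝ) (_ : Mart π Y) (_ : ∀ n x, 0 ≤ Y n x) (J : Ω → ℕ → Prop)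
    (_ : ∀ n, Ms π (n + 1) (fun x => J x n)) (N : ℕ),
    ∑ x, √(ss (J x) (fun k => Y k x) N) ^ p ≤ C * ∑ x, Y N x ^ p := by
  rcases le_total p 2 with h | h
  · exact burk_low hp h
  · exact burk_high h

lemma ss_sub_le (J : ℕ → Prop) (a b : ℕ → ℝ) (n : ℕ) :
    √(ss J (fun k => a k - b k) n) ≤ 2 * (√(ss J a n) + √(ss J b n)) := by
  refine Real.sqrt_le_iff.2 ⟨by positivity, ?_⟩
  have h1 : ss J (fun k => a k - b k) n ≤ 2 * (ss J a n + ss J b n) := by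
    unfold ss
    rw [← sum_add_distrib, mul_sum]
    refine sum_le_sum fun k _ => ?_
    rw [hold_sub, hold_sub]
    nlinarith [sq_nonneg ((hold J a (k + 1) - hold J a k) + (hold J b (k + 1) - hold J b k))]
  have h2 := Real.sq_sqrt (ss_nonneg J a n)
  have h3 := Real.sq_sqrt (ss_nonneg J b n)
  nlinarith [mul_nonneg (Real.sqrt_nonneg (ss J a n)) (Real.sqrt_nonneg (ss J b n)), ss_nonneg J a n, ss_nonneg J b n]

lemma rmx_sub_le (a b : ℕ → ℝ) (n : ℕ) : rmx (fun k => a k - b k) n ≤ rmx a n + rmx b n := by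
  obtain ⟨k, hk, e⟩ := rmx_attained (fun k => a k - b k) n
  rw [e]
  exact (abs_sub _ _).trans (add_le_add (le_rmx a hk) (le_rmx b hk))

lemma mart_bd {p : ℝ} (hp : 1 < p) : ∃ C : ℝ, 0 < C ∧ ∀ (Ω α : Type) (_ : Fintype Ω) (π : ℕ → Ω → α)
    (_ : Refi π) (N : ℕ) (_ : Function.Injective (π N)) (f : Ω → ℝ),
    nm p (fun x => rmx (fun k => E π k f x) N) ≤ C * nm p f ∧
    ∀ (J : Ω → ℕ → Prop) (_ : ∀ n, Ms π (n + 1) (fun x => J x n)),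
      nm p (fun x => √(ss (J x) (fun k => E π k f x) N)) ≤ C * nm p f := by
  obtain ⟨A, hA, hD⟩ := doob hp
  obtain ⟨B, hB, hS⟩ := burk hp
  have hp0 : 0 < p := by linarith
  refine ⟨2 * A ^ (1 / p) + 4 * B ^ (1 / p), by positivity, ?_⟩
  intro Ω α _ π hπ N hN f
  set f1 : Ω → ℝ := fun x => max (f x) 0
  set f2 : Ω → ℝ := fun x => max (-f x) 0
  have h1 : ∀ x, 0 ≤ f1 x := fun x => le_max_right _ _
  have h2 : ∀ x, 0 ≤ f2 x := fun x => le_max_right _ _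
  have n1 : nm p f1 ≤ nm p f := by
    have : nm p f = nm p (fun x => |f x|) := by simp [nm]
    rw [this]; refine nm_mono hp0 fun x => ?_
    rw [abs_of_nonneg (h1 x)]; exact max_le (le_abs_self _) (abs_nonneg _)
  have n2 : nm p f2 ≤ nm p f := by
    have : nm p f = nm p (fun x => |f x|) := by simp [nm]
    rw [this]; refine nm_mono hp0 fun x => ?_
    rw [abs_of_nonneg (h2 x)]; exact max_le (neg_le_abs _) (abs_nonneg _)
  have hf : f = fun x => f1 x - f2 x := by
    ext x; simp only [f1, f2]
    rcases le_total (f x) 0 with h | h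
    · rw [max_eq_right h, max_eq_left (by linarith)]; ring
    · rw [max_eq_left h, max_eq_right (by linarith)]; ring
  have e : ∀ x, (fun k => E π k f x) = fun k => E π k f1 x - E π k f2 x := by
    intro x; ext k; rw [← E_sub, ← hf]
  have hn := nm_nonneg p f
  have a0 : 0 ≤ A ^ (1 / p) := by positivity
  have b0 : 0 ≤ B ^ (1 / p) := by positivity
  constructor
  · have k1 := nm_of_sum hp0 hA.le (fun x => rmx_nonneg _ _) (fun x => E_nonneg π N h1 x) (hD Ω α _ π hπ _ (E_mart hπ f1) (fun n x => E_nonneg π n h1 x) N)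
    have k2 := nm_of_sum hp0 hA.le (fun x => rmx_nonneg _ _) (fun x => E_nonneg π N h2 x) (hD Ω α _ π hπ _ (E_mart hπ f2) (fun n x => E_nonneg π n h2 x) N)
    simp only [E_inj π hN] at k1 k2
    calc _ ≤ nm p (fun x => rmx (fun k => E π k f1 x) N + rmx (fun k => E π k f2 x) N) := by
          refine nm_mono hp0 fun x => ?_
          rw [abs_of_nonneg (rmx_nonneg _ _), e]
          exact rmx_sub_le _ _ _
      _ ≤ _ := nm_add hp.le _ _
      _ ≤ A ^ (1 / p) * nm p f + A ^ (1 / p) * nm p f := by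
          gcongr
          · exact k1.trans (by gcongr)
          · exact k2.trans (by gcongr)
      _ ≤ _ := by nlinarith
  · intro J hJ
    have k1 := nm_of_sum hp0 hB.le (fun x => Real.sqrt_nonneg _) (fun x => E_nonneg π N h1 x) (hS Ω α _ π hπ _ (E_mart hπ f1) (fun n x => E_nonneg π n h1 x) J hJ N)
    have k2 := nm_of_sum hp0 hB.le (fun x => Real.sqrt_nonneg _) (fun x => E_nonneg π N h2 x) (hS Ω α _ π hπ _ (E_mart hπ f2) (fun n x => E_nonneg π n h2 x) J hJ N)
    simp only [E_inj π hN] at k1 k2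
    calc _ ≤ nm p (fun x => 2 * (√(ss (J x) (fun k => E π k f1 x) N) + √(ss (J x) (fun k => E π k f2 x) N))) := by
          refine nm_mono hp0 fun x => ?_
          rw [abs_of_nonneg (Real.sqrt_nonneg _), e]
          exact ss_sub_le _ _ _ _
      _ = _ := nm_smul hp0 (by norm_num) _
      _ ≤ 2 * (nm p (fun x => √(ss (J x) (fun k => E π k f1 x) N)) + nm p (fun x => √(ss (J x) (fun k => E π k f2 x) N))) :=
          mul_le_mul_of_nonneg_left (nm_add hp.le _ _) (by norm_num)
      _ ≤ 2 * (B ^ (1 / p) * nm p f + B ^ (1 / p) * nm p f) := by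
          gcongr
          · exact k1.trans (by gcongr)
          · exact k2.trans (by gcongr)
      _ ≤ _ := by nlinarith

open Classical in
/-- multiplicative stopping process -/
noncomputable def hm (m : ℕ) (a : ℕ → ℝ) : ℕ → ℝ
  | 0 => a 0
  | n + 1 => if (1/2:ℝ) ^ m * rmx a (n + 1) ≤ |a (n + 1) - hm m a n| then a (n + 1) else hm m a n

def hJ (m : ℕ) (a : ℕ → ℝ) (n : ℕ) : Prop := (1/2:ℝ) ^ m * rmx a (n + 1) ≤ |a (n + 1) - hm m a n|

lemma hm_eq (m : ℕ) (a : ℕ → ℝ) (n : ℕ) : hm m a n = hold (hJ m a) a n := by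
  induction n with
  | zero => rfl
  | succ n ih => unfold hm hold; rw [← ih]; rfl

lemma hm_pos {m : ℕ} {a : ℕ → ℝ} {n : ℕ} (h : hJ m a n) : hm m a (n + 1) = a (n + 1) := by
  rw [hm]; exact if_pos h

lemma hm_neg {m : ℕ} {a : ℕ → ℝ} {n : ℕ} (h : ¬ hJ m a n) : hm m a (n + 1) = hm m a n := by
  rw [hm]; exact if_neg h

lemma hJ_ms {Ω α : Type} [Fintype Ω] {π : ℕ → Ω → α} (hπ : Refi π) {X : ℕ → Ω → ℝ} (hX : ∀ n, Ms π n (X n)) (m : ℕ) :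
    ∀ n, Ms π (n + 1) (fun x => hJ m (fun k => X k x) n) := by
  have key : ∀ n, Ms π n (fun x => hm m (fun k => X k x) n) := by
    intro n
    induction n with
    | zero => intro x y h; exact hX 0 x y h
    | succ n ih =>
      intro x y h
      simp only [hm, hX (n+1) x y h, (ih.succ hπ) x y h, rmx_ms hπ hX (n+1) x y h]
  intro n x y h
  simp only [hJ, hX (n+1) x y h, ((key n).succ hπ) x y h, rmx_ms hπ hX (n+1) x y h]

lemma hm_near (m : ℕ) (a : ℕ → ℝ) (n : ℕ) : |a n - hm m a n| ≤ (1/2:ℝ) ^ m * rmx a n := by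
  cases n with
  | zero => simp only [hm, sub_self, abs_zero]; exact mul_nonneg (by positivity) (rmx_nonneg _ _)
  | succ n =>
    by_cases h : hJ m a n
    · rw [hm_pos h, sub_self, abs_zero]; exact mul_nonneg (by positivity) (rmx_nonneg _ _)
    · rw [hm_neg h]; exact (not_le.1 h).le

/-- last jump -/
lemma last_jump (m : ℕ) (a : ℕ → ℝ) (s : ℕ) : ∀ t, s ≤ t → hm m a t = hm m a s ∨
    ∃ k, s ≤ k ∧ k < t ∧ hJ m a k ∧ ∀ j, k + 1 ≤ j → j ≤ t → hm m a j = a (k + 1) := by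
  intro t hst
  induction t, hst using Nat.le_induction with
  | base => exact Or.inl rfl
  | succ t hst ih =>
    by_cases h : hJ m a t
    · refine Or.inr ⟨t, hst, by omega, h, fun j h1 h2 => ?_⟩
      have : j = t + 1 := by omega
      rw [this, hm_pos h]
    · rcases ih with ih | ⟨k, h1, h2, h3, h4⟩
      · left; rw [hm_neg h, ih]
      · refine Or.inr ⟨k, h1, by omega, h3, fun j h5 h6 => ?_⟩
        rcases Nat.lt_or_ge j (t + 1) with h7 | h7
        · exact h4 j h5 (by omega)
        · have : j = t + 1 := by omega
          rw [this, hm_neg h]; exact h4 t (by omega) le_rfl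

lemma jump {m : ℕ} (hm1 : 1 ≤ m) (a : ℕ → ℝ) {s t : ℕ} (hst : s ≤ t) (hM : 0 < rmx a t)
    (hD : 4 * (1/2:ℝ) ^ m * rmx a t ≤ |a t - a s|) :
    ∃ k, s ≤ k ∧ k < t ∧ (1/2:ℝ) ^ m * rmx a t / 2 ≤ |hm m a (k + 1) - hm m a k| := by
  have h2 : (0:ℝ) < (1/2) ^ m := by positivity
  have n1 := hm_near m a t
  have n2 := hm_near m a s
  have n3 : (1/2:ℝ) ^ m * rmx a s ≤ (1/2:ℝ) ^ m * rmx a t := by gcongr; exact rmx_mono a hst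
  rcases last_jump m a s t hst with h | ⟨k, h1, h2', h3, h4⟩
  · exfalso
    rw [h] at n1
    have : |a t - a s| ≤ |a t - hm m a s| + |a s - hm m a s| := by
      rw [abs_sub_comm (a s)]; exact abs_sub_le _ _ _
    nlinarith [mul_pos h2 hM]
  · refine ⟨k, h1, h2', ?_⟩
    rw [hm_pos h3]
    have h5 : (1/2:ℝ) ^ m * rmx a (k + 1) ≤ |a (k + 1) - hm m a k| := h3
    have h6 : rmx a t / 2 ≤ rmx a (k + 1) := by
      obtain ⟨j, hj, e⟩ := rmx_attained a t
      rcases Nat.lt_or_ge j (k + 1) with hlt | hge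
      · have := le_rmx a hlt.le
        rw [e]; have := abs_nonneg (a j); linarith
      · have h7 := hm_near m a j
        rw [h4 j hge hj] at h7
        have h8 : (1/2:ℝ) ^ m ≤ 1/2 := by
          calc (1/2:ℝ) ^ m ≤ (1/2) ^ 1 := pow_le_pow_of_le_one (by norm_num) (by norm_num) hm1
            _ = 1/2 := by norm_num
        have h9 : rmx a j ≤ rmx a t := rmx_mono a hj
        have h10 : (1/2:ℝ) ^ m * rmx a j ≤ 1/2 * rmx a t := by
          have := rmx_nonneg a j
          gcongr
        have h11 := le_rmx_self a (k + 1)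
        have h12 := abs_sub_abs_le_abs_sub (a j) (a (k + 1))
        linarith
    calc _ = (1/2:ℝ) ^ m * (rmx a t / 2) := by ring
      _ ≤ (1/2:ℝ) ^ m * rmx a (k + 1) := by gcongr
      _ ≤ _ := h5

lemma pair_bd {r : ℝ} (hr : 2 < r) (a : ℕ → ℝ) {s t N : ℕ} (hst : s ≤ t) (htN : t ≤ N) :
    ∃ m : ℕ, |a t - a s| ^ r ≤ 256 * (8:ℝ) ^ (r - 2) * (((1/2:ℝ) ^ (r - 2)) ^ m * rmx a N ^ (r - 2)) *
      ∑ k ∈ Ico s t, (hm m a (k + 1) - hm m a k) ^ 2 := by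
  set D := |a t - a s| with hDd
  rcases (abs_nonneg (a t - a s)).eq_or_lt with h0 | h0
  · refine ⟨0, ?_⟩
    rw [hDd, ← h0, Real.zero_rpow (by linarith)]
    have := rmx_nonneg a N
    positivity
  · change 0 < D at h0
    have hD2 : D ≤ 2 * rmx a t := by
      have := abs_sub (a t) (a s)
      have h1 := le_rmx_self a t
      have h2 := le_rmx a hst
      linarith
    have hM : 0 < rmx a t := by linarith
    obtain ⟨n, h1, h2⟩ := exists_nat_pow_near_of_lt_one (x := D / (4 * rmx a t)) (y := 1/2) (by positivity)
      (by rw [div_le_one (by positivity)]; linarith) (by norm_num) (by norm_num)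
    rw [lt_div_iff₀ (by positivity)] at h1
    rw [div_le_iff₀ (by positivity)] at h2
    set m := n + 1
    have h2' : D ≤ 8 * (1/2:ℝ) ^ m * rmx a t := by
      simp only [m, pow_succ]; linarith
    obtain ⟨k, hk1, hk2, hk3⟩ := jump (m := m) (by omega) a hst hM (by rw [← hDd]; linarith)
    refine ⟨m, ?_⟩
    have hMN := rmx_mono a htN
    have e1 : D ^ r = D ^ (r - 2) * D ^ 2 := by
      rw [← Real.rpow_natCast D 2, ← Real.rpow_add h0]; congr 1; push_cast; ring
    have e2 : D ^ 2 ≤ 256 * ∑ k ∈ Ico s t, (hm m a (k + 1) - hm m a k) ^ 2 := by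
      have h3 : (hm m a (k + 1) - hm m a k) ^ 2 ≤ ∑ k ∈ Ico s t, (hm m a (k + 1) - hm m a k) ^ 2 :=
        single_le_sum (f := fun k => (hm m a (k + 1) - hm m a k) ^ 2) (fun _ _ => sq_nonneg _) (mem_Ico.2 ⟨hk1, hk2⟩)
      have h4 : D ≤ 16 * |hm m a (k + 1) - hm m a k| := by linarith
      have h5 : D ^ 2 ≤ (16 * |hm m a (k + 1) - hm m a k|) ^ 2 := by gcongr
      rw [mul_pow, sq_abs (hm m a (k + 1) - hm m a k)] at h5
      linarith
    have e3 : D ^ (r - 2) ≤ (8:ℝ) ^ (r - 2) * (((1/2:ℝ) ^ (r - 2)) ^ m * rmx a N ^ (r - 2)) := by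
      calc D ^ (r - 2) ≤ (8 * (1/2:ℝ) ^ m * rmx a N) ^ (r - 2) := by
            refine Real.rpow_le_rpow h0.le (h2'.trans ?_) (by linarith)
            gcongr
        _ = _ := by
            have := rmx_nonneg a N
            rw [Real.mul_rpow (by positivity) this, Real.mul_rpow (by norm_num) (by positivity),
              ← Real.rpow_natCast, ← Real.rpow_mul (by norm_num), mul_comm (m:ℝ), Real.rpow_mul (by norm_num),
              Real.rpow_natCast]
            ring
    rw [e1]
    have := rmx_nonneg a N
    calc _ ≤ ((8:ℝ) ^ (r - 2) * (((1/2:ℝ) ^ (r - 2)) ^ m * rmx a N ^ (r - 2))) *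
          (256 * ∑ k ∈ Ico s t, (hm m a (k + 1) - hm m a k) ^ 2) := by gcongr
      _ = _ := by ring

lemma sum_Ico_mono (g : ℕ → ℝ) {u : ℕ → ℕ} (hu : Monotone u) (J : ℕ) :
    ∑ j ∈ range J, ∑ k ∈ Ico (u j) (u (j + 1)), g k = ∑ k ∈ Ico (u 0) (u J), g k := by
  induction J with
  | zero => simp
  | succ J ih =>
    rw [sum_range_succ, ih, sum_Ico_consecutive _ (hu (by omega)) (hu (by omega))]

lemma lepingle {p r : ℝ} (hp : 1 < p) (hr : 2 < r) : ∃ C : ℝ, 0 < C ∧ ∀ (Ω α : Type) (_ : Fintype Ω)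
    (π : ℕ → Ω → α) (_ : Refi π) (N : ℕ) (_ : Function.Injective (π N)) (f : Ω → ℝ),
    ∃ W : Ω → ℝ, nm p W ≤ C * nm p f ∧ ∀ x, VDom r (fun n => (E π n f x : ℂ)) (N + 1) (W x) := by
  obtain ⟨C, hC, hB⟩ := mart_bd hp
  have hp0 : 0 < p := by linarith
  set ρ : ℝ := (1/2:ℝ) ^ (r - 2) with hρ
  have hρ0 : 0 < ρ := by positivity
  have hρ1 : ρ < 1 := Real.rpow_lt_one (by norm_num) (by norm_num) (by linarith)
  set σ : ℝ := √ρ with hσ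
  have hσ0 : 0 < σ := Real.sqrt_pos.2 hρ0
  have hσ1 : σ < 1 := by rw [hσ, Real.sqrt_lt' one_pos]; simpa using hρ1
  have hσ2 : σ ^ 2 = ρ := Real.sq_sqrt hρ0.le
  set c : ℝ := 256 * (8:ℝ) ^ (r - 2) with hc
  have hc0 : 0 < c := by positivity
  have h1σ : 0 < 1 - σ := by linarith
  refine ⟨c ^ (1 / r) * (C + 1 / (1 - σ) * C), by positivity, ?_⟩
  intro Ω α _ π hπ N hN f
  obtain ⟨hmax, hsq⟩ := hB Ω α _ π hπ N hN f
  set X : Ω → ℕ → ℝ := fun x k => E π k f x with hX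
  have hall : ∀ i : Ω × Fin (N + 1) × Fin (N + 1), ∃ m : ℕ, (i.2.1 : ℕ) ≤ i.2.2 →
      |X i.1 i.2.2 - X i.1 i.2.1| ^ r ≤ c * (ρ ^ m * rmx (X i.1) N ^ (r - 2)) *
        ∑ k ∈ Ico (i.2.1 : ℕ) i.2.2, (hm m (X i.1) (k + 1) - hm m (X i.1) k) ^ 2 := by
    rintro ⟨x, s, t⟩
    by_cases h : (s : ℕ) ≤ t
    · obtain ⟨m, hm⟩ := pair_bd hr (X x) h (show (t:ℕ) ≤ N by omega)
      exact ⟨m, fun _ => hm⟩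
    · exact ⟨0, fun h' => absurd h' h⟩
  choose mm hmm using hall
  set L := univ.sup mm + 1 with hL
  have hmL : ∀ i, mm i ∈ range L := fun i => mem_range.2 (Nat.lt_succ_of_le (le_sup (mem_univ i)))
  set S : ℕ → Ω → ℝ := fun m x => √(ss (hJ m (X x)) (X x) N) with hS
  have hS0 : ∀ m x, 0 ≤ S m x := fun m x => Real.sqrt_nonneg _
  have hSS : ∀ m x, S m x ^ 2 = ∑ k ∈ range N, (hm m (X x) (k + 1) - hm m (X x) k) ^ 2 := by
    intro m x
    rw [hS, Real.sq_sqrt (ss_nonneg _ _ _)]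
    simp only [ss, hm_eq]
  set Q : Ω → ℝ := fun x => rmx (X x) N + ∑ m ∈ range L, σ ^ m * S m x with hQ
  have hsum0 : ∀ x, 0 ≤ ∑ m ∈ range L, σ ^ m * S m x := fun x =>
    sum_nonneg fun m _ => mul_nonneg (by positivity) (hS0 m x)
  have hQ0 : ∀ x, 0 ≤ Q x := fun x => add_nonneg (rmx_nonneg _ _) (hsum0 x)
  refine ⟨fun x => c ^ (1 / r) * Q x, ?_, ?_⟩
  · rw [nm_smul hp0 (by positivity), mul_assoc]
    refine mul_le_mul_of_nonneg_left ?_ (by positivity)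
    rw [add_mul]
    refine (nm_add hp.le _ _).trans (add_le_add hmax ?_)
    refine (nm_sum hp.le _ _).trans ?_
    calc _ ≤ ∑ m ∈ range L, σ ^ m * (C * nm p f) := by
          refine sum_le_sum fun m _ => ?_
          rw [nm_smul hp0 (by positivity)]
          exact mul_le_mul_of_nonneg_left (hsq _ (hJ_ms hπ (fun n => E_ms π n f) m)) (by positivity)
      _ = (∑ m ∈ range L, σ ^ m) * (C * nm p f) := by rw [sum_mul]
      _ ≤ (1 / (1 - σ)) * (C * nm p f) := by
          refine mul_le_mul_of_nonneg_right ?_ (mul_nonneg hC.le (nm_nonneg _ _))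
          have := (summable_geometric_of_lt_one hσ0.le hσ1).sum_le_tsum (range L) (fun _ _ => by positivity)
          rwa [tsum_geometric_of_lt_one hσ0.le hσ1, ← one_div] at this
      _ = _ := by ring
  · intro x
    refine ⟨mul_nonneg (by positivity) (hQ0 x), fun J u hu huN => ?_⟩
    have hle : ∀ j ≤ J, u j < N + 1 := fun j hj => (hu hj).trans_lt huN
    have hM0 := rmx_nonneg (X x) N
    have step : ∀ j ∈ range J, ‖(E π (u (j + 1)) f x : ℂ) - (E π (u j) f x : ℂ)‖ ^ r ≤
        ∑ m ∈ range L, c * (ρ ^ m * rmx (X x) N ^ (r - 2)) *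
          ∑ k ∈ Ico (u j) (u (j + 1)), (hm m (X x) (k + 1) - hm m (X x) k) ^ 2 := by
      intro j hj
      have hj := mem_range.1 hj
      have h1 := hmm (x, ⟨u j, hle j hj.le⟩, ⟨u (j+1), hle (j+1) hj⟩) (hu (Nat.le_succ j))
      rw [← Complex.ofReal_sub, Complex.norm_real, Real.norm_eq_abs]
      refine h1.trans ?_
      exact single_le_sum (f := fun m => c * (ρ ^ m * rmx (X x) N ^ (r - 2)) *
          ∑ k ∈ Ico (u j) (u (j + 1)), (hm m (X x) (k + 1) - hm m (X x) k) ^ 2)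
          (fun m _ => mul_nonneg (by positivity) (sum_nonneg fun _ _ => sq_nonneg _)) (hmL _)
    refine (sum_le_sum step).trans ?_
    rw [sum_comm]
    have h2 : ∀ m ∈ range L, ∑ j ∈ range J, c * (ρ ^ m * rmx (X x) N ^ (r - 2)) *
          ∑ k ∈ Ico (u j) (u (j + 1)), (hm m (X x) (k + 1) - hm m (X x) k) ^ 2 ≤
          c * rmx (X x) N ^ (r - 2) * (σ ^ m * S m x) ^ 2 := by
      intro m _
      rw [← mul_sum, sum_Ico_mono _ hu]
      have : ∑ k ∈ Ico (u 0) (u J), (hm m (X x) (k + 1) - hm m (X x) k) ^ 2 ≤ S m x ^ 2 := by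
        rw [hSS]
        refine sum_le_sum_of_subset_of_nonneg ?_ fun _ _ _ => sq_nonneg _
        intro k hk; rw [mem_Ico] at hk; rw [mem_range]; omega
      calc _ ≤ c * (ρ ^ m * rmx (X x) N ^ (r - 2)) * S m x ^ 2 := by gcongr
        _ = _ := by rw [mul_pow, ← pow_mul, mul_comm m, pow_mul, hσ2]; ring
    refine (sum_le_sum h2).trans ?_
    rw [← mul_sum, Real.mul_rpow (by positivity) (hQ0 x), ← Real.rpow_mul hc0.le,
      one_div_mul_cancel (by linarith), Real.rpow_one, mul_assoc]
    have h3 : ∑ m ∈ range L, (σ ^ m * S m x) ^ 2 ≤ (∑ m ∈ range L, σ ^ m * S m x) ^ 2 :=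
      sum_sq_le_sq_sum_of_nonneg fun m _ => mul_nonneg (by positivity) (hS0 m x)
    have hMQ : rmx (X x) N ≤ Q x := by have := hsum0 x; simp only [hQ]; linarith
    have hsQ : ∑ m ∈ range L, σ ^ m * S m x ≤ Q x := by simp only [hQ]; linarith
    have e1 : Q x ^ r = Q x ^ (r - 2) * Q x ^ 2 := by
      rw [← Real.rpow_natCast (Q x) 2, ← Real.rpow_add' (hQ0 x) (by push_cast; linarith)]; congr 1; push_cast; ring
    rw [e1]
    have := hQ0 x
    refine mul_le_mul_of_nonneg_left ?_ hc0.le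
    refine mul_le_mul (Real.rpow_le_rpow hM0 hMQ (by linarith)) (h3.trans ?_) (sum_nonneg fun _ _ => sq_nonneg _) (by positivity)
    have := hsum0 x
    gcongr

lemma VDom.reverse {r : ℝ} {a : ℕ → ℂ} {K : ℕ} {w : ℝ} (h : VDom r a (K + 1) w) :
    VDom r (fun n => a (K - n)) (K + 1) w := by
  refine ⟨h.1, fun J u hu hL => ?_⟩
  have := h.2 J (fun j => K - u (J - j)) (fun i j hij => by
    have := hu (show J - j ≤ J - i by omega)
    simp only; omega) (by omega)
  refine le_trans (le_of_eq ?_) this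
  rw [← sum_range_reflect]
  refine sum_congr rfl fun j hj => ?_
  have hj := mem_range.1 hj
  rw [show J - 1 - j + 1 = J - j by omega, show J - 1 - j = J - (j + 1) by omega, norm_sub_rev]

end DF

namespace DF
open Finset
set_option linter.unusedVariables false

lemma nm_pow {Ω : Type*} [Fintype Ω] {p q : ℝ} (hp : 0 < p) (hq : 0 < q) {f : Ω → ℝ} (hf : ∀ x, 0 ≤ f x) :
    nm q (fun x => f x ^ (p / q)) = (∑ x, f x ^ p) ^ (1 / q) := by
  unfold nm
  congr 1
  refine sum_congr rfl fun x _ => ?_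
  rw [abs_of_nonneg (Real.rpow_nonneg (hf x) _), ← Real.rpow_mul (hf x), div_mul_cancel₀ _ hq.ne']

/-- analytic power of a complex number -/
noncomputable def cpw (v : ℂ) (s : ℝ) (z : ℂ) : ℂ := v / (s : ℂ) * Complex.exp (Real.log s * z)

lemma cpw_norm {v : ℂ} {s : ℝ} (hs : 0 ≤ s) {z : ℂ} (hz : 0 < z.re) :
    ‖cpw v s z‖ = ‖v‖ / s * s ^ z.re := by
  unfold cpw
  rw [norm_mul, norm_div, Complex.norm_real, Real.norm_of_nonneg hs, Complex.norm_exp]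
  rcases hs.eq_or_lt with rfl | hs
  · simp
  · congr 1
    rw [Real.rpow_def_of_pos hs]; simp

theorem riesz_thorin {Ω κ : Type} [Fintype Ω] [Fintype κ] (T : (Ω → ℂ) →ₗ[ℂ] (κ → Ω → ℂ))
    {p0 p1 p θ A B : ℝ} (h0 : 1 < p0) (h1 : 1 < p1) (hθ0 : 0 ≤ θ) (hθ1 : θ ≤ 1) (hp0 : 0 < p)
    (hp : 1 / p = (1 - θ) / p0 + θ / p1) (hA : 0 ≤ A) (hB : 0 ≤ B)
    (H0 : ∀ f, nm p0 (sqn (T f)) ≤ A * nm p0 (fun x => ‖f x‖))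
    (H1 : ∀ f, nm p1 (sqn (T f)) ≤ B * nm p1 (fun x => ‖f x‖)) (f : Ω → ℂ) :
    nm p (sqn (T f)) ≤ A ^ (1 - θ) * B ^ θ * nm p (fun x => ‖f x‖) := by
  set q0 := Real.conjExponent p0
  set q1 := Real.conjExponent p1
  have hc0 : p0.HolderConjugate q0 := Real.HolderConjugate.conjExponent h0
  have hc1 : p1.HolderConjugate q1 := Real.HolderConjugate.conjExponent h1
  have hq0 : 0 < q0 := hc0.symm.pos
  have hq1 : 0 < q1 := hc1.symm.pos
  have hp00 : 0 < p0 := by linarith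
  have hp10 : 0 < p1 := by linarith
  have i0 : 1 / q0 = 1 - 1 / p0 := by
    have := hc0.inv_add_inv_eq_one
    rw [one_div, one_div]; linarith
  have i1 : 1 / q1 = 1 - 1 / p1 := by
    have := hc1.inv_add_inv_eq_one
    rw [one_div, one_div]; linarith
  set S := sqn (T f) with hS
  have hS0 : ∀ x, 0 ≤ S x := fun x => sqn_nonneg _ _
  set P := ∑ x, S x ^ p with hP
  have hPn : 0 ≤ P := sum_nonneg fun x _ => Real.rpow_nonneg (hS0 x) _
  set Q := ∑ x, ‖f x‖ ^ p with hQ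
  have hQn : 0 ≤ Q := sum_nonneg fun x _ => Real.rpow_nonneg (norm_nonneg _) _
  have nS : nm p S = P ^ (1 / p) := by simp only [nm, abs_of_nonneg (hS0 _), hP]
  have nf : nm p (fun x => ‖f x‖) = Q ^ (1 / p) := by simp [nm, hQ]
  rw [nS, nf]
  rcases hPn.eq_or_lt with hP0 | hP0
  · rw [← hP0, Real.zero_rpow (by positivity)]; positivity
  -- analytic family
  set α : ℂ → ℂ := fun z => (p:ℂ) * ((1 - z) / p0 + z / p1) with hα
  set β : ℂ → ℂ := fun z => (p:ℂ) * ((1 - z) / q0 + z / q1) with hβ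
  have rα : ∀ z, (α z).re = p * ((1 - z.re) / p0 + z.re / p1) := by
    intro z; simp [hα, Complex.div_ofReal_re]
  have rβ : ∀ z, (β z).re = p * ((1 - z.re) / q0 + z.re / q1) := by
    intro z; simp [hβ, Complex.div_ofReal_re]
  have pos_aux : ∀ a b t : ℝ, 0 < a → 0 < b → 0 ≤ t → t ≤ 1 → 0 < p * ((1 - t) / a + t / b) := by
    intro a b t ha hb ht0 ht1
    refine mul_pos hp0 ?_
    rcases ht0.eq_or_lt with rfl | ht
    · simp; exact ha
    · have : 0 < t / b := by positivity
      have : 0 ≤ (1 - t) / a := div_nonneg (by linarith) ha.le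
      linarith
  have le_aux : ∀ a b t : ℝ, 0 < a → 0 < b → 0 ≤ t → t ≤ 1 → p * ((1 - t) / a + t / b) ≤ p * (1 / a + 1 / b) := by
    intro a b t ha hb ht0 ht1
    gcongr
    linarith
  set fz : ℂ → Ω → ℂ := fun z x => cpw (f x) ‖f x‖ (α z) with hfz
  set gz : ℂ → κ → Ω → ℂ := fun z k x => cpw ((starRingEnd ℂ) (T f k x)) (S x) (β z) with hgz
  have nfz : ∀ z : ℂ, 0 ≤ z.re → z.re ≤ 1 → ∀ x, ‖fz z x‖ = ‖f x‖ ^ (α z).re := by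
    intro z hz0 hz1 x
    have hpos : 0 < (α z).re := by rw [rα]; exact pos_aux _ _ _ hp00 hp10 hz0 hz1
    simp only [hfz]
    rw [cpw_norm (norm_nonneg _) hpos]
    rcases (norm_nonneg (f x)).eq_or_lt with h | h
    · rw [← h, Real.zero_rpow hpos.ne', mul_zero]
    · rw [div_self h.ne', one_mul]
  have ngz : ∀ z : ℂ, 0 ≤ z.re → z.re ≤ 1 → ∀ x, sqn (gz z) x = S x ^ (β z).re := by
    intro z hz0 hz1 x
    have hpos : 0 < (β z).re := by rw [rβ]; exact pos_aux _ _ _ hq0 hq1 hz0 hz1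
    have e : ∑ k, ‖gz z k x‖ ^ 2 = (S x / S x * S x ^ (β z).re) ^ 2 := by
      simp only [hgz, cpw_norm (hS0 x) hpos, mul_pow, div_pow, RCLike.norm_conj]
      rw [← sum_mul, ← sum_div, ← sqn_sq]
    unfold sqn
    rw [e, Real.sqrt_sq (mul_nonneg (div_nonneg (hS0 x) (hS0 x)) (Real.rpow_nonneg (hS0 x) _))]
    rcases (hS0 x).eq_or_lt with h | h
    · rw [← h, Real.zero_rpow hpos.ne', mul_zero]
    · rw [div_self h.ne', one_mul]
  set Φ : ℂ → ℂ := fun z => ∑ x, ∑ k, T (fz z) k x * gz z k x with hΦ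
  have hhol : ∀ {s s' D : ℝ}, s.HolderConjugate s' → (∀ f, nm s (sqn (T f)) ≤ D * nm s (fun x => ‖f x‖)) →
      ∀ z, ‖Φ z‖ ≤ D * nm s (fun x => ‖fz z x‖) * nm s' (sqn (gz z)) := by
    intro s s' D hs HD z
    calc ‖Φ z‖ ≤ ∑ x, sqn (T (fz z)) x * sqn (gz z) x := by
          refine (norm_sum_le _ _).trans (sum_le_sum fun x _ => ?_)
          refine (norm_sum_le _ _).trans ?_
          simp only [norm_mul]
          exact Real.sum_mul_le_sqrt_mul_sqrt _ _ _
      _ ≤ nm s (sqn (T (fz z))) * nm s' (sqn (gz z)) := holder hs _ _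
      _ ≤ _ := by
          gcongr
          · exact nm_nonneg _ _
          · exact HD _
  have hdiff : Differentiable ℂ Φ := by
    have d1 : ∀ x, Differentiable ℂ (fun z => fz z x) := by
      intro x; simp only [hfz, cpw, hα]; fun_prop
    have d2 : ∀ k x, Differentiable ℂ (fun z => gz z k x) := by
      intro k x; simp only [hgz, cpw, hβ]; fun_prop
    have d3 : Differentiable ℂ (fun z => T (fz z)) :=
      (LinearMap.toContinuousLinearMap T).differentiable.comp (differentiable_pi.2 d1)
    have d4 : ∀ k x, Differentiable ℂ (fun z => T (fz z) k x) := fun k x =>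
      differentiable_pi.1 (differentiable_pi.1 d3 k) x
    simp only [hΦ]
    refine Differentiable.fun_sum fun x _ => Differentiable.fun_sum fun k _ => ?_
    exact (d4 k x).mul (d2 k x)
  have hbdd : BddAbove ((norm ∘ Φ) '' Complex.HadamardThreeLines.verticalClosedStrip 0 1) := by
    refine ⟨A * nm p0 (fun x => (1 + ‖f x‖) ^ (p * (1 / p0 + 1 / p1))) * nm q0 (fun x => (1 + S x) ^ (p * (1 / q0 + 1 / q1))), ?_⟩
    rintro _ ⟨z, ⟨hz0, hz1⟩, rfl⟩
    refine (hhol hc0 H0 z).trans ?_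
    refine mul_le_mul (mul_le_mul_of_nonneg_left ?_ hA) ?_ (nm_nonneg _ _) (mul_nonneg hA (nm_nonneg _ _))
    · refine nm_mono hp00 fun x => ?_
      rw [abs_of_nonneg (norm_nonneg _), nfz z hz0 hz1 x, rα]
      calc _ ≤ (1 + ‖f x‖) ^ (p * ((1 - z.re) / p0 + z.re / p1)) := by
            refine Real.rpow_le_rpow (norm_nonneg _) (by linarith) (pos_aux _ _ _ hp00 hp10 hz0 hz1).le
        _ ≤ _ := by
            refine Real.rpow_le_rpow_of_exponent_le ?_ (le_aux _ _ _ hp00 hp10 hz0 hz1)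
            have := norm_nonneg (f x); linarith
    · refine nm_mono hq0 fun x => ?_
      rw [abs_of_nonneg (sqn_nonneg _ _), ngz z hz0 hz1 x, rβ]
      calc _ ≤ (1 + S x) ^ (p * ((1 - z.re) / q0 + z.re / q1)) := by
            refine Real.rpow_le_rpow (hS0 x) (by linarith) (pos_aux _ _ _ hq0 hq1 hz0 hz1).le
        _ ≤ _ := by
            refine Real.rpow_le_rpow_of_exponent_le ?_ (le_aux _ _ _ hq0 hq1 hz0 hz1)
            have := hS0 x; linarith
  have hb0 : ∀ z ∈ Complex.re ⁻¹' {0}, ‖Φ z‖ ≤ A * Q ^ (1 / p0) * P ^ (1 / q0) := by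
    intro z hz
    have hz : z.re = 0 := hz
    refine (hhol hc0 H0 z).trans (le_of_eq ?_)
    simp only [nfz z (by rw [hz]) (by rw [hz]; norm_num)]
    have : sqn (gz z) = fun x => S x ^ (p / q0) := by
      ext x; rw [ngz z (by rw [hz]) (by rw [hz]; norm_num), rβ, hz]; congr 1; ring
    rw [this, rα, hz, show p * ((1 - 0) / p0 + 0 / p1) = p / p0 by ring, nm_pow hp0 hp00 (fun x => norm_nonneg _),
      nm_pow hp0 hq0 hS0]
  have hb1 : ∀ z ∈ Complex.re ⁻¹' {1}, ‖Φ z‖ ≤ B * Q ^ (1 / p1) * P ^ (1 / q1) := by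
    intro z hz
    have hz : z.re = 1 := hz
    refine (hhol hc1 H1 z).trans (le_of_eq ?_)
    simp only [nfz z (by rw [hz]; norm_num) (by rw [hz])]
    have : sqn (gz z) = fun x => S x ^ (p / q1) := by
      ext x; rw [ngz z (by rw [hz]; norm_num) (by rw [hz]), rβ, hz]; congr 1; ring
    rw [this, rα, hz, show p * ((1 - 1) / p0 + 1 / p1) = p / p1 by ring, nm_pow hp0 hp10 (fun x => norm_nonneg _),
      nm_pow hp0 hq1 hS0]
  have key := Complex.HadamardThreeLines.norm_le_interp_of_mem_verticalClosedStrip₀₁' Φ (z := (θ:ℂ))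
    (by exact ⟨hθ0, hθ1⟩) hdiff.diffContOnCl hbdd hb0 hb1
  rw [Complex.ofReal_re] at key
  have hαθ : α θ = 1 := by
    have : (1:ℝ) = p * ((1 - θ) / p0 + θ / p1) := by rw [← hp]; field_simp
    simp only [hα]; exact_mod_cast this.symm
  have i2 : (1 - θ) / q0 + θ / q1 = 1 - 1 / p := by
    rw [hp, div_eq_mul_one_div, i0, div_eq_mul_one_div θ q1, i1]; ring
  have hβθ : β θ = ((p - 1 : ℝ) : ℂ) := by
    have : p - 1 = p * ((1 - θ) / q0 + θ / q1) := by rw [i2]; field_simp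
    rw [this]; simp only [hβ]; push_cast; ring
  have hfθ : fz θ = f := by
    ext x
    simp only [hfz, hαθ, cpw, mul_one]
    rcases (norm_nonneg (f x)).eq_or_lt with h | h
    · have : f x = 0 := norm_eq_zero.1 h.symm
      simp [this]
    · rw [← Complex.ofReal_exp, Real.exp_log h, div_mul_cancel₀]
      exact_mod_cast h.ne'
  have hΦθ : Φ θ = (P : ℂ) := by
    simp only [hΦ, hfθ, hP]
    push_cast
    refine sum_congr rfl fun x _ => ?_
    simp only [hgz, cpw, hβθ]
    rcases (hS0 x).eq_or_lt with h | h
    · rw [← h, Real.zero_rpow hp0.ne']; simp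
    · have e : Complex.exp (Real.log (S x) * ((p - 1 : ℝ) : ℂ)) = ((S x ^ (p - 1) : ℝ) : ℂ) := by
        rw [← Complex.ofReal_mul, ← Complex.ofReal_exp, Real.rpow_def_of_pos h]
      rw [e]
      have e2 : ∑ k, T f k x * ((starRingEnd ℂ) (T f k x) / (S x : ℂ) * ((S x ^ (p - 1) : ℝ) : ℂ)) =
          (∑ k, ‖T f k x‖ ^ 2 : ℝ) / (S x : ℂ) * ((S x ^ (p - 1) : ℝ) : ℂ) := by
        push_cast
        rw [sum_div, sum_mul]
        refine sum_congr rfl fun k _ => ?_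
        rw [← Complex.mul_conj']; ring
      rw [e2, ← sqn_sq, ← hS]
      rw [← Complex.ofReal_div, ← Complex.ofReal_mul]
      congr 1
      rw [Real.rpow_sub_one h.ne']; field_simp
  rw [hΦθ, Complex.norm_real, Real.norm_of_nonneg hPn] at key
  have a0 := Real.rpow_nonneg hQn (1 / p0)
  have a1 := Real.rpow_nonneg hQn (1 / p1)
  have b0 := Real.rpow_nonneg hPn (1 / q0)
  have b1 := Real.rpow_nonneg hPn (1 / q1)
  rw [Real.mul_rpow (mul_nonneg hA a0) b0, Real.mul_rpow hA a0, Real.mul_rpow (mul_nonneg hB a1) b1,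
    Real.mul_rpow hB a1, ← Real.rpow_mul hQn, ← Real.rpow_mul hQn, ← Real.rpow_mul hPn, ← Real.rpow_mul hPn] at key
  have eQ : Q ^ (1 / p0 * (1 - θ)) * Q ^ (1 / p1 * θ) = Q ^ (1 / p) := by
    have u1 : 0 ≤ 1 / p0 * (1 - θ) := mul_nonneg (by positivity) (by linarith)
    have u2 : 0 ≤ 1 / p1 * θ := mul_nonneg (by positivity) hθ0
    rw [← Real.rpow_add_of_nonneg hQn u1 u2, hp]; congr 1; ring
  have eP : P ^ (1 / q0 * (1 - θ)) * P ^ (1 / q1 * θ) = P ^ (1 - 1 / p) := by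
    rw [← Real.rpow_add hP0, ← i2]; congr 1; ring
  have key2 : P ≤ (A ^ (1 - θ) * B ^ θ * Q ^ (1 / p)) * P ^ (1 - 1 / p) := by
    rw [← eQ, ← eP]; refine key.trans (le_of_eq ?_); ring
  have e3 : P = P ^ (1 / p) * P ^ (1 - 1 / p) := by
    rw [← Real.rpow_add hP0]; simp
  nth_rewrite 1 [e3] at key2
  exact le_of_mul_le_mul_right key2 (by positivity)

end DF

namespace DF
open Finset
set_option linter.unusedVariables false
set_option linter.unusedSectionVars false

section grp
variable {G : Type} [AddCommGroup G] [Fintype G]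

/-- convolution with a real kernel -/
def cv {V : Type} [AddCommGroup V] [Module ℝ V] (k : G → ℝ) (f : G → V) (x : G) : V := ∑ g, k g • f (x + g)

structure PK (k : G → ℝ) : Prop where
  nn : ∀ g, 0 ≤ k g
  one : ∑ g, k g = 1
  ev : ∀ g, k (-g) = k g

lemma cv_const {k : G → ℝ} (hk : PK k) {V : Type} [AddCommGroup V] [Module ℝ V] (v : V) (x : G) :
    cv k (fun _ => v) x = v := by
  rw [cv, ← sum_smul, hk.one, one_smul]

lemma cv_mono {k : G → ℝ} (hk : PK k) {f g : G → ℝ} (h : ∀ x, f x ≤ g x) (x : G) : cv k f x ≤ cv k g x :=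
  sum_le_sum fun y _ => mul_le_mul_of_nonneg_left (h _) (hk.nn y)

lemma cv_nonneg {k : G → ℝ} (hk : PK k) {f : G → ℝ} (h : ∀ x, 0 ≤ f x) (x : G) : 0 ≤ cv k f x :=
  sum_nonneg fun y _ => mul_nonneg (hk.nn y) (h _)

lemma cv_norm_le {k : G → ℝ} (hk : PK k) (f : G → ℂ) (x : G) : ‖cv k f x‖ ≤ cv k (fun y => ‖f y‖) x := by
  refine (norm_sum_le _ _).trans (sum_le_sum fun g _ => ?_)
  rw [norm_smul, Real.norm_of_nonneg (hk.nn g)]; rfl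

lemma cv_sq_le {k : G → ℝ} (hk : PK k) (f : G → ℂ) (x : G) :
    ‖cv k f x‖ ^ 2 ≤ cv k (fun y => ‖f y‖ ^ 2) x := by
  calc ‖cv k f x‖ ^ 2 ≤ (cv k (fun y => ‖f y‖) x) ^ 2 := by gcongr; exact cv_norm_le hk f x
    _ ≤ _ := by
      have h := sum_sq_le_sum_mul_sum_of_sq_eq_mul univ (r := fun g => k g * ‖f (x + g)‖) (f := k)
        (g := fun g => k g * ‖f (x + g)‖ ^ 2) (fun g _ => hk.nn g) (fun g _ => mul_nonneg (hk.nn g) (by positivity))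
        (fun g _ => by ring)
      rw [hk.one, one_mul] at h
      exact h

lemma cv_adj {k : G → ℝ} (hk : PK k) (f h : G → ℂ) : ∑ x, cv k f x * h x = ∑ x, f x * cv k h x := by
  simp only [cv, sum_mul, mul_sum]
  rw [sum_comm, sum_comm (s := univ) (t := univ) (f := fun x i => f x * k i • h (x + i))]
  rw [← Equiv.sum_comp (Equiv.neg G)]
  refine sum_congr rfl fun g _ => ?_
  rw [← Equiv.sum_comp (Equiv.addRight g)]
  refine sum_congr rfl fun x _ => ?_
  simp only [Equiv.neg_apply, Equiv.coe_addRight, hk.ev, add_neg_cancel_right, Complex.real_smul]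
  ring

lemma cv_adj_real {k : G → ℝ} (hk : PK k) (f h : G → ℝ) : ∑ x, cv k f x * h x = ∑ x, f x * cv k h x := by
  simp only [cv, sum_mul, mul_sum]
  rw [sum_comm, sum_comm (s := univ) (t := univ) (f := fun x i => f x * k i • h (x + i))]
  rw [← Equiv.sum_comp (Equiv.neg G)]
  refine sum_congr rfl fun g _ => ?_
  rw [← Equiv.sum_comp (Equiv.addRight g)]
  refine sum_congr rfl fun x _ => ?_
  simp only [Equiv.neg_apply, Equiv.coe_addRight, hk.ev, add_neg_cancel_right, smul_eq_mul]
  ring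

/-- convolution as a linear map -/
noncomputable def cvL (k : G → ℝ) : (G → ℂ) →ₗ[ℂ] (G → ℂ) where
  toFun := cv k
  map_add' f g := by ext x; simp [cv, sum_add_distrib]
  map_smul' c f := by
    ext x; simp only [cv, Pi.smul_apply, RingHom.id_apply, smul_eq_mul, Complex.real_smul, mul_sum]
    exact sum_congr rfl fun g _ => by ring

lemma cvL_apply (k : G → ℝ) (f : G → ℂ) (x : G) : cvL k f x = cv k f x := rfl

lemma sqn_sq_nm {κ : Type} [Fintype κ] {q : ℝ} (hq : 0 < q) (h : G → ℝ) (hh : ∀ x, 0 ≤ h x) :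
    nm q (fun x => h x ^ 2) = nm (2 * q) h ^ 2 := by
  unfold nm
  rw [← Real.rpow_natCast, ← Real.rpow_mul (by positivity)]
  congr 1
  · refine sum_congr rfl fun x _ => ?_
    rw [abs_of_nonneg (sq_nonneg _), abs_of_nonneg (hh x), Real.rpow_mul (hh x)]
    norm_num
  · field_simp; norm_num

lemma vec_of_max {κ : Type} [Fintype κ] {k : κ → G → ℝ} (hk : ∀ n, PK (k n)) {q q' C : ℝ}
    (hq : q.HolderConjugate q') (hC : 0 ≤ C)
    (Hm : ∀ f : G → ℝ, (∀ x, 0 ≤ f x) → ∃ W : G → ℝ, (∀ n x, cv (k n) f x ≤ W x) ∧ nm q W ≤ C * nm q f)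
    (h : κ → G → ℂ) :
    nm (2 * q') (sqn (fun n => cv (k n) (h n))) ≤ √C * nm (2 * q') (sqn h) := by
  have hq' := hq.symm.pos
  have h2 : nm q' (fun x => sqn (fun n => cv (k n) (h n)) x ^ 2) ≤ C * nm q' (fun x => sqn h x ^ 2) := by
    refine dual_bound hq.symm (fun x => sq_nonneg _) (mul_nonneg hC (nm_nonneg _ _)) fun g hg => ?_
    obtain ⟨W, hW, hWn⟩ := Hm g hg
    calc ∑ x, sqn (fun n => cv (k n) (h n)) x ^ 2 * g x
        ≤ ∑ x, ∑ n, cv (k n) (fun y => ‖h n y‖ ^ 2) x * g x := by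
          refine sum_le_sum fun x _ => ?_
          rw [sqn_sq, sum_mul]
          exact sum_le_sum fun n _ => mul_le_mul_of_nonneg_right (cv_sq_le (hk n) _ _) (hg x)
      _ = ∑ x, ∑ n, ‖h n x‖ ^ 2 * cv (k n) g x := by
          rw [sum_comm, sum_comm (s := univ) (t := univ) (f := fun x n => ‖h n x‖ ^ 2 * cv (k n) g x)]
          exact sum_congr rfl fun n _ => cv_adj_real (hk n) _ _
      _ ≤ ∑ x, sqn h x ^ 2 * W x := by
          refine sum_le_sum fun x _ => ?_
          rw [sqn_sq, sum_mul]
          exact sum_le_sum fun n _ => mul_le_mul_of_nonneg_left (hW n x) (sq_nonneg _)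
      _ ≤ nm q' (fun x => sqn h x ^ 2) * nm q W := holder hq.symm _ _
      _ ≤ nm q' (fun x => sqn h x ^ 2) * (C * nm q g) := mul_le_mul_of_nonneg_left hWn (nm_nonneg _ _)
      _ = _ := by ring
  rw [sqn_sq_nm (κ := κ) hq' _ (fun x => sqn_nonneg _ _), sqn_sq_nm (κ := κ) hq' _ (fun x => sqn_nonneg _ _)] at h2
  have := Real.sqrt_le_sqrt h2
  rwa [Real.sqrt_mul hC, Real.sqrt_sq (nm_nonneg _ _), Real.sqrt_sq (nm_nonneg _ _)] at this

lemma vec_dual {κ : Type} [Fintype κ] {k : κ → G → ℝ} (hk : ∀ n, PK (k n)) {p p' C : ℝ}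
    (hp : p.HolderConjugate p') (hC : 0 ≤ C)
    (H : ∀ h : κ → G → ℂ, nm p (sqn (fun n => cv (k n) (h n))) ≤ C * nm p (sqn h)) (h : κ → G → ℂ) :
    nm p' (sqn (fun n => cv (k n) (h n))) ≤ C * nm p' (sqn h) := by
  set S := sqn (fun n => cv (k n) (h n)) with hS
  have hS0 : ∀ x, 0 ≤ S x := fun x => sqn_nonneg _ _
  refine dual_bound hp.symm hS0 (mul_nonneg hC (nm_nonneg _ _)) fun g hg => ?_
  set w : κ → G → ℂ := fun n x => (starRingEnd ℂ) (cv (k n) (h n) x) / (S x : ℂ) * (g x : ℂ) with hw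
  have e1 : ((∑ x, S x * g x : ℝ) : ℂ) = ∑ x, ∑ n, cv (k n) (h n) x * w n x := by
    push_cast
    refine sum_congr rfl fun x _ => ?_
    have : ∑ n, cv (k n) (h n) x * w n x = ((S x ^ 2 : ℝ) : ℂ) / S x * g x := by
      rw [hS, sqn_sq]; push_cast
      rw [sum_div, sum_mul]
      refine sum_congr rfl fun n _ => ?_
      rw [← Complex.mul_conj', hw]; ring
    rw [this]
    rcases (hS0 x).eq_or_lt with h0 | h0
    · rw [← h0]; simp
    · rw [← Complex.ofReal_div]; congr 2; field_simp
  have e2 : ∑ x, ∑ n, cv (k n) (h n) x * w n x = ∑ x, ∑ n, h n x * cv (k n) (w n) x := by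
    rw [sum_comm, sum_comm (s := univ) (t := univ) (f := fun x n => h n x * cv (k n) (w n) x)]
    exact sum_congr rfl fun n _ => cv_adj (hk n) _ _
  have hwg : ∀ x, sqn w x ≤ g x := by
    intro x
    refine Real.sqrt_le_iff.2 ⟨hg x, ?_⟩
    have : ∑ n, ‖w n x‖ ^ 2 = (S x / S x) ^ 2 * g x ^ 2 := by
      simp only [hw, norm_mul, norm_div, RCLike.norm_conj, Complex.norm_real, mul_pow, div_pow, Real.norm_eq_abs, sq_abs]
      rw [← sum_mul, ← sum_div, ← sqn_sq]
    rw [this]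
    have h1 : (S x / S x) ^ 2 ≤ 1 := by
      rcases (hS0 x).eq_or_lt with h0 | h0
      · rw [← h0]; simp
      · rw [div_self h0.ne']; simp
    nlinarith [sq_nonneg (g x)]
  have e3 : ∑ x, S x * g x ≤ ∑ x, sqn h x * sqn (fun n => cv (k n) (w n)) x := by
    have : ∑ x, S x * g x = ‖((∑ x, S x * g x : ℝ) : ℂ)‖ := by
      rw [Complex.norm_real, Real.norm_of_nonneg (sum_nonneg fun x _ => mul_nonneg (hS0 x) (hg x))]
    rw [this, e1, e2]
    refine (norm_sum_le _ _).trans (sum_le_sum fun x _ => ?_)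
    refine (norm_sum_le _ _).trans ?_
    simp only [norm_mul]
    exact Real.sum_mul_le_sqrt_mul_sqrt _ _ _
  calc _ ≤ _ := e3
    _ ≤ nm p' (sqn h) * nm p (sqn (fun n => cv (k n) (w n))) := holder hp.symm _ _
    _ ≤ nm p' (sqn h) * (C * nm p g) := by
        refine mul_le_mul_of_nonneg_left ((H w).trans (mul_le_mul_of_nonneg_left ?_ hC)) (nm_nonneg _ _)
        exact nm_mono hp.pos fun x => by rw [abs_of_nonneg (sqn_nonneg _ _)]; exact hwg x
    _ = _ := by ring

/-- Fourier transform -/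
noncomputable def ft (f : G → ℂ) (ψ : AddChar G ℂ) : ℂ := ∑ x, ψ (-x) * f x

lemma ft_cv (k : G → ℝ) (f : G → ℂ) (ψ : AddChar G ℂ) : ft (cv k f) ψ = (∑ g, k g * ψ g) * ft f ψ := by
  simp only [ft, cv, mul_sum, sum_mul]
  rw [sum_comm, sum_comm (s := univ) (t := univ) (f := fun x i => k i * ψ i * (ψ (-x) * f x))]
  refine sum_congr rfl fun g _ => ?_
  rw [← Equiv.sum_comp (Equiv.subRight g)]
  refine sum_congr rfl fun x _ => ?_
  simp only [Equiv.subRight_apply, sub_add_cancel, neg_sub, Complex.real_smul]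
  rw [sub_eq_add_neg, AddChar.map_add_eq_mul]; ring

lemma plancherel (f : G → ℂ) : ∑ ψ : AddChar G ℂ, ‖ft f ψ‖ ^ 2 = Fintype.card G * ∑ x, ‖f x‖ ^ 2 := by
  classical
  have : (∑ ψ : AddChar G ℂ, ‖ft f ψ‖ ^ 2 : ℂ) = Fintype.card G * ∑ x, (‖f x‖ : ℂ) ^ 2 := by
    have h1 : ∀ ψ : AddChar G ℂ, (‖ft f ψ‖ : ℂ) ^ 2 = ∑ x, ∑ y, f x * (starRingEnd ℂ) (f y) * ψ (y - x) := by
      intro ψ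
      rw [← Complex.mul_conj', ft, map_sum, sum_mul_sum]
      refine sum_congr rfl fun x _ => sum_congr rfl fun y _ => ?_
      rw [map_mul, AddChar.map_neg_eq_conj ψ y, Complex.conj_conj, sub_eq_add_neg, AddChar.map_add_eq_mul]
      ring
    simp only [h1]
    rw [sum_comm, mul_sum]
    refine sum_congr rfl fun x _ => ?_
    rw [sum_comm]
    simp only [← mul_sum, AddChar.sum_apply_eq_ite]
    rw [sum_eq_single x]
    · simp [← Complex.mul_conj']; ring
    · intro y _ hy; simp [sub_eq_zero, hy]
    · simp
  exact_mod_cast this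

lemma l2_bound {κ : Type} [Fintype κ] (T : κ → (G → ℂ) → (G → ℂ)) (m : κ → AddChar G ℂ → ℂ)
    (hT : ∀ k f ψ, ft (T k f) ψ = m k ψ * ft f ψ) {c : ℝ} (hc : 0 ≤ c)
    (H : ∀ ψ, ∑ k, ‖m k ψ‖ ^ 2 ≤ c ^ 2) (f : G → ℂ) :
    nm 2 (sqn (fun k => T k f)) ≤ c * nm 2 (fun x => ‖f x‖) := by
  have hn : (0:ℝ) < Fintype.card G := by exact_mod_cast Fintype.card_pos_iff.2 ⟨(0:G)⟩
  have e : ∀ {h : G → ℝ}, (∀ x, 0 ≤ h x) → nm 2 h = √(∑ x, h x ^ 2) := by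
    intro h hh
    rw [nm, Real.sqrt_eq_rpow]; simp
  rw [e (fun x => sqn_nonneg _ _), e (fun x => norm_nonneg _), ← Real.sqrt_sq hc, ← Real.sqrt_mul (sq_nonneg c)]
  refine Real.sqrt_le_sqrt ?_
  simp only [sqn_sq]
  rw [sum_comm]
  refine le_of_mul_le_mul_left ?_ hn
  rw [mul_sum]
  simp only [← plancherel, hT, norm_mul, mul_pow]
  rw [sum_comm, mul_left_comm, ← plancherel, mul_sum]
  refine sum_le_sum fun ψ _ => ?_
  rw [← sum_mul]
  exact mul_le_mul_of_nonneg_right (H ψ) (sq_nonneg _)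

end grp
end DF

namespace DF
open Finset
set_option linter.unusedVariables false
set_option linter.unusedSectionVars false

noncomputable def gs (L : ℕ) (z : ℂ) : ℂ := (L : ℂ)⁻¹ * ∑ j ∈ range L, z ^ j

lemma pow_sub_one_le {z : ℂ} (hz : ‖z‖ = 1) (j : ℕ) : ‖z ^ j - 1‖ ≤ j * ‖z - 1‖ := by
  rw [← mul_geom_sum, norm_mul, mul_comm]
  refine mul_le_mul_of_nonneg_right ((norm_sum_le _ _).trans ?_) (norm_nonneg _)
  simp [hz]

lemma zpow_sub_one_le {z : ℂ} (hz : ‖z‖ = 1) {N : ℕ} {j : ℤ} (hj : |j| ≤ N) : ‖z ^ j - 1‖ ≤ N * ‖z - 1‖ := by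
  have hz0 : z ≠ 0 := by rintro rfl; simp at hz
  have : ‖z ^ j - 1‖ = ‖z ^ j.natAbs - 1‖ := by
    rcases Int.natAbs_eq j with h | h
    · conv_lhs => rw [h, zpow_natCast]
    · conv_lhs => rw [h, zpow_neg, zpow_natCast]
      have h0 : z ^ j.natAbs ≠ 0 := pow_ne_zero _ hz0
      have : (z ^ j.natAbs)⁻¹ - 1 = (z ^ j.natAbs)⁻¹ * (1 - z ^ j.natAbs) := by field_simp
      rw [this, norm_mul, norm_inv, norm_pow, hz, norm_sub_rev]; simp
  rw [this]
  refine (pow_sub_one_le hz _).trans (mul_le_mul_of_nonneg_right ?_ (norm_nonneg _))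
  have : j.natAbs ≤ N := by zify; exact hj
  exact_mod_cast this

lemma gs_le_one {z : ℂ} (hz : ‖z‖ = 1) (L : ℕ) : ‖gs L z‖ ≤ 1 := by
  rw [gs, norm_mul, norm_inv, Complex.norm_natCast]
  have : ‖∑ j ∈ range L, z ^ j‖ ≤ L := (norm_sum_le _ _).trans (by simp [hz])
  exact (mul_le_mul_of_nonneg_left this (by positivity)).trans (inv_mul_le_one (a := (L:ℝ)))

lemma gs_decay {z : ℂ} (hz : ‖z‖ = 1) (L : ℕ) : L * ‖z - 1‖ * ‖gs L z‖ ≤ 2 := by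
  rcases Nat.eq_zero_or_pos L with h | h
  · subst h; simp
  have hL : (0:ℝ) < L := by exact_mod_cast h
  rw [gs, norm_mul, norm_inv, Complex.norm_natCast]
  have : L * ‖z - 1‖ * ((L:ℝ)⁻¹ * ‖∑ j ∈ range L, z ^ j‖) = ‖(z - 1) * ∑ j ∈ range L, z ^ j‖ := by
    rw [norm_mul]; field_simp
  rw [this, mul_geom_sum]
  refine (norm_sub_le _ _).trans ?_
  simp [hz]; norm_num

lemma half_one_add {w : ℂ} (hw : ‖w‖ = 1) : ‖1 + w‖ ≤ 2 - ‖w - 1‖ ^ 2 / 4 := by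
  have h := parallelogram_law_with_norm ℝ (1:ℂ) w
  rw [hw, norm_one, norm_sub_rev] at h
  have h2 : ‖w - 1‖ ≤ 2 := (norm_sub_le _ _).trans (by rw [hw]; norm_num)
  refine abs_le_of_sq_le_sq' ?_ ?_ |>.2 <;> nlinarith [norm_nonneg (w - 1), sq_nonneg (‖w - 1‖ ^ 2)]

lemma pow_lower {z : ℂ} (hz : ‖z‖ = 1) {a : ℕ} (ha : a * ‖z - 1‖ ≤ 2) : a * ‖z - 1‖ / 2 ≤ ‖z ^ a - 1‖ := by
  set φ := z.arg with hφ
  have e : z = Complex.exp (Complex.I * (φ:ℝ)) := by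
    conv_lhs => rw [← Complex.norm_mul_exp_arg_mul_I z, hz]
    simp [hφ, mul_comm]
  have e1 : ‖z - 1‖ = 2 * |Real.sin (φ / 2)| := by
    conv_lhs => rw [e, Complex.norm_exp_I_mul_ofReal_sub_one]
    simp
  have e2 : ‖z ^ a - 1‖ = 2 * |Real.sin (a * φ / 2)| := by
    have : z ^ a = Complex.exp (Complex.I * ((a * φ : ℝ))) := by
      conv_lhs => rw [e, ← Complex.exp_nat_mul]
      congr 1; push_cast; ring
    rw [this, Complex.norm_exp_I_mul_ofReal_sub_one]; simp
  have hpi := Real.pi_pos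
  have hp4 := Real.pi_le_four
  have hφ' : |φ| ≤ Real.pi := Complex.abs_arg_le_pi z
  have sabs : ∀ x : ℝ, |x| ≤ Real.pi → |Real.sin x| = Real.sin |x| := fun x hx => Real.abs_sin_eq_sin_abs_of_abs_le_pi hx
  have a1 : |φ / 2| = |φ| / 2 := by rw [abs_div]; norm_num
  have a2 : |a * φ / 2| = a * |φ| / 2 := by rw [abs_div, abs_mul]; norm_num
  have b1 : |φ| ≤ Real.pi / 2 * ‖z - 1‖ := by
    rw [e1, sabs _ (by rw [a1]; linarith [abs_nonneg φ]), a1]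
    have := Real.mul_le_sin (x := |φ| / 2) (by positivity) (by linarith)
    have h3 : Real.pi * (2 / Real.pi * (|φ| / 2)) = |φ| := by field_simp
    nlinarith
  have b2 : ‖z - 1‖ ≤ |φ| := by
    rw [e1]; have := Real.abs_sin_le_abs (x := φ / 2); rw [a1] at this; linarith
  have b3 : a * |φ| / 2 ≤ Real.pi / 2 := by
    have : (a:ℝ) * |φ| ≤ a * (Real.pi / 2 * ‖z - 1‖) := by gcongr
    nlinarith
  rw [e2, sabs _ (by rw [a2]; linarith), a2]
  have := Real.mul_le_sin (x := a * |φ| / 2) (by positivity) b3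
  have h4 : (1:ℝ) / 2 ≤ 2 / Real.pi := by rw [div_le_div_iff₀ (by norm_num) hpi]; linarith
  have h5 : (a:ℝ) * ‖z - 1‖ ≤ a * |φ| := by gcongr
  have h6 : 1 / 2 * (a * |φ| / 2) ≤ 2 / Real.pi * (a * |φ| / 2) := by gcongr
  linarith

lemma gs_near {z : ℂ} (hz : ‖z‖ = 1) {L : ℕ} (hL : 2 ≤ L) (h : L * ‖z - 1‖ ≤ 4) :
    ‖gs L z‖ ≤ 1 - (L * ‖z - 1‖) ^ 2 / 1024 := by
  obtain ⟨a, ha1, ha2⟩ : ∃ a, 2 * a ≤ L ∧ L ≤ 4 * a := ⟨(L + 3) / 4, by omega, by omega⟩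
  have hLr : (2:ℝ) ≤ L := by exact_mod_cast hL
  have h1 : (2:ℝ) * a ≤ L := by exact_mod_cast ha1
  have h2 : (L:ℝ) ≤ 4 * a := by exact_mod_cast ha2
  have ht := norm_nonneg (z - 1)
  have hza : ‖z ^ a‖ = 1 := by simp [hz]
  have key : ‖∑ j ∈ range L, z ^ j‖ ≤ a * ‖1 + z ^ a‖ + (L - 2 * a) := by
    have e : ∑ j ∈ range L, z ^ j = (1 + z ^ a) * ∑ j ∈ range a, z ^ j + ∑ j ∈ range (L - 2 * a), z ^ (2 * a + j) := by
      conv_lhs => rw [← Nat.add_sub_of_le ha1, sum_range_add, two_mul, sum_range_add]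
      simp only [pow_add, ← mul_sum]
      ring
    rw [e]
    refine (norm_add_le _ _).trans (add_le_add ?_ ?_)
    · rw [norm_mul, mul_comm]
      refine mul_le_mul_of_nonneg_right ((norm_sum_le _ _).trans ?_) (norm_nonneg _)
      simp [hz]
    · refine (norm_sum_le _ _).trans ?_
      simp [hz, Nat.cast_sub ha1]
  have h3 := pow_lower hz (a := a) (by nlinarith)
  have h4 := half_one_add hza
  have h5 : (L * ‖z - 1‖ / 8) ^ 2 ≤ ‖z ^ a - 1‖ ^ 2 := by
    gcongr; nlinarith
  rw [gs, norm_mul, norm_inv, Complex.norm_natCast, inv_mul_le_iff₀ (by linarith)]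
  refine key.trans ?_
  have h6 : (a:ℝ) * ‖1 + z ^ a‖ ≤ a * (2 - (L * ‖z - 1‖ / 8) ^ 2 / 4) := by gcongr; linarith
  have h7 : (L:ℝ) / 4 * (L * ‖z - 1‖ / 8) ^ 2 ≤ a * (L * ‖z - 1‖ / 8) ^ 2 := by gcongr; linarith
  nlinarith

lemma gs_pow {z : ℂ} (hz : ‖z‖ = 1) {L : ℕ} (hL : 2 ≤ L) :
    ‖gs L z‖ ^ 1024 * (1 + (L * ‖z - 1‖) ^ 2) ≤ 1 := by
  have hLr : (2:ℝ) ≤ L := by exact_mod_cast hL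
  set t := (L:ℝ) * ‖z - 1‖ with ht
  have ht0 : 0 ≤ t := by positivity
  have hg := norm_nonneg (gs L z)
  by_cases h : t ≤ 4
  · have h1 := gs_near hz hL h
    rw [← ht] at h1
    have h2 : ‖gs L z‖ ≤ Real.exp (-(t ^ 2 / 1024)) := h1.trans (by linarith [Real.add_one_le_exp (-(t ^ 2 / 1024))])
    have h3 : ‖gs L z‖ ^ 1024 ≤ Real.exp (-t ^ 2) := by
      calc _ ≤ Real.exp (-(t ^ 2 / 1024)) ^ 1024 := by gcongr
        _ = _ := by rw [← Real.exp_nat_mul]; congr 1; push_cast; ring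
    calc _ ≤ Real.exp (-t ^ 2) * Real.exp (t ^ 2) := by
          gcongr; linarith [Real.add_one_le_exp (t ^ 2)]
      _ = 1 := by rw [← Real.exp_add]; simp
  · push Not at h
    have h1 := gs_decay hz L
    rw [← ht] at h1
    have h2 : ‖gs L z‖ ≤ 2 / t := by rw [le_div_iff₀ (by linarith)]; linarith
    have h3 : ‖gs L z‖ ^ 1024 ≤ ‖gs L z‖ ^ 6 := pow_le_pow_of_le_one hg (gs_le_one hz L) (by norm_num)
    have h4 : ‖gs L z‖ ^ 6 ≤ (2 / t) ^ 6 := by gcongr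
    calc _ ≤ (2 / t) ^ 6 * (1 + t ^ 2) := by gcongr; linarith
      _ ≤ 1 := by
        rw [div_pow, div_mul_eq_mul_div, div_le_one (by positivity)]
        have h16 : 16 ≤ t ^ 2 := by nlinarith
        have e : t ^ 6 = t ^ 2 * t ^ 2 * t ^ 2 := by ring
        have : 16 * 16 ≤ t ^ 2 * t ^ 2 := by nlinarith
        nlinarith

lemma gs_sq {z : ℂ} (hz : ‖z‖ = 1) {L : ℕ} (hL : 1 ≤ L) : 1 - ‖gs L z‖ ^ 2 ≤ (L * ‖z - 1‖) ^ 2 := by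
  have hL0 : (0:ℝ) < L := by exact_mod_cast hL
  have hsum : ∑ j ∈ range L, z ^ j = (L:ℝ) • gs L z := by
    rw [gs, Complex.real_smul, ← mul_assoc]; push_cast; rw [mul_inv_cancel₀ (by exact_mod_cast hL0.ne'), one_mul]
  have h1 : ∑ j ∈ range L, ‖z ^ j - 1‖ ^ 2 = L * (1 - ‖gs L z‖ ^ 2 + ‖gs L z - 1‖ ^ 2) := by
    simp only [norm_sub_sq_real, norm_pow, hz]
    rw [sum_add_distrib, sum_sub_distrib, ← mul_sum, ← sum_inner, hsum, real_inner_smul_left]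
    simp; ring
  have h2 : ∑ j ∈ range L, ‖z ^ j - 1‖ ^ 2 ≤ ∑ j ∈ range L, (L * ‖z - 1‖) ^ 2 := by
    refine sum_le_sum fun j hj => ?_
    have : (j:ℝ) ≤ L := by exact_mod_cast (mem_range.1 hj).le
    gcongr
    exact (pow_sub_one_le hz j).trans (by gcongr)
  rw [h1, sum_const, card_range, nsmul_eq_mul] at h2
  have := le_of_mul_le_mul_left h2 hL0
  nlinarith [sq_nonneg ‖gs L z - 1‖]

lemma gs_double {z : ℂ} (hz : ‖z‖ = 1) (L : ℕ) : ‖gs (2 * L) z‖ ≤ ‖gs L z‖ := by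
  have e : gs (2 * L) z = (1 + z ^ L) / 2 * gs L z := by
    simp only [gs, two_mul, sum_range_add, pow_add, ← mul_sum]
    push_cast; rw [← two_mul, mul_inv]; ring
  rw [e, norm_mul, norm_div]
  have : ‖1 + z ^ L‖ ≤ 2 := (norm_add_le _ _).trans (by simp [hz]; norm_num)
  have h2 : ‖1 + z ^ L‖ / ‖(2:ℂ)‖ ≤ 1 := by rw [div_le_one (by simp)]; simpa using this
  exact mul_le_of_le_one_left (norm_nonneg _) h2

noncomputable def aS (N : ℕ) (z : ℂ) : ℂ := ((2 * N + 1 : ℕ) : ℂ)⁻¹ * ∑ j ∈ Icc (-(N:ℤ)) N, z ^ j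

lemma sum_sym {V : Type} [AddCommGroup V] [Module ℝ V] (N : ℕ) (F : ℤ → V) :
    ∑ j ∈ Icc (-(N:ℤ)) N, F (-j) = ∑ j ∈ Icc (-(N:ℤ)) N, F j := by
  refine sum_nbij' (fun j => -j) (fun j => -j) ?_ ?_ ?_ ?_ ?_ <;> intro j hj <;> simp at hj ⊢ <;> omega

lemma aS_norm {z : ℂ} (hz : ‖z‖ = 1) (N : ℕ) : ‖aS N z‖ = ‖gs (2 * N + 1) z‖ := by
  have hz0 : z ≠ 0 := by rintro rfl; simp at hz
  have : ∑ j ∈ Icc (-(N:ℤ)) N, z ^ j = z ^ (-(N:ℤ)) * ∑ j ∈ range (2 * N + 1), z ^ j := by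
    rw [mul_sum]
    refine sum_nbij' (fun j => (j + N).toNat) (fun j => (j:ℤ) - N) ?_ ?_ ?_ ?_ ?_
    · intro j hj; simp at hj ⊢; omega
    · intro j hj; simp at hj ⊢; omega
    · intro j hj; simp at hj ⊢; omega
    · intro j hj; simp
    · intro j hj; simp at hj
      rw [← zpow_natCast, ← zpow_add₀ hz0]; congr 1; omega
  rw [aS, gs, this, norm_mul, norm_mul, norm_mul, norm_zpow, hz]; simp

lemma aS_sub_eq {z : ℂ} (hz : ‖z‖ = 1) (j : ℤ) : z ^ j + z ^ (-j) = ((2 - ‖z ^ j - 1‖ ^ 2 : ℝ) : ℂ) := by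
  have h : z ^ (-j) = (starRingEnd ℂ) (z ^ j) := by
    rw [zpow_neg, ← Complex.inv_eq_conj (by simp [hz])]
  have hn : ‖z ^ j‖ = 1 := by simp [hz]
  have hn' : z ^ j * (starRingEnd ℂ) (z ^ j) = 1 := by rw [Complex.mul_conj', hn]; simp
  push_cast
  rw [h, ← Complex.mul_conj', map_sub, map_one]
  linear_combination hn'

lemma aS_near' {z : ℂ} (hz : ‖z‖ = 1) {N M : ℕ} (hNM : N ≤ M) (s : Finset ℤ) (hs : s ⊆ Icc (-(M:ℤ)) M)
    (hsy : ∑ j ∈ s, z ^ (-j) = ∑ j ∈ s, z ^ j) :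
    ‖∑ j ∈ s, (z ^ j - 1)‖ ≤ #s * ((M * ‖z - 1‖) ^ 2 / 2) := by
  have e : ∑ j ∈ s, (z ^ j - 1) = ∑ j ∈ s, ((-(‖z ^ j - 1‖ ^ 2 / 2) : ℝ) : ℂ) := by
    have : ∑ j ∈ s, (z ^ j + z ^ (-j)) = ∑ j ∈ s, ((2 - ‖z ^ j - 1‖ ^ 2 : ℝ) : ℂ) :=
      sum_congr rfl fun j _ => aS_sub_eq hz j
    rw [sum_add_distrib, hsy] at this
    push_cast at this ⊢
    simp only [sum_sub_distrib, sum_neg_distrib, ← sum_div] at this ⊢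
    simp only [sum_const, nsmul_eq_mul] at this ⊢
    linear_combination this / 2
  rw [e]
  refine (norm_sum_le _ _).trans ?_
  rw [← nsmul_eq_mul]
  refine sum_le_card_nsmul _ _ _ fun j hj => ?_
  have hj' := mem_Icc.1 (hs hj)
  rw [Complex.norm_real, norm_neg, Real.norm_of_nonneg (by positivity)]
  gcongr
  exact zpow_sub_one_le hz (abs_le.2 hj')

lemma card_box (N : ℕ) : #(Icc (-(N:ℤ)) N) = 2 * N + 1 := by simp; omega

lemma aS_near {z : ℂ} (hz : ‖z‖ = 1) (N : ℕ) : ‖aS N z - 1‖ ≤ (N * ‖z - 1‖) ^ 2 / 2 := by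
  have h := aS_near' hz le_rfl (Icc (-(N:ℤ)) N) subset_rfl (sum_sym N _)
  rw [card_box] at h
  have hp : ((2 * N + 1 : ℕ) : ℂ) ≠ 0 := Nat.cast_ne_zero.2 (by omega)
  have hp' : (0:ℝ) < ((2 * N + 1 : ℕ) : ℝ) := by positivity
  have e : aS N z - 1 = ((2 * N + 1 : ℕ) : ℂ)⁻¹ * ∑ j ∈ Icc (-(N:ℤ)) N, (z ^ j - 1) := by
    rw [aS, sum_sub_distrib, sum_const, card_box, mul_sub, nsmul_eq_mul, mul_one, inv_mul_cancel₀ hp]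
  rw [e, norm_mul, norm_inv, Complex.norm_natCast, inv_mul_le_iff₀ hp']
  exact h

lemma aS_diff {z : ℂ} (hz : ‖z‖ = 1) {N h : ℕ} (hN : 1 ≤ N) (hh : h ≤ N) :
    ‖aS N z - aS (N + h) z‖ ≤ 3 * h / N * min 1 ((N * ‖z - 1‖) ^ 2) := by
  set s := Icc (-((N + h : ℕ):ℤ)) ((N + h : ℕ):ℤ) \ Icc (-(N:ℤ)) N with hs
  have hsub : Icc (-(N:ℤ)) N ⊆ Icc (-((N + h : ℕ):ℤ)) ((N + h : ℕ):ℤ) := Icc_subset_Icc (by push_cast; omega) (by push_cast; omega)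
  have hc : #s = 2 * h := by rw [hs, card_sdiff_of_subset hsub, card_box, card_box]; omega
  have hsum : ∀ F : ℤ → ℂ, ∑ j ∈ s, F j = ∑ j ∈ Icc (-((N + h : ℕ):ℤ)) ((N + h : ℕ):ℤ), F j - ∑ j ∈ Icc (-(N:ℤ)) N, F j :=
    fun F => by rw [hs, sum_sdiff_eq_sub hsub]
  have hsy : ∑ j ∈ s, z ^ (-j) = ∑ j ∈ s, z ^ j := by
    rw [hsum, hsum, sum_sym (N + h) (fun j => z ^ j), sum_sym N (fun j => z ^ j)]
  have h1 := aS_near' hz (Nat.le_add_right N h) s sdiff_subset hsy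
  have h2 := aS_near hz N
  rw [hc] at h1
  set P := ((2 * (N + h) + 1 : ℕ) : ℂ) with hP
  have hN0 : (1:ℝ) ≤ N := by exact_mod_cast hN
  have hhr : (h:ℝ) ≤ N := by exact_mod_cast hh
  have hp : P ≠ 0 := by rw [hP]; exact Nat.cast_ne_zero.2 (by omega)
  have hp1 : ((2 * N + 1 : ℕ) : ℂ) ≠ 0 := Nat.cast_ne_zero.2 (by omega)
  have hp' : (0:ℝ) < ((2 * (N + h) + 1 : ℕ) : ℝ) := by positivity
  have e1 : ∑ j ∈ Icc (-(N:ℤ)) N, z ^ j = ((2 * N + 1 : ℕ) : ℂ) * aS N z := by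
    rw [aS, ← mul_assoc, mul_inv_cancel₀ hp1, one_mul]
  have e2 : ∑ j ∈ Icc (-((N + h : ℕ):ℤ)) ((N + h : ℕ):ℤ), z ^ j = P * aS (N + h) z := by
    rw [aS, ← mul_assoc, mul_inv_cancel₀ hp, one_mul]
  have e3 : ∑ j ∈ s, (z ^ j - 1) = P * aS (N + h) z - ((2 * N + 1 : ℕ) : ℂ) * aS N z - 2 * h := by
    rw [sum_sub_distrib, sum_const, hc, hsum, e1, e2]; simp
  have e : aS N z - aS (N + h) z = P⁻¹ * (2 * h * (aS N z - 1) - ∑ j ∈ s, (z ^ j - 1)) := by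
    rw [eq_inv_mul_iff_mul_eq₀ hp, e3, hP]; push_cast; ring
  have hY : (((N + h : ℕ):ℝ) * ‖z - 1‖) ^ 2 ≤ 4 * (N * ‖z - 1‖) ^ 2 := by
    have : ((N + h : ℕ):ℝ) * ‖z - 1‖ ≤ 2 * (N * ‖z - 1‖) := by
      rw [← mul_assoc]; gcongr; push_cast; linarith
    calc _ ≤ (2 * (N * ‖z - 1‖)) ^ 2 := by gcongr
      _ = _ := by ring
  have key : ∀ m : ℝ, 0 ≤ m → ‖2 * h * (aS N z - 1) - ∑ j ∈ s, (z ^ j - 1)‖ ≤ 2 * h * m * 3 →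
      ‖aS N z - aS (N + h) z‖ ≤ 3 * h / N * m := by
    intro m hm hk
    rw [e, norm_mul, norm_inv, hP, Complex.norm_natCast, inv_mul_le_iff₀ hp']
    refine hk.trans ?_
    have : 3 * (h:ℝ) / N * m * (2 * N) ≤ 3 * (h:ℝ) / N * m * ((2 * (N + h) + 1 : ℕ) : ℝ) := by
      gcongr; push_cast; linarith
    have h3 : 3 * (h:ℝ) / N * m * (2 * N) = 2 * h * m * 3 := by field_simp
    linarith
  refine key _ (by positivity) ?_
  have n1 : ‖(2:ℂ) * h‖ = 2 * h := by simp
  rcases le_total 1 ((N * ‖z - 1‖) ^ 2) with hm | hm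
  · rw [min_eq_left hm]
    have e4 : 2 * h * (aS N z - 1) - ∑ j ∈ s, (z ^ j - 1) = 2 * h * aS N z - ∑ j ∈ s, z ^ j := by
      rw [sum_sub_distrib, sum_const, hc]; simp; ring
    rw [e4]
    refine (norm_sub_le _ _).trans ?_
    have h5 : ‖∑ j ∈ s, z ^ j‖ ≤ 2 * h := (norm_sum_le _ _).trans (by simp [hz, hc])
    have h6 : ‖aS N z‖ ≤ 1 := by rw [aS_norm hz]; exact gs_le_one hz _
    rw [norm_mul, n1]
    nlinarith [Nat.cast_nonneg (α := ℝ) h]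
  · rw [min_eq_right hm]
    refine (norm_sub_le _ _).trans ?_
    rw [norm_mul, n1]
    push_cast at h1
    have h7 : 2 * (h:ℝ) * ‖aS N z - 1‖ ≤ 2 * h * ((N * ‖z - 1‖) ^ 2 / 2) := by gcongr
    push_cast at hY
    have h8 : 2 * (h:ℝ) * (((N + h) * ‖z - 1‖) ^ 2 / 2) ≤ 2 * h * (4 * (N * ‖z - 1‖) ^ 2 / 2) := by gcongr
    have h9 : 0 ≤ 2 * (h:ℝ) * ((N * ‖z - 1‖) ^ 2) := by positivity
    nlinarith

end DF

namespace DF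
open Finset
set_option linter.unusedVariables false
set_option linter.unusedSectionVars false

lemma prod_sub_one_le {ι : Type*} (s : Finset ι) (a : ι → ℂ) (ha : ∀ i, ‖a i‖ ≤ 1) :
    ‖∏ i ∈ s, a i - 1‖ ≤ ∑ i ∈ s, ‖a i - 1‖ := by
  classical
  induction s using Finset.induction_on with
  | empty => simp
  | insert i s hi ih =>
    rw [prod_insert hi, sum_insert hi]
    have : a i * ∏ x ∈ s, a x - 1 = (a i - 1) + a i * (∏ x ∈ s, a x - 1) := by ring
    rw [this]
    refine (norm_add_le _ _).trans (add_le_add le_rfl ?_)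
    rw [norm_mul]
    exact (mul_le_of_le_one_left (norm_nonneg _) (ha i)).trans ih

lemma one_add_sum_le {ι : Type*} (s : Finset ι) (x : ι → ℝ) (hx : ∀ i, 0 ≤ x i) :
    1 + ∑ i ∈ s, x i ≤ ∏ i ∈ s, (1 + x i) := by
  classical
  induction s using Finset.induction_on with
  | empty => simp
  | insert i s hi ih =>
    rw [prod_insert hi, sum_insert hi]
    have := sum_nonneg fun i (_ : i ∈ s) => hx i
    nlinarith [hx i, mul_le_mul_of_nonneg_left ih (by linarith [hx i] : 0 ≤ 1 + x i), mul_nonneg (hx i) this]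

lemma prod_far {ι : Type*} (s : Finset ι) (g x : ι → ℝ) (hg : ∀ i, 0 ≤ g i) (hx : ∀ i, 0 ≤ x i)
    (h : ∀ i, g i ^ 1024 * (1 + x i) ≤ 1) : (∏ i ∈ s, g i) ^ 1024 * ∑ i ∈ s, x i ≤ 1 := by
  calc _ ≤ (∏ i ∈ s, g i ^ 1024) * ∏ i ∈ s, (1 + x i) := by
        rw [prod_pow]
        exact mul_le_mul_of_nonneg_left (by linarith [one_add_sum_le s x hx]) (pow_nonneg (prod_nonneg fun i _ => hg i) _)
    _ ≤ 1 := by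
        rw [← prod_mul_distrib]
        exact prod_le_one (fun i _ => mul_nonneg (pow_nonneg (hg i) _) (by linarith [hx i])) fun i _ => h i

lemma prod_diff {ι : Type*} (s : Finset ι) (a b : ι → ℂ) (ρ : ι → ℝ) (hρ : ∀ i, 1 / 2 ≤ ρ i)
    (ha : ∀ i, ‖a i‖ ≤ ρ i) (hb : ∀ i, ‖b i‖ ≤ ρ i) :
    ‖∏ i ∈ s, a i - ∏ i ∈ s, b i‖ ≤ (∑ i ∈ s, 2 * ‖a i - b i‖) * ∏ i ∈ s, ρ i := by
  classical
  induction s using Finset.induction_on with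
  | empty => simp
  | insert i s hi ih =>
    rw [prod_insert hi, sum_insert hi, prod_insert hi, prod_insert hi]
    have : a i * ∏ x ∈ s, a x - b i * ∏ x ∈ s, b x
      = (a i - b i) * ∏ x ∈ s, a x + b i * (∏ x ∈ s, a x - ∏ x ∈ s, b x) := by ring
    rw [this]
    refine (norm_add_le _ _).trans ?_
    rw [norm_mul, norm_mul, norm_prod]
    have h1 : ∏ x ∈ s, ‖a x‖ ≤ ∏ x ∈ s, ρ x := prod_le_prod (fun _ _ => norm_nonneg _) fun x _ => ha x
    have h0 : 0 ≤ ∏ x ∈ s, ρ x := prod_nonneg fun x _ => by linarith [hρ x]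
    have h2 : ‖a i - b i‖ * ∏ x ∈ s, ‖a x‖ ≤ ‖a i - b i‖ * ∏ x ∈ s, ρ x := by gcongr
    have h3 : ‖b i‖ * ‖∏ x ∈ s, a x - ∏ x ∈ s, b x‖ ≤ ρ i * ((∑ i ∈ s, 2 * ‖a i - b i‖) * ∏ i ∈ s, ρ i) :=
      mul_le_mul (hb i) ih (norm_nonneg _) (by linarith [hρ i])
    have h4 : 0 ≤ ‖a i - b i‖ * ∏ x ∈ s, ρ x := by positivity
    nlinarith [hρ i]

section dd
variable {d : ℕ}

noncomputable def aD (N : ℕ) (z : Fin d → ℂ) : ℂ := ∏ i, aS N (z i)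
noncomputable def fD (n : ℕ) (z : Fin d → ℂ) : ℝ := ∏ i, ‖gs (2 ^ n) (z i)‖ ^ 2
noncomputable def YY (z : Fin d → ℂ) : ℝ := ∑ i, ‖z i - 1‖ ^ 2

lemma YY_nonneg (z : Fin d → ℂ) : 0 ≤ YY z := sum_nonneg fun _ _ => sq_nonneg _

variable {z : Fin d → ℂ} (hz : ∀ i, ‖z i‖ = 1)
include hz

lemma aS_le_one (N : ℕ) (i : Fin d) : ‖aS N (z i)‖ ≤ 1 := by rw [aS_norm (hz i)]; exact gs_le_one (hz i) _

lemma aD_le_one (N : ℕ) : ‖aD N z‖ ≤ 1 := by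
  rw [aD, norm_prod]; exact prod_le_one (fun _ _ => norm_nonneg _) fun i _ => aS_le_one hz N i

lemma aD_near (N : ℕ) : ‖aD N z - 1‖ ≤ N ^ 2 * YY z := by
  refine (prod_sub_one_le _ _ (aS_le_one hz N)).trans ?_
  rw [YY, mul_sum]
  refine sum_le_sum fun i _ => (aS_near (hz i) N).trans ?_
  rw [mul_pow]; nlinarith [mul_nonneg (sq_nonneg (N:ℝ)) (sq_nonneg ‖z i - 1‖)]

lemma aS_pow {N : ℕ} (hN : 1 ≤ N) (i : Fin d) : ‖aS N (z i)‖ ^ 1024 * (1 + (N * ‖z i - 1‖) ^ 2) ≤ 1 := by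
  refine le_trans ?_ (gs_pow (hz i) (L := 2 * N + 1) (by omega))
  rw [aS_norm (hz i)]
  gcongr; linarith [Nat.cast_nonneg (α := ℝ) N]

lemma aD_far {N : ℕ} (hN : 1 ≤ N) : ‖aD N z‖ ^ 1024 * (N ^ 2 * YY z) ≤ 1 := by
  rw [aD, norm_prod, YY, mul_sum]
  refine prod_far _ _ _ (fun _ => norm_nonneg _) (fun _ => by positivity) fun i => ?_
  rw [← mul_pow]; exact aS_pow hz hN i

lemma aD_diff {N h : ℕ} (hN : 1 ≤ N) (hh : h ≤ N) : ‖aD N z - aD (N + h) z‖ ≤ 12288 * (h / N) := by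
  set s : Fin d → ℝ := fun i => min 1 ((N * ‖z i - 1‖) ^ 2) with hs
  have hs0 : ∀ i, 0 ≤ s i := fun i => by positivity
  have hs1 : ∀ i, s i ≤ 1 := fun i => min_le_left _ _
  have hsp : ∀ M : ℕ, N ≤ M → ∀ i, ‖aS M (z i)‖ ≤ Real.exp (-(s i / 2048)) := by
    intro M hM i
    have h1 := aS_pow hz (hN.trans hM) i
    have h2 : s i ≤ (M * ‖z i - 1‖) ^ 2 := (min_le_right _ _).trans (by gcongr)
    have h3 : Real.exp (s i / 2) ≤ 1 + s i := by
      have := Real.exp_bound' (x := s i / 2) (by linarith [hs0 i]) (by linarith [hs1 i]) (n := 2) (by norm_num)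
      norm_num [sum_range_succ] at this
      nlinarith [hs0 i, hs1 i]
    have h4 : ‖aS M (z i)‖ ^ 1024 * Real.exp (s i / 2) ≤ 1 :=
      (mul_le_mul_of_nonneg_left (by linarith) (by positivity)).trans h1
    have h5 : ‖aS M (z i)‖ ^ 1024 ≤ Real.exp (-(s i / 2048)) ^ 1024 := by
      rw [← Real.exp_nat_mul]
      have : ((1024:ℕ):ℝ) * -(s i / 2048) = -(s i / 2) := by push_cast; ring
      rw [this, Real.exp_neg, ← one_div, le_div_iff₀ (Real.exp_pos _)]; exact h4
    exact le_of_pow_le_pow_left₀ (by norm_num) (Real.exp_pos _).le h5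
  have hρ : ∀ i, 1 / 2 ≤ Real.exp (-(s i / 2048)) := fun i => by
    linarith [Real.add_one_le_exp (-(s i / 2048)), hs1 i]
  have hd := prod_diff univ (fun i => aS N (z i)) (fun i => aS (N + h) (z i)) _ hρ (hsp N le_rfl) (hsp (N + h) (by omega))
  refine hd.trans ?_
  rw [← Real.exp_sum, sum_neg_distrib, ← sum_div]
  set S := ∑ i, s i with hS
  have hN0 : (0:ℝ) < N := by exact_mod_cast hN
  have h6 : ∑ i, 2 * ‖aS N (z i) - aS (N + h) (z i)‖ ≤ 6 * (h / N) * S := by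
    rw [hS, mul_sum]
    refine sum_le_sum fun i _ => ?_
    have := aS_diff (hz i) hN hh
    calc _ ≤ 2 * (3 * h / N * min 1 ((N * ‖z i - 1‖) ^ 2)) := by gcongr
      _ = _ := by simp only [hs]; ring
  have h7 : S * Real.exp (-(S / 2048)) ≤ 2048 := by
    have := Real.add_one_le_exp (S / 2048)
    rw [Real.exp_neg, ← div_eq_mul_inv, div_le_iff₀ (Real.exp_pos _)]
    nlinarith
  calc _ ≤ 6 * (h / N) * S * Real.exp (-(S / 2048)) := by gcongr
    _ = 6 * (h / N) * (S * Real.exp (-(S / 2048))) := by ring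
    _ ≤ 6 * (h / N) * 2048 := by gcongr
    _ = _ := by ring

omit hz in
lemma fD_nonneg (n : ℕ) : 0 ≤ fD n z := prod_nonneg fun _ _ => sq_nonneg _

lemma gs2_le_one (n : ℕ) (i : Fin d) : ‖gs (2 ^ n) (z i)‖ ^ 2 ≤ 1 := pow_le_one₀ (norm_nonneg _) (gs_le_one (hz i) _)

lemma fD_le_one (n : ℕ) : fD n z ≤ 1 := prod_le_one (fun _ _ => sq_nonneg _) fun i _ => gs2_le_one hz n i

lemma fD_anti (n : ℕ) : fD (n + 1) z ≤ fD n z := by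
  refine prod_le_prod (fun _ _ => sq_nonneg _) fun i _ => ?_
  gcongr
  rw [pow_succ, mul_comm]; exact gs_double (hz i) _

omit hz in
lemma fD_zero : fD 0 z = 1 := by simp [fD, gs]

lemma fD_near (n : ℕ) : 1 - fD n z ≤ 4 ^ n * YY z := by
  have h := prod_sub_one_le univ (fun i => ((‖gs (2 ^ n) (z i)‖ ^ 2 : ℝ) : ℂ)) (fun i => by
    rw [Complex.norm_real, Real.norm_of_nonneg (sq_nonneg _)]; exact gs2_le_one hz n i)
  rw [← Complex.ofReal_prod, ← Complex.ofReal_one, ← Complex.ofReal_sub, Complex.norm_real] at h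
  have h0 : 1 - fD n z ≤ ‖fD n z - 1‖ := by rw [Real.norm_eq_abs, abs_sub_comm]; exact le_abs_self _
  refine h0.trans (h.trans ?_)
  rw [YY, mul_sum]
  refine sum_le_sum fun i _ => ?_
  rw [← Complex.ofReal_sub, Complex.norm_real, Real.norm_eq_abs, abs_sub_comm, abs_of_nonneg (by linarith [gs2_le_one hz n i])]
  refine (gs_sq (hz i) Nat.one_le_two_pow).trans (le_of_eq ?_)
  rw [mul_pow]; congr 1; push_cast; rw [← pow_mul, mul_comm, pow_mul]; norm_num

lemma fD_far {n : ℕ} (hn : 1 ≤ n) : fD n z ^ 1024 * (4 ^ n * YY z) ≤ 1 := by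
  rw [fD, YY, mul_sum]
  refine prod_far _ _ _ (fun _ => sq_nonneg _) (fun _ => by positivity) fun i => ?_
  have h2 : 2 ≤ 2 ^ n := by
    calc 2 = 2 ^ 1 := rfl
      _ ≤ 2 ^ n := Nat.pow_le_pow_right (by norm_num) hn
  have h := gs_pow (hz i) h2
  have e : ((2 ^ n : ℕ) * ‖z i - 1‖ : ℝ) ^ 2 = 4 ^ n * ‖z i - 1‖ ^ 2 := by
    rw [mul_pow]; congr 1; push_cast; rw [← pow_mul, mul_comm, pow_mul]; norm_num
  rw [e] at h
  refine le_trans ?_ h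
  gcongr
  have := gs_le_one (hz i) (2 ^ n)
  nlinarith [norm_nonneg (gs (2 ^ n) (z i))]

end dd
end DF

namespace DF
open Finset
set_option linter.unusedVariables false
set_option linter.unusedSectionVars false

abbrev GG (d K : ℕ) := Fin d → ZMod (2 ^ K)

section ker
variable {d K : ℕ}

/-- product kernel -/
noncomputable def pk (w : ZMod (2 ^ K) → ℝ) (g : GG d K) : ℝ := ∏ i, w (g i)

lemma pk_sum {R : Type} [CommSemiring R] (F : Fin d → ZMod (2 ^ K) → R) :
    ∑ g : GG d K, ∏ i, F i (g i) = ∏ i, ∑ b, F i b := by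
  rw [prod_univ_sum, Fintype.piFinset_univ]

lemma pk_PK {w : ZMod (2 ^ K) → ℝ} (h : PK w) : PK (pk w : GG d K → ℝ) where
  nn g := prod_nonneg fun i _ => h.nn _
  one := by simp only [pk]; rw [pk_sum]; simp [h.one]
  ev g := prod_congr rfl fun i _ => h.ev _

/-- coordinate characters -/
noncomputable def ci (ψ : AddChar (GG d K) ℂ) (i : Fin d) : AddChar (ZMod (2 ^ K)) ℂ :=
  ψ.compAddMonoidHom (AddMonoidHom.single (fun _ => ZMod (2 ^ K)) i)

lemma ci_prod (ψ : AddChar (GG d K) ℂ) (g : GG d K) : ψ g = ∏ i, ci ψ i (g i) := by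
  conv_lhs => rw [← univ_sum_single g]
  exact map_sum ψ.toAddMonoidHom (fun i => Pi.single i (g i)) univ

lemma pk_symbol (w : ZMod (2 ^ K) → ℝ) (ψ : AddChar (GG d K) ℂ) :
    ∑ g, (pk w g : ℂ) * ψ g = ∏ i, ∑ b, (w b : ℂ) * ci ψ i b := by
  rw [← pk_sum (fun i b => (w b : ℂ) * ci ψ i b)]
  refine sum_congr rfl fun g _ => ?_
  rw [prod_mul_distrib, ← ci_prod, pk]; push_cast; rfl

noncomputable def wA (K N : ℕ) (b : ZMod (2 ^ K)) : ℝ :=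
  ((2 * N + 1 : ℕ) : ℝ)⁻¹ * ∑ j ∈ Icc (-(N:ℤ)) N, if (j : ZMod (2 ^ K)) = b then 1 else 0

lemma wA_sum {V : Type} [AddCommGroup V] [Module ℝ V] (N : ℕ) (F : ZMod (2 ^ K) → V) :
    ∑ b, wA K N b • F b = ((2 * N + 1 : ℕ) : ℝ)⁻¹ • ∑ j ∈ Icc (-(N:ℤ)) N, F (j : ZMod (2 ^ K)) := by
  simp only [wA, mul_smul, sum_smul, ← smul_sum]
  rw [sum_comm]; simp

lemma wA_PK (N : ℕ) : PK (wA K N) where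
  nn b := mul_nonneg (by positivity) (sum_nonneg fun j _ => by split_ifs <;> norm_num)
  one := by
    have := wA_sum (K := K) N (fun _ => (1:ℝ))
    simp only [smul_eq_mul, mul_one, sum_const, card_box, nsmul_eq_mul] at this
    rw [this, inv_mul_cancel₀ (Nat.cast_ne_zero.2 (by omega))]
  ev b := by
    rw [wA, wA, ← sum_sym]
    congr 1; refine sum_congr rfl fun j _ => ?_
    congr 1; push_cast; rw [neg_inj]

noncomputable def wF (K n : ℕ) (b : ZMod (2 ^ K)) : ℝ :=
  ((2:ℝ) ^ K * 2 ^ n)⁻¹ * ∑ u : ZMod (2 ^ K), if u.val / 2 ^ n = (u + b).val / 2 ^ n then 1 else 0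

lemma blk {n : ℕ} (hn : n ≤ K) {q : ℕ} (hq : q < 2 ^ (K - n)) {R : Type} [AddCommMonoid R] (h : ℕ → R) :
    ∑ y : ZMod (2 ^ K) with y.val / 2 ^ n = q, h y.val = ∑ j ∈ range (2 ^ n), h (2 ^ n * q + j) := by
  have hM : 2 ^ K = 2 ^ n * 2 ^ (K - n) := by rw [← pow_add]; congr 1; omega
  have hp : 0 < 2 ^ n := by positivity
  have hlt : ∀ j < 2 ^ n, 2 ^ n * q + j < 2 ^ K := by
    intro j hj
    rw [hM]
    calc _ < 2 ^ n * q + 2 ^ n := by omega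
      _ = 2 ^ n * (q + 1) := by ring
      _ ≤ _ := Nat.mul_le_mul_left _ hq
  refine sum_nbij' (fun y => y.val % 2 ^ n) (fun j => ((2 ^ n * q + j : ℕ) : ZMod (2 ^ K))) ?_ ?_ ?_ ?_ ?_
  · intro y hy; exact mem_range.2 (Nat.mod_lt _ hp)
  · intro j hj
    have hj := mem_range.1 hj
    simp only [mem_filter, mem_univ, true_and]
    rw [ZMod.val_natCast, Nat.mod_eq_of_lt (hlt j hj), Nat.mul_add_div hp, Nat.div_eq_of_lt hj, add_zero]
  · intro y hy
    simp only [mem_filter, mem_univ, true_and] at hy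
    rw [← hy, Nat.div_add_mod, ZMod.natCast_zmod_val]
  · intro j hj
    have hj := mem_range.1 hj
    rw [ZMod.val_natCast, Nat.mod_eq_of_lt (hlt j hj), Nat.mul_add_mod, Nat.mod_eq_of_lt hj]
  · intro y hy
    simp only [mem_filter, mem_univ, true_and] at hy
    rw [← hy, Nat.div_add_mod]

lemma q_lt {n : ℕ} (hn : n ≤ K) (y : ZMod (2 ^ K)) : y.val / 2 ^ n < 2 ^ (K - n) := by
  rw [Nat.div_lt_iff_lt_mul (by positivity), ← pow_add, Nat.sub_add_cancel hn]; exact ZMod.val_lt y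

lemma fib_card {n : ℕ} (hn : n ≤ K) (u : ZMod (2 ^ K)) :
    ∑ y : ZMod (2 ^ K), (if u.val / 2 ^ n = y.val / 2 ^ n then (1:ℝ) else 0) = 2 ^ n := by
  have := blk hn (q_lt hn u) (fun _ => (1:ℝ))
  rw [sum_filter] at this
  simp only [eq_comm (a := u.val / 2 ^ n)]
  rw [this]; simp

lemma wF_sum {R : Type} [CommRing R] [Algebra ℝ R] (n : ℕ) (F : ZMod (2 ^ K) → R) :
    ∑ b, wF K n b • F b = ((2:ℝ) ^ K * 2 ^ n)⁻¹ • ∑ u : ZMod (2 ^ K), ∑ y : ZMod (2 ^ K),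
      if u.val / 2 ^ n = y.val / 2 ^ n then F (y - u) else 0 := by
  simp only [wF, mul_smul, sum_smul, ← smul_sum]
  rw [sum_comm]
  congr 1; refine sum_congr rfl fun u _ => ?_
  rw [← Equiv.sum_comp (Equiv.subRight u)]
  refine sum_congr rfl fun y _ => ?_
  simp only [Equiv.subRight_apply, add_sub_cancel, ite_smul, one_smul, zero_smul]

lemma wF_PK {n : ℕ} (hn : n ≤ K) : PK (wF K n) where
  nn b := mul_nonneg (by positivity) (sum_nonneg fun j _ => by split_ifs <;> norm_num)
  one := by
    have := wF_sum (K := K) n (fun _ => (1:ℝ))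
    simp only [smul_eq_mul, mul_one] at this
    rw [this]
    simp only [fib_card hn, sum_const, card_univ, ZMod.card, nsmul_eq_mul]
    push_cast; field_simp
  ev b := by
    rw [wF, wF, ← Equiv.sum_comp (Equiv.addRight b)]
    congr 1; refine sum_congr rfl fun u _ => ?_
    simp only [Equiv.coe_addRight, add_neg_cancel_right]
    simp only [eq_comm]

lemma zchar (χ : AddChar (ZMod (2 ^ K)) ℂ) (b : ZMod (2 ^ K)) : χ b = χ 1 ^ b.val := by
  conv_lhs => rw [← ZMod.natCast_zmod_val b, ← nsmul_one, AddChar.map_nsmul_eq_pow]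

lemma wA_symbol (N : ℕ) (χ : AddChar (ZMod (2 ^ K)) ℂ) : ∑ b, (wA K N b : ℂ) * χ b = aS N (χ 1) := by
  have := wA_sum (K := K) N (fun b => χ b)
  simp only [Complex.real_smul] at this
  rw [this, aS]; push_cast
  congr 1; refine sum_congr rfl fun j _ => ?_
  rw [← zsmul_one, AddChar.map_zsmul_eq_zpow]

lemma wF_symbol {n : ℕ} (hn : n ≤ K) (χ : AddChar (ZMod (2 ^ K)) ℂ) :
    ∑ b, (wF K n b : ℂ) * χ b = ((‖gs (2 ^ n) (χ 1)‖ ^ 2 : ℝ) : ℂ) := by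
  have := wF_sum (K := K) n (fun b => χ b)
  simp only [Complex.real_smul] at this
  rw [this]
  set z := χ 1 with hz
  have hz1 : ‖z‖ = 1 := AddChar.norm_apply χ 1
  set g := ∑ j ∈ range (2 ^ n), z ^ j with hg
  have hB : ∀ q < 2 ^ (K - n), ∑ y : ZMod (2 ^ K) with y.val / 2 ^ n = q, χ y = z ^ (2 ^ n * q) * g := by
    intro q hq
    have := blk hn hq (fun j => z ^ j)
    simp only [pow_add, ← mul_sum] at this
    rw [← this]; exact sum_congr rfl fun y _ => zchar χ y
  have e : ∑ u : ZMod (2 ^ K), ∑ y : ZMod (2 ^ K), (if u.val / 2 ^ n = y.val / 2 ^ n then χ (y - u) else 0)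
      = ∑ q ∈ range (2 ^ (K - n)), ((‖g‖ ^ 2 : ℝ) : ℂ) := by
    rw [← sum_fiberwise_of_maps_to (g := fun u : ZMod (2 ^ K) => u.val / 2 ^ n) (t := range (2 ^ (K - n)))
      (fun u _ => mem_range.2 (q_lt hn u))]
    refine sum_congr rfl fun q hq => ?_
    have h1 : ∀ u ∈ univ.filter (fun u : ZMod (2 ^ K) => u.val / 2 ^ n = q),
        ∑ y : ZMod (2 ^ K), (if u.val / 2 ^ n = y.val / 2 ^ n then χ (y - u) else 0)
        = (starRingEnd ℂ) (χ u) * (z ^ (2 ^ n * q) * g) := by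
      intro u hu
      simp only [mem_filter, mem_univ, true_and] at hu
      rw [← hB q (mem_range.1 hq), hu, ← sum_filter, mul_sum]
      simp only [eq_comm (a := q)]
      refine sum_congr rfl fun y _ => ?_
      rw [sub_eq_add_neg, AddChar.map_add_eq_mul, AddChar.map_neg_eq_conj, mul_comm]
    rw [sum_congr rfl h1, ← sum_mul, ← map_sum, hB q (mem_range.1 hq), mul_comm, Complex.mul_conj']
    rw [norm_mul, norm_pow, hz1]; simp
  rw [e, sum_const, card_range, gs, norm_mul, ← hg, mul_pow]
  have h2 : (2:ℝ) ^ K = 2 ^ n * 2 ^ (K - n) := by rw [← pow_add]; congr 1; omega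
  simp only [h2, norm_inv, Complex.norm_natCast, nsmul_eq_mul]
  rw [← Complex.ofReal_natCast, ← Complex.ofReal_mul, ← Complex.ofReal_mul, Complex.ofReal_inj]
  push_cast
  field_simp

noncomputable def kA (N : ℕ) : GG d K → ℝ := pk (wA K N)
noncomputable def kF (n : ℕ) : GG d K → ℝ := pk (wF K n)

lemma kA_PK (N : ℕ) : PK (kA N : GG d K → ℝ) := pk_PK (wA_PK N)
lemma kF_PK {n : ℕ} (hn : n ≤ K) : PK (kF n : GG d K → ℝ) := pk_PK (wF_PK hn)

noncomputable def zz (ψ : AddChar (GG d K) ℂ) (i : Fin d) : ℂ := ci ψ i 1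

lemma zz_norm (ψ : AddChar (GG d K) ℂ) (i : Fin d) : ‖zz ψ i‖ = 1 := AddChar.norm_apply _ _

lemma ft_A (N : ℕ) (f : GG d K → ℂ) (ψ : AddChar (GG d K) ℂ) : ft (cv (kA N) f) ψ = aD N (zz ψ) * ft f ψ := by
  rw [ft_cv, kA, pk_symbol]; simp only [wA_symbol]; rfl

lemma ft_F {n : ℕ} (hn : n ≤ K) (f : GG d K → ℂ) (ψ : AddChar (GG d K) ℂ) :
    ft (cv (kF n) f) ψ = (fD n (zz ψ) : ℂ) * ft f ψ := by
  rw [ft_cv, kF, pk_symbol]; simp only [wF_symbol hn]; rw [fD]; push_cast; rfl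

/-- the dyadic filtration -/
def dy (d K : ℕ) (k : ℕ) (x : GG d K) : Fin d → ℕ := fun i => (x i).val / 2 ^ (K - k)

lemma dy_refi : Refi (dy d K) := by
  intro n x y h
  funext i
  have := congrFun h i
  simp only [dy] at this ⊢
  by_cases hn : n < K
  · have e : K - n = (K - (n + 1)) + 1 := by omega
    rw [e, pow_succ, ← Nat.div_div_eq_div_mul, ← Nat.div_div_eq_div_mul, this]
  · have e : K - n = K - (n + 1) := by omega
    rw [e, this]

lemma dy_inj : Function.Injective (dy d K K) := by
  intro x y h
  funext i
  have := congrFun h i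
  simp only [dy, Nat.sub_self, pow_zero, Nat.div_one] at this
  exact ZMod.val_injective _ this

lemma F_eq {n : ℕ} (hn : n ≤ K) (f : GG d K → ℝ) (x : GG d K) :
    cv (kF n) f x = ((2:ℝ) ^ (K * d))⁻¹ * ∑ s : GG d K, E (dy d K) (K - n) (fun y => f (y - s)) (x + s) := by
  classical
  have hK : K - (K - n) = n := by omega
  have hk : ∀ g : GG d K, kF n g = (((2:ℝ) ^ K * 2 ^ n)⁻¹) ^ d *
      ∑ u : GG d K, if dy d K (K - n) u = dy d K (K - n) (u + g) then 1 else 0 := by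
    intro g
    have : ∀ u : GG d K, (if dy d K (K - n) u = dy d K (K - n) (u + g) then (1:ℝ) else 0)
        = ∏ i, if (u i).val / 2 ^ n = (u i + g i).val / 2 ^ n then 1 else 0 := by
      intro u
      rw [prod_boole]
      simp only [dy, hK, funext_iff, mem_univ, true_imp_iff]; rfl
    simp only [this]
    rw [pk_sum (fun i (b : ZMod (2 ^ K)) => if b.val / 2 ^ n = (b + g i).val / 2 ^ n then (1:ℝ) else 0)]
    simp only [kF, pk, wF, prod_mul_distrib, prod_const, card_univ, Fintype.card_fin]
  have hfib : ∀ x : GG d K, ((univ.filter fun y => dy d K (K - n) y = dy d K (K - n) x).card : ℝ) = 2 ^ (n * d) := by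
    intro x
    have h1 : ((univ.filter fun y => dy d K (K - n) y = dy d K (K - n) x).card : ℝ)
        = ∑ y : GG d K, ∏ i, if (x i).val / 2 ^ n = (y i).val / 2 ^ n then 1 else 0 := by
      rw [card_filter]; push_cast
      refine sum_congr rfl fun y _ => ?_
      rw [prod_boole]
      simp only [dy, hK, funext_iff, mem_univ, true_imp_iff]
      congr 1; simp only [eq_comm]
    rw [h1, pk_sum (fun i (b : ZMod (2 ^ K)) => if (x i).val / 2 ^ n = b.val / 2 ^ n then (1:ℝ) else 0)]
    simp [fib_card hn, pow_mul]
  have hE : ∀ (h : GG d K → ℝ) (x : GG d K), E (dy d K) (K - n) h x =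
      ((2:ℝ) ^ (n * d))⁻¹ * ∑ y, if dy d K (K - n) x = dy d K (K - n) y then h y else 0 := by
    intro h x
    rw [E, ← hfib x, div_eq_inv_mul, sum_filter]
    simp only [eq_comm (a := dy d K (K - n) x)]
    congr!
  simp only [hE, cv, hk, smul_eq_mul, sum_mul, mul_sum]
  rw [sum_comm, ← Equiv.sum_comp (Equiv.addLeft x)]
  refine sum_congr rfl fun s _ => ?_
  conv_rhs => rw [← Equiv.sum_comp (Equiv.addLeft (x + s))]
  refine sum_congr rfl fun g _ => ?_
  have : x + s + g - s = x + g := by abel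
  change (_ * (if dy d K (K - n) (x + s) = dy d K (K - n) (x + s + g) then (1:ℝ) else 0)) * f (x + g)
    = _ * (_ * (if dy d K (K - n) (x + s) = dy d K (K - n) (x + s + g) then f (x + s + g - s) else 0))
  rw [this]
  by_cases hh : dy d K (K - n) (x + s) = dy d K (K - n) (x + s + g)
  · rw [if_pos hh, if_pos hh, mul_inv, mul_pow, inv_pow, inv_pow, ← pow_mul, ← pow_mul]; ring
  · rw [if_neg hh, if_neg hh]; simp

end ker
end DF

namespace DF
open Finset
set_option linter.unusedVariables false
set_option linter.unusedSectionVars false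

section F
variable {d K : ℕ}

lemma cv_re_im {G : Type} [AddCommGroup G] [Fintype G] (k : G → ℝ) (f : G → ℂ) (x : G) :
    cv k f x = ((cv k (fun y => (f y).re) x : ℝ) : ℂ) + Complex.I * ((cv k (fun y => (f y).im) x : ℝ) : ℂ) := by
  simp only [cv, smul_eq_mul, Complex.ofReal_sum, mul_sum, ← sum_add_distrib]
  refine sum_congr rfl fun g _ => ?_
  conv_lhs => rw [← Complex.re_add_im (f (x + g))]
  rw [Complex.real_smul]; push_cast; ring

lemma nm_re_le {Ω : Type} [Fintype Ω] {p : ℝ} (hp : 0 < p) (f : Ω → ℂ) :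
    nm p (fun y => (f y).re) ≤ nm p (fun y => ‖f y‖) := nm_mono hp fun x => Complex.abs_re_le_norm _
lemma nm_im_le {Ω : Type} [Fintype Ω] {p : ℝ} (hp : 0 < p) (f : Ω → ℂ) :
    nm p (fun y => (f y).im) ≤ nm p (fun y => ‖f y‖) := nm_mono hp fun x => Complex.abs_im_le_norm _

lemma avg_nm {p : ℝ} (hp : 1 ≤ p) {B : ℝ} (W : GG d K → GG d K → ℝ) (h : ∀ s, nm p (W s) ≤ B) :
    nm p (fun x => ((2:ℝ) ^ (K * d))⁻¹ * ∑ s, W s (x + s)) ≤ B := by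
  rw [nm_smul (by linarith) (by positivity), inv_mul_le_iff₀ (by positivity)]
  refine (nm_sum hp univ (fun s x => W s (x + s))).trans ?_
  calc _ ≤ ∑ s : GG d K, B := by
        refine sum_le_sum fun s _ => ?_
        exact (nm_equiv p (Equiv.addRight s) (W s)).le.trans (h s)
    _ = _ := by
        rw [sum_const, card_univ, Fintype.card_fun, ZMod.card, Fintype.card_fin, nsmul_eq_mul, ← pow_mul]
        push_cast; rfl

lemma sub_nm (p : ℝ) (s : GG d K) (f : GG d K → ℝ) : nm p (fun y => f (y - s)) = nm p f :=
  nm_equiv p (Equiv.subRight s) f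

lemma FVar {p r : ℝ} (hp : 1 < p) (hr : 2 < r) : ∃ C : ℝ, 0 < C ∧ ∀ (d K : ℕ) (f : GG d K → ℂ),
    ∃ W : GG d K → ℝ, nm p W ≤ C * nm p (fun x => ‖f x‖) ∧ ∀ x, VDom r (fun n => cv (kF n) f x) (K + 1) (W x) := by
  obtain ⟨C, hC, H⟩ := lepingle hp hr
  have real : ∀ (d K : ℕ) (f : GG d K → ℝ), ∃ W : GG d K → ℝ, nm p W ≤ C * nm p f ∧
      ∀ x, VDom r (fun n => ((cv (kF n) f x : ℝ) : ℂ)) (K + 1) (W x) := by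
    intro d K f
    choose W hW hV using fun s : GG d K => H (GG d K) (Fin d → ℕ) _ (dy d K) dy_refi K dy_inj (fun y => f (y - s))
    refine ⟨fun x => ((2:ℝ) ^ (K * d))⁻¹ * ∑ s, W s (x + s), avg_nm hp.le W fun s => ?_, fun x => ?_⟩
    · rw [← sub_nm p s f]; exact hW s
    · have h1 := (VDom.sum (by linarith : 1 ≤ r) univ (fun s _ => hV s (x + s))).smul ((((2:ℝ) ^ (K * d))⁻¹ : ℝ) : ℂ)
      rw [Complex.norm_real, Real.norm_of_nonneg (by positivity)] at h1
      refine h1.reverse.congr fun n hn => ?_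
      rw [F_eq (by omega)]; push_cast; rfl
  refine ⟨2 * C, by positivity, fun d K f => ?_⟩
  obtain ⟨W1, h1, V1⟩ := real d K (fun y => (f y).re)
  obtain ⟨W2, h2, V2⟩ := real d K (fun y => (f y).im)
  refine ⟨fun x => W1 x + W2 x, ?_, fun x => ?_⟩
  · have h3 := nm_re_le (by linarith : 0 < p) f
    have h4 := nm_im_le (by linarith : 0 < p) f
    refine (nm_add hp.le _ _).trans ?_
    nlinarith
  · have := (V1 x).add (by linarith) ((V2 x).smul Complex.I)
    rw [Complex.norm_I, one_mul] at this
    exact this.congr fun n _ => (cv_re_im _ _ _).symm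

lemma FMax {p : ℝ} (hp : 1 < p) : ∃ C : ℝ, 0 < C ∧ ∀ (d K : ℕ) (f : GG d K → ℝ),
    ∃ W : GG d K → ℝ, (∀ n ≤ K, ∀ x, |cv (kF n) f x| ≤ W x) ∧ nm p W ≤ C * nm p f := by
  obtain ⟨C, hC, H⟩ := mart_bd hp
  refine ⟨C, hC, fun d K f => ?_⟩
  have h := fun s : GG d K => (H (GG d K) (Fin d → ℕ) inferInstance (dy d K) dy_refi K dy_inj (fun y => f (y - s))).1
  refine ⟨fun x => ((2:ℝ) ^ (K * d))⁻¹ * ∑ s, rmx (fun k => E (dy d K) k (fun y => f (y - s)) (x + s)) K, ?_, ?_⟩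
  · intro n hn x
    rw [F_eq hn, abs_mul, abs_of_nonneg (by positivity : (0:ℝ) ≤ ((2:ℝ) ^ (K * d))⁻¹)]
    refine mul_le_mul_of_nonneg_left ?_ (by positivity)
    refine (abs_sum_le_sum_abs _ _).trans (sum_le_sum fun s _ => ?_)
    exact le_rmx (fun k => E (dy d K) k (fun y => f (y - s)) (x + s)) (by omega : K - n ≤ K)
  · refine avg_nm hp.le (fun s x => rmx (fun k => E (dy d K) k (fun y => f (y - s)) x) K) fun s => ?_
    rw [← sub_nm p s f]; exact h s

lemma hold_true (a : ℕ → ℝ) (n : ℕ) : hold (fun _ => True) a n = a n := by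
  cases n <;> simp [hold]

/-- martingale differences -/
noncomputable def DD (m : ℕ) (f : GG d K → ℂ) (x : GG d K) : ℂ := cv (kF m) f x - cv (kF (m + 1)) f x

lemma FSq {p : ℝ} (hp : 1 < p) : ∃ C : ℝ, 0 < C ∧ ∀ (d K : ℕ) (f : GG d K → ℂ),
    nm p (sqn (fun m : Fin K => DD m f)) ≤ C * nm p (fun x => ‖f x‖) := by
  obtain ⟨C, hC, H⟩ := mart_bd hp
  have hp0 : 0 < p := by linarith
  have real : ∀ (d K : ℕ) (f : GG d K → ℝ),
      nm p (sqn (fun (m : Fin K) x => ((cv (kF m) f x - cv (kF (m + 1)) f x : ℝ) : ℂ))) ≤ C * nm p f := by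
    intro d K f
    have h := fun s : GG d K => (H (GG d K) (Fin d → ℕ) inferInstance (dy d K) dy_refi K dy_inj (fun y => f (y - s))).2
      (fun _ _ => True) (fun n x y _ => rfl)
    set e : GG d K → ℕ → GG d K → ℝ := fun s k x => E (dy d K) k (fun y => f (y - s)) x with he
    refine le_trans (nm_mono hp0 fun x => ?_) (avg_nm hp.le (fun s x => √(ss (fun _ => True) (fun k => e s k x) K))
      fun s => by rw [← sub_nm p s f]; exact h s)
    rw [abs_of_nonneg (sqn_nonneg _ _)]
    set c := ((2:ℝ) ^ (K * d))⁻¹ with hc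
    have hc0 : 0 ≤ c := by positivity
    have e1 : sqn (fun (m : Fin K) x => ((cv (kF m) f x - cv (kF (m + 1)) f x : ℝ) : ℂ)) x
        = sqn (fun (m : Fin K) x => ∑ s, ((c * (e s (K - m) (x + s) - e s (K - (m + 1)) (x + s)) : ℝ) : ℂ)) x := by
      unfold sqn; congr 1; refine sum_congr rfl fun m _ => ?_
      dsimp only
      rw [F_eq (by omega), F_eq (by omega), ← mul_sub, ← sum_sub_distrib, ← Complex.ofReal_sum, mul_sum]
    rw [e1, mul_sum]
    refine (sqn_sum univ _ x).trans (le_of_eq (sum_congr rfl fun s _ => ?_))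
    rw [sqn, ← Real.sqrt_sq hc0, ← Real.sqrt_mul (sq_nonneg c)]
    congr 1
    simp only [Complex.norm_real, Real.norm_eq_abs, sq_abs, mul_pow]
    rw [ss, Real.sqrt_sq hc0, ← mul_sum]
    congr 1
    rw [Fin.sum_univ_eq_sum_range (fun m => (e s (K - m) (x + s) - e s (K - (m + 1)) (x + s)) ^ 2) K, ← sum_range_reflect]
    refine sum_congr rfl fun m hm => ?_
    have hm := mem_range.1 hm
    simp only [hold_true]
    rw [show K - (K - 1 - m) = m + 1 by omega, show K - (K - 1 - m + 1) = m by omega]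
  refine ⟨2 * C, by positivity, fun d K f => ?_⟩
  have h1 := real d K (fun y => (f y).re)
  have h2 := real d K (fun y => (f y).im)
  have h3 := nm_re_le hp0 f
  have h4 := nm_im_le hp0 f
  set S1 := sqn (fun (m : Fin K) x => ((cv (kF m) (fun y => (f y).re) x - cv (kF (m + 1)) (fun y => (f y).re) x : ℝ) : ℂ)) with hS1
  set S2 := sqn (fun (m : Fin K) x => ((cv (kF m) (fun y => (f y).im) x - cv (kF (m + 1)) (fun y => (f y).im) x : ℝ) : ℂ)) with hS2
  have key : ∀ x, sqn (fun m : Fin K => DD m f) x ≤ S1 x + S2 x := by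
    intro x
    have e1 : sqn (fun m : Fin K => DD m f) x = sqn (fun (m : Fin K) x =>
      ((cv (kF m) (fun y => (f y).re) x - cv (kF (m + 1)) (fun y => (f y).re) x : ℝ) : ℂ) +
      Complex.I * ((cv (kF m) (fun y => (f y).im) x - cv (kF (m + 1)) (fun y => (f y).im) x : ℝ) : ℂ)) x := by
      unfold sqn; congr 1; refine sum_congr rfl fun m _ => ?_
      show ‖cv (kF m) f x - cv (kF (m + 1)) f x‖ ^ 2 = _
      rw [cv_re_im, cv_re_im (kF (m + 1)) f]; congr 2; push_cast; ring
    rw [e1]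
    refine (sqn_add _ _ x).trans (add_le_add le_rfl ?_)
    exact sqn_mono fun m => by rw [norm_mul, Complex.norm_I, one_mul]
  refine (nm_mono hp0 fun x => ?_).trans ((nm_add hp.le S1 S2).trans ?_)
  · rw [abs_of_nonneg (sqn_nonneg _ _)]; exact key x
  · nlinarith

lemma F_zero (f : GG d K → ℂ) (x : GG d K) : cv (kF 0) f x = f x := by
  have h : ∀ g : GG d K → ℝ, cv (kF 0) g x = g x := by
    intro g
    rw [F_eq (Nat.zero_le _), Nat.sub_zero]
    simp only [E_inj _ dy_inj, add_sub_cancel_right, sum_const, card_univ, Fintype.card_fun, ZMod.card,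
      Fintype.card_fin, nsmul_eq_mul, ← pow_mul]
    push_cast; field_simp
  rw [cv_re_im, h, h, mul_comm, Complex.re_add_im]

lemma F_top (f : GG d K → ℂ) (x y : GG d K) : cv (kF K) f x = cv (kF K) f y := by
  have hk : ∀ g : GG d K, kF K g = kF K (0 : GG d K) := by
    intro g
    simp only [kF, pk, wF]
    refine prod_congr rfl fun i _ => ?_
    congr 1; refine sum_congr rfl fun u _ => ?_
    simp [Nat.div_eq_of_lt (ZMod.val_lt _)]
  simp only [cv, hk]
  rw [← smul_sum, ← smul_sum]
  congr 1
  exact (Equiv.sum_comp (Equiv.addLeft x) f).trans (Equiv.sum_comp (Equiv.addLeft y) f).symm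

lemma telesc (f : GG d K → ℂ) (x : GG d K) : f x = ∑ m ∈ range K, DD m f x + cv (kF K) f x := by
  simp only [DD]
  rw [sum_range_sub' (fun m => cv (kF m) f x), F_zero]; ring

lemma ft_sub (f g : GG d K → ℂ) (ψ : AddChar (GG d K) ℂ) : ft (fun x => f x - g x) ψ = ft f ψ - ft g ψ := by
  simp only [ft, mul_sub, sum_sub_distrib]

lemma ft_D {m : ℕ} (hm : m < K) (f : GG d K → ℂ) (ψ : AddChar (GG d K) ℂ) :
    ft (DD m f) ψ = ((fD m (zz ψ) - fD (m + 1) (zz ψ) : ℝ) : ℂ) * ft f ψ := by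
  rw [show DD m f = fun x => cv (kF m) f x - cv (kF (m + 1)) f x from rfl, ft_sub, ft_F hm.le, ft_F hm]
  push_cast; ring

end F
end DF

namespace DF
open Finset
set_option linter.unusedVariables false
set_option linter.unusedSectionVars false

/-- decay ratio -/
noncomputable def rr : ℝ := (1 / 4 : ℝ) ^ (1 / 1024 : ℝ)
lemma rr_pos : 0 < rr := by unfold rr; positivity
lemma rr_lt : rr < 1 := Real.rpow_lt_one (by norm_num) (by norm_num) (by norm_num)
lemma rr_pow : rr ^ 1024 = 1 / 4 := by
  rw [rr, ← Real.rpow_natCast, ← Real.rpow_mul (by norm_num)]; norm_num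

lemma rr_dec {s t X : ℝ} {k : ℕ} (hs : 0 ≤ s) (hs1 : s ≤ 1) (ht : 0 ≤ t) (hX : s ≤ X)
    (h : t ^ 1024 * (4 ^ k * X) ≤ 1) : s * t ≤ rr ^ k := by
  rw [← pow_le_pow_iff_left₀ (by positivity) (pow_nonneg rr_pos.le _) (by norm_num : 1024 ≠ 0)]
  rw [← pow_mul, mul_comm k, pow_mul, rr_pow, mul_pow, one_div, inv_pow, ← one_div, le_div_iff₀ (by positivity)]
  have h1 : s ^ 1024 ≤ X := (pow_le_of_le_one hs hs1 (by norm_num)).trans hX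
  calc s ^ 1024 * t ^ 1024 * 4 ^ k ≤ X * t ^ 1024 * 4 ^ k := by gcongr
    _ ≤ 1 := by linarith [h]

lemma sym_dec {d : ℕ} {z : Fin d → ℂ} (hz : ∀ i, ‖z i‖ = 1) {n N m : ℕ} (h1 : 2 ^ n ≤ N) (h2 : N ≤ 2 ^ (n + 1)) :
    ‖aD N z - (fD n z : ℂ)‖ * (fD m z - fD (m + 1) z) ≤ 10 * rr ^ ((m : ℤ) - n).natAbs := by
  have hY := YY_nonneg z
  have hD0 : 0 ≤ fD m z - fD (m + 1) z := by linarith [fD_anti hz m]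
  have hfn := fD_nonneg (z := z) n
  have hfm := fD_nonneg (z := z) (m + 1)
  have hfn1 := fD_le_one hz n
  have hfm1 := fD_le_one hz m
  have ha := aD_le_one hz N
  have hNl : (4:ℝ) ^ n ≤ N ^ 2 := by
    have : ((2:ℝ) ^ n) ^ 2 ≤ N ^ 2 := by gcongr; exact_mod_cast h1
    rwa [← pow_mul, mul_comm, pow_mul, show (2:ℝ) ^ 2 = 4 by norm_num] at this
  have hNu : (N:ℝ) ^ 2 ≤ 4 * 4 ^ n := by
    have : (N:ℝ) ^ 2 ≤ ((2:ℝ) ^ (n + 1)) ^ 2 := by gcongr; exact_mod_cast h2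
    rw [← pow_mul (2:ℝ), mul_comm (n + 1), pow_mul (2:ℝ), show (2:ℝ) ^ 2 = 4 by norm_num] at this
    linarith [pow_succ (4:ℝ) n]
  have hN1 : 1 ≤ N := le_trans Nat.one_le_two_pow h1
  set s := ‖aD N z - (fD n z : ℂ)‖ with hs
  have hs2 : s ≤ ‖aD N z‖ + fD n z := by
    refine (norm_sub_le _ _).trans ?_
    rw [Complex.norm_real, Real.norm_of_nonneg hfn]
  have hs5 : s ≤ 5 * (4 ^ n * YY z) := by
    have e : aD N z - (fD n z : ℂ) = (aD N z - 1) + ((1 - fD n z : ℝ) : ℂ) := by push_cast; ring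
    have h3 := norm_add_le (aD N z - 1) ((1 - fD n z : ℝ) : ℂ)
    rw [← e, Complex.norm_real, Real.norm_of_nonneg (by linarith)] at h3
    have h4 := aD_near hz N
    have h5 := fD_near hz n
    have h6 : (N:ℝ) ^ 2 * YY z ≤ 4 * 4 ^ n * YY z := by gcongr
    linarith
  have hs0 : 0 ≤ s := norm_nonneg _
  rcases le_or_gt n m with hnm | hnm
  · obtain ⟨k, rfl⟩ := Nat.exists_eq_add_of_le hnm
    have ek : (((n + k : ℕ) : ℤ) - n).natAbs = k := by omega
    rw [ek]
    have key : s / 10 * fD (n + k) z ≤ rr ^ k := by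
      rcases Nat.eq_zero_or_pos (n + k) with h0 | h0
      · have : k = 0 := by omega
        subst this; rw [pow_zero]
        nlinarith [fD_nonneg (z := z) (n + 0)]
      · refine rr_dec (X := 4 ^ n * YY z) (by positivity) (by linarith) (fD_nonneg _) (by nlinarith [mul_nonneg (pow_nonneg (by norm_num : (0:ℝ) ≤ 4) n) hY]) ?_
        have := fD_far hz h0
        rw [pow_add] at this
        calc _ = _ := by ring
          _ ≤ 1 := this
    have : s * (fD (n + k) z - fD (n + k + 1) z) ≤ s * fD (n + k) z := by
      apply mul_le_mul_of_nonneg_left _ hs0; linarith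
    linarith
  · obtain ⟨k, rfl⟩ := Nat.exists_eq_add_of_lt hnm
    set j := k + 1
    have ek : ((m : ℤ) - (m + k + 1 : ℕ)).natAbs = j := by omega
    rw [ek]
    set D := fD m z - fD (m + 1) z with hD
    have hDX : D / 4 ≤ 4 ^ m * YY z := by
      have := fD_near hz (m + 1)
      rw [pow_succ] at this; linarith
    have p4 : (4:ℝ) ^ (m + k + 1) = 4 ^ j * 4 ^ m := by rw [← pow_add]; congr 1; omega
    have k1 : D / 4 * ‖aD N z‖ ≤ rr ^ j := by
      refine rr_dec (by positivity) (by linarith) (norm_nonneg _) hDX ?_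
      refine le_trans ?_ (aD_far hz hN1)
      rw [← mul_assoc (4 ^ j), ← p4]; gcongr
    have k2 : D / 4 * fD (m + k + 1) z ≤ rr ^ j := by
      refine rr_dec (by positivity) (by linarith) hfn hDX ?_
      rw [← mul_assoc (4 ^ j), ← p4]; exact fD_far hz (by omega)
    have : s * D ≤ (‖aD N z‖ + fD (m + k + 1) z) * D := by gcongr
    have := pow_pos rr_pos j
    linarith

lemma sum_int {σ : ℝ} (h0 : 0 ≤ σ) (h1 : σ < 1) (K : ℕ) :
    ∑ j ∈ Ioo (-(K:ℤ)) K, σ ^ j.natAbs ≤ 2 / (1 - σ) := by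
  classical
  have hg : ∑ i ∈ range K, σ ^ i ≤ (1 - σ)⁻¹ := by
    rw [← tsum_geometric_of_lt_one h0 h1]
    exact (summable_geometric_of_lt_one h0 h1).sum_le_tsum _ fun i _ => by positivity
  set s := (range K).image (fun i : ℕ => (i:ℤ))
  set t := (range K).image (fun i : ℕ => -(i:ℤ))
  have hst : Ioo (-(K:ℤ)) K ⊆ s ∪ t := by
    intro j hj
    rw [mem_Ioo] at hj
    simp only [s, t, mem_union, mem_image, mem_range]
    rcases le_total 0 j with h | h
    · exact Or.inl ⟨j.natAbs, by omega, by omega⟩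
    · exact Or.inr ⟨j.natAbs, by omega, by omega⟩
  refine (sum_le_sum_of_subset_of_nonneg hst fun i _ _ => by positivity).trans ?_
  have := sum_union_inter (s₁ := s) (s₂ := t) (f := fun j : ℤ => σ ^ j.natAbs)
  have h3 : 0 ≤ ∑ j ∈ s ∩ t, σ ^ j.natAbs := sum_nonneg fun _ _ => by positivity
  have h4 : ∑ j ∈ s, σ ^ j.natAbs = ∑ i ∈ range K, σ ^ i := by
    rw [sum_image fun a _ b _ h => by simpa using h]; simp
  have h5 : ∑ j ∈ t, σ ^ j.natAbs = ∑ i ∈ range K, σ ^ i := by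
    rw [sum_image fun a _ b _ h => by simpa using h]; simp
  rw [div_eq_mul_inv]; linarith

lemma shift_sum {K : ℕ} (g : ℕ → ℝ) (hg : ∀ i, 0 ≤ g i) (j : ℤ) :
    ∑ n : Fin K, (if 0 ≤ (n:ℤ) + j ∧ (n:ℤ) + j < K then g ((n:ℤ) + j).toNat else 0) ≤ ∑ m : Fin K, g m := by
  classical
  rw [← sum_filter, Fin.sum_univ_eq_sum_range g K,
    ← sum_image (s := univ.filter fun n : Fin K => 0 ≤ (n:ℤ) + j ∧ (n:ℤ) + j < K) (g := fun n : Fin K => ((n:ℤ) + j).toNat)]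
  · refine sum_le_sum_of_subset_of_nonneg ?_ fun i _ _ => hg i
    intro i hi
    simp only [mem_image, mem_filter, mem_univ, true_and] at hi
    obtain ⟨n, h, rfl⟩ := hi
    rw [mem_range]; omega
  · intro a ha b hb h
    simp only [coe_filter, mem_univ, true_and, Set.mem_ofPred_eq] at ha hb
    ext; dsimp only at h; omega

section core
variable {d K : ℕ}

/-- the operators `D_m`, `m ∈ ℤ` -/
noncomputable def DL (m : ℤ) : (GG d K → ℂ) →ₗ[ℂ] (GG d K → ℂ) :=
  if 0 ≤ m ∧ m < K then cvL (kF m.toNat) - cvL (kF (m.toNat + 1)) else 0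

lemma DL_pos {m : ℤ} (h : 0 ≤ m ∧ m < K) (f : GG d K → ℂ) : DL m f = DD m.toNat f := by
  rw [DL, if_pos h]; rfl

lemma DL_neg {m : ℤ} (h : ¬ (0 ≤ m ∧ m < K)) (f : GG d K → ℂ) : DL m f = 0 := by
  rw [DL, if_neg h]; rfl

theorem core {κ : Type} [Fintype κ] (lev : κ → Fin K) (B : κ → (GG d K → ℂ) →ₗ[ℂ] (GG d K → ℂ))
    (mu : κ → AddChar (GG d K) ℂ → ℂ) (hmu : ∀ k f ψ, ft (B k f) ψ = mu k ψ * ft f ψ)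
    (hc : ∀ k (c : ℂ), B k (fun _ => c) = 0) {M L η : ℝ} (hL : ∀ n, ((univ.filter fun k => lev k = n).card : ℝ) ≤ L)
    (hM : ∀ k ψ, ‖mu k ψ‖ ≤ M) (hM0 : 0 < M) (hL0 : 0 ≤ L) (hη : 0 < η) (hη1 : η ≤ 1)
    (hdec : ∀ k (m : ℕ) ψ, ‖mu k ψ‖ * (fD m (zz ψ) - fD (m + 1) (zz ψ)) ≤ 20 * rr ^ ((m : ℤ) - lev k).natAbs)
    {p0 p θ C0 B0 : ℝ} (hp0 : 1 < p0) (hp : 1 < p) (hθ0 : 0 ≤ θ) (hθ1 : θ < 1) (hC0 : 0 ≤ C0) (hB0 : 0 ≤ B0)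
    (hpp : 1 / p = (1 - θ) / 2 + θ / p0)
    (HS : ∀ f : GG d K → ℂ, nm p0 (sqn (fun m : Fin K => DD m f)) ≤ C0 * nm p0 (fun x => ‖f x‖))
    (H0 : ∀ h : Fin K → GG d K → ℂ, nm p0 (sqn (fun k => B k (h (lev k)))) ≤ B0 * nm p0 (sqn h))
    (f : GG d K → ℂ) :
    nm p (sqn (fun k => B k f)) ≤ √(20 * L * M ^ (2 - η)) ^ (1 - θ) * (B0 * C0) ^ θ
      * (2 / (1 - (rr ^ (η / 2)) ^ (1 - θ))) * nm p (fun x => ‖f x‖) := by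
  classical
  set A := √(20 * L * M ^ (2 - η)) with hA
  have hA0 : 0 ≤ A := Real.sqrt_nonneg _
  set ρ := rr ^ (η / 2) with hρ
  have hρ0 : 0 < ρ := Real.rpow_pos_of_pos rr_pos _
  have hρ1 : ρ < 1 := Real.rpow_lt_one rr_pos.le rr_lt (by positivity)
  set σ := ρ ^ (1 - θ) with hσ
  have hσ0 : 0 < σ := Real.rpow_pos_of_pos hρ0 _
  have hσ1 : σ < 1 := Real.rpow_lt_one hρ0.le hρ1 (by linarith)
  let T : ℤ → (GG d K → ℂ) →ₗ[ℂ] (κ → GG d K → ℂ) := fun j => LinearMap.pi fun k => (B k).comp (DL ((lev k : ℕ) + j))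
  have hT : ∀ j f k, T j f k = B k (DL ((lev k : ℕ) + j) f) := fun j f k => rfl
  -- decomposition
  have hdecomp : ∀ k, B k f = ∑ j ∈ Ioo (-(K:ℤ)) K, T j f k := by
    intro k
    have e1 : f = (∑ m ∈ range K, DD m f) + fun _ => cv (kF K) f 0 := by
      funext x
      rw [Pi.add_apply, Finset.sum_apply, F_top f 0 x]; exact telesc f x
    conv_lhs => rw [e1, map_add, hc, add_zero, map_sum]
    refine sum_of_injOn (fun m : ℕ => (m:ℤ) - (lev k : ℕ)) ?_ ?_ ?_ ?_
    · intro a _ b _ h; dsimp only at h; omega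
    · intro m hm
      have := mem_range.1 (mem_coe.1 hm)
      have := (lev k).2
      rw [mem_coe, mem_Ioo]; dsimp only; omega
    · intro j _ hj
      rw [hT, DL_neg, map_zero]
      intro h
      exact hj ⟨((lev k : ℕ) + j).toNat, by rw [mem_coe, mem_range]; omega, by dsimp only; omega⟩
    · intro m hm
      have := mem_range.1 hm
      rw [hT, DL_pos (by omega)]; congr 3; omega
  -- L² bounds
  have H2 : ∀ (j : ℤ) f, nm 2 (sqn (T j f)) ≤ (A * ρ ^ j.natAbs) * nm 2 (fun x => ‖f x‖) := by
    intro j f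
    let dz : κ → AddChar (GG d K) ℂ → ℝ := fun k ψ => if 0 ≤ ((lev k : ℕ) : ℤ) + j ∧ ((lev k : ℕ) : ℤ) + j < K then
      fD (((lev k : ℕ) : ℤ) + j).toNat (zz ψ) - fD ((((lev k : ℕ) : ℤ) + j).toNat + 1) (zz ψ) else 0
    refine l2_bound (fun k f => T j f k) (fun k ψ => mu k ψ * (dz k ψ : ℂ)) ?_ (by positivity) ?_ f
    · intro k f ψ
      rw [hT, hmu, mul_assoc]; congr 1
      simp only [dz]
      split_ifs with h
      · rw [DL_pos h, ft_D (by omega)]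
      · rw [DL_neg h]; simp [ft]
    · intro ψ
      have hD0 : ∀ m, 0 ≤ fD m (zz ψ) - fD (m + 1) (zz ψ) := fun m => by linarith [fD_anti (zz_norm ψ) m]
      have hD1 : ∀ m, fD m (zz ψ) - fD (m + 1) (zz ψ) ≤ 1 := fun m => by
        linarith [fD_le_one (zz_norm ψ) m, fD_nonneg (z := zz ψ) (m + 1)]
      set c := 20 * M ^ (2 - η) * (rr ^ j.natAbs) ^ η with hcdef
      have hc0 : 0 ≤ c := by have := rr_pos; positivity
      have pw : ∀ k, ‖mu k ψ * (dz k ψ : ℂ)‖ ^ 2 ≤ c * dz k ψ := by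
        intro k
        simp only [dz]
        split_ifs with h
        · set m := (((lev k : ℕ) : ℤ) + j).toNat with hm
          have hd := hdec k m ψ
          rw [show ((m : ℤ) - lev k).natAbs = j.natAbs by omega] at hd
          set D := fD m (zz ψ) - fD (m + 1) (zz ψ)
          set a := ‖mu k ψ‖ with ha
          have ha0 : 0 ≤ a := norm_nonneg _
          rw [norm_mul, Complex.norm_real, Real.norm_of_nonneg (hD0 m), ← ha]
          have hDm : 0 ≤ D := hD0 m
          have h1 : (a * D) ^ 2 = (a * D) ^ η * (a ^ (2 - η) * D ^ (1 - η)) * D := by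
            rcases eq_or_lt_of_le hDm with h0 | h0
            · rw [← h0]; simp
            rcases eq_or_lt_of_le ha0 with h0' | h0'
            · rw [← h0', Real.zero_rpow (by linarith)]; simp
            rw [Real.mul_rpow ha0 hDm]
            calc (a * D) ^ 2 = a ^ (η + (2 - η)) * D ^ (η + (1 - η)) * D := by
                  rw [add_sub_cancel, add_sub_cancel, Real.rpow_one, show (2:ℝ) = ((2:ℕ):ℝ) by norm_num, Real.rpow_natCast]; ring
              _ = _ := by rw [Real.rpow_add h0', Real.rpow_add h0]; ring
          rw [h1]
          refine mul_le_mul_of_nonneg_right ?_ hDm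
          have h2 : (a * D) ^ η ≤ 20 * (rr ^ j.natAbs) ^ η := by
            refine (Real.rpow_le_rpow (by positivity) hd hη.le).trans ?_
            rw [Real.mul_rpow (by norm_num) (pow_nonneg rr_pos.le _)]
            refine mul_le_mul_of_nonneg_right ?_ (Real.rpow_nonneg (pow_nonneg rr_pos.le _) _)
            calc (20:ℝ) ^ η ≤ 20 ^ (1:ℝ) := Real.rpow_le_rpow_of_exponent_le (by norm_num) hη1
              _ = 20 := Real.rpow_one _
          have h3 : a ^ (2 - η) ≤ M ^ (2 - η) := Real.rpow_le_rpow ha0 (hM k ψ) (by linarith)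
          have h4 : D ^ (1 - η) ≤ 1 := Real.rpow_le_one hDm (hD1 m) (by linarith)
          have h6 := rr_pos
          calc _ ≤ (20 * (rr ^ j.natAbs) ^ η) * (M ^ (2 - η) * 1) := by gcongr
            _ = c := by rw [hcdef]; ring
        · simp
      refine (sum_le_sum fun k _ => pw k).trans ?_
      rw [← mul_sum]
      have h5 : ∑ k, dz k ψ ≤ L * 1 := by
        rw [← sum_fiberwise_of_maps_to (t := univ) (g := lev) (fun _ _ => mem_univ _)]
        let g : ℕ → ℝ := fun m => fD m (zz ψ) - fD (m + 1) (zz ψ)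
        calc _ ≤ ∑ n : Fin K, L * (if 0 ≤ (n:ℤ) + j ∧ (n:ℤ) + j < K then g ((n:ℤ) + j).toNat else 0) := by
              refine sum_le_sum fun n _ => ?_
              rw [sum_congr rfl (g := fun _ => if 0 ≤ (n:ℤ) + j ∧ (n:ℤ) + j < K then g ((n:ℤ) + j).toNat else 0) (by
                intro k hk; rw [mem_filter] at hk; simp only [dz, hk.2]; rfl), sum_const, nsmul_eq_mul]
              refine mul_le_mul_of_nonneg_right (hL n) ?_
              split_ifs; exacts [hD0 _, le_rfl]
          _ ≤ L * ∑ m : Fin K, g m := by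
              rw [← mul_sum]; exact mul_le_mul_of_nonneg_left (shift_sum g hD0 j) hL0
          _ ≤ L * 1 := by
              refine mul_le_mul_of_nonneg_left ?_ hL0
              rw [Fin.sum_univ_eq_sum_range g K, sum_range_sub' (fun m => fD m (zz ψ))]
              linarith [fD_le_one (zz_norm ψ) 0, fD_nonneg (z := zz ψ) K]
      refine (mul_le_mul_of_nonneg_left h5 hc0).trans (le_of_eq ?_)
      have h7 : (rr ^ j.natAbs) ^ η = (ρ ^ j.natAbs) ^ 2 := by
        rw [hρ, ← pow_mul, ← Real.rpow_natCast rr, ← Real.rpow_natCast (rr ^ _), ← Real.rpow_mul rr_pos.le, ← Real.rpow_mul rr_pos.le]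
        push_cast; congr 1; ring
      rw [mul_pow, hA, Real.sq_sqrt (by positivity), hcdef, h7]; ring
  have H1 : ∀ (j : ℤ) f, nm p0 (sqn (T j f)) ≤ (B0 * C0) * nm p0 (fun x => ‖f x‖) := by
    intro j f
    refine (H0 (fun n => DL ((n:ℕ) + j) f)).trans ?_
    rw [mul_assoc]
    refine mul_le_mul_of_nonneg_left ((nm_mono (by linarith) fun x => ?_).trans (HS f)) hB0
    rw [abs_of_nonneg (sqn_nonneg _ _)]
    refine Real.sqrt_le_sqrt (le_trans (le_of_eq ?_) (shift_sum (fun m => ‖DD m f x‖ ^ 2) (fun _ => by positivity) j))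
    refine sum_congr rfl fun n _ => ?_
    dsimp only
    split_ifs with h
    · rw [DL_pos h]
    · rw [DL_neg h]; simp
  have hsum : nm p (sqn (fun k => B k f)) ≤ ∑ j ∈ Ioo (-(K:ℤ)) K, nm p (sqn (T j f)) := by
    refine le_trans (nm_mono (by linarith) fun x => ?_) (nm_sum hp.le _ _)
    rw [abs_of_nonneg (sqn_nonneg _ _)]
    refine le_trans (le_of_eq ?_) (sqn_sum _ _ x)
    congr 1; funext k y
    rw [hdecomp k, Finset.sum_apply]
  refine hsum.trans ?_
  calc _ ≤ ∑ j ∈ Ioo (-(K:ℤ)) K, (A ^ (1 - θ) * (B0 * C0) ^ θ * nm p (fun x => ‖f x‖)) * σ ^ j.natAbs := by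
        refine sum_le_sum fun j _ => ?_
        refine (riesz_thorin (T j) (by norm_num) hp0 hθ0 hθ1.le (by linarith) hpp (by positivity) (by positivity) (H2 j) (H1 j) f).trans (le_of_eq ?_)
        rw [Real.mul_rpow hA0 (by positivity), hσ, ← Real.rpow_natCast, ← Real.rpow_natCast, ← Real.rpow_mul hρ0.le,
          ← Real.rpow_mul hρ0.le, mul_comm (j.natAbs:ℝ)]; ring
    _ ≤ _ := by
        rw [← mul_sum]
        have h0 := nm_nonneg p (fun x => ‖f x‖)
        refine (mul_le_mul_of_nonneg_left (sum_int hσ0.le hσ1 K) (by positivity)).trans (le_of_eq ?_)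
        ring

end core
end DF

namespace DF
open Finset
set_option linter.unusedVariables false
set_option linter.unusedSectionVars false

/-- admissible radii -/
def Adm (N : ℕ → ℕ) : Prop := ∀ n, 2 ^ n ≤ N n ∧ N n ≤ 2 ^ (n + 1)

def SA (d K : ℕ) (k : Fin K → GG d K → ℝ) : Prop := ∃ N : ℕ → ℕ, Adm N ∧ k = fun n : Fin K => kA (N n)
def SF (d K : ℕ) (k : Fin K → GG d K → ℝ) : Prop := k = fun n : Fin K => kF n

lemma SA_PK {d K : ℕ} {k : Fin K → GG d K → ℝ} (h : SA d K k) (n : Fin K) : PK (k n) := by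
  obtain ⟨N, _, rfl⟩ := h; exact kA_PK _
lemma SF_PK {d K : ℕ} {k : Fin K → GG d K → ℝ} (h : SF d K k) (n : Fin K) : PK (k n) := by
  rw [h]; exact kF_PK n.2.le

def MaxOn (S : ∀ d K : ℕ, (Fin K → GG d K → ℝ) → Prop) (q : ℝ) : Prop :=
  ∃ C : ℝ, 0 < C ∧ ∀ (d K : ℕ) (k : Fin K → GG d K → ℝ), S d K k → ∀ f : GG d K → ℝ, (∀ x, 0 ≤ f x) →
    ∃ W : GG d K → ℝ, (∀ n x, cv (k n) f x ≤ W x) ∧ nm q W ≤ C * nm q f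

def VOn (S : ∀ d K : ℕ, (Fin K → GG d K → ℝ) → Prop) (p : ℝ) : Prop :=
  ∃ C : ℝ, 0 < C ∧ ∀ (d K : ℕ) (k : Fin K → GG d K → ℝ), S d K k → ∀ h : Fin K → GG d K → ℂ,
    nm p (sqn (fun n => cv (k n) (h n))) ≤ C * nm p (sqn h)

/-- `A_N - F_n` -/
noncomputable def BF {d K : ℕ} (N n : ℕ) : (GG d K → ℂ) →ₗ[ℂ] (GG d K → ℂ) := cvL (kA N) - cvL (kF n)

def SqB (p : ℝ) : Prop := ∃ C : ℝ, 0 < C ∧ ∀ (d K : ℕ) (N : ℕ → ℕ), Adm N → ∀ f : GG d K → ℂ,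
    nm p (sqn (fun n : Fin K => BF (N n) n f)) ≤ C * nm p (fun x => ‖f x‖)

section S
variable {S : ∀ d K : ℕ, (Fin K → GG d K → ℝ) → Prop} (hS : ∀ {d K} {k : Fin K → GG d K → ℝ}, S d K k → ∀ n, PK (k n))
include hS

lemma vgt {q q' : ℝ} (h : MaxOn S q) (hq : q.HolderConjugate q') : VOn S (2 * q') := by
  obtain ⟨C, hC, H⟩ := h
  exact ⟨√C, by positivity, fun d K k hk => vec_of_max (hS hk) hq hC.le (H d K k hk)⟩

lemma vdual {p p' : ℝ} (h : VOn S p) (hp : p.HolderConjugate p') : VOn S p' := by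
  obtain ⟨C, hC, H⟩ := h
  exact ⟨C, hC, fun d K k hk => vec_dual (hS hk) hp hC.le (H d K k hk)⟩

lemma v2 : VOn S 2 := by
  refine ⟨1, one_pos, fun d K k hk h => ?_⟩
  rw [one_mul, nm_le_iff (by norm_num) (nm_nonneg _ _), nm_rpow (by norm_num)]
  have e : ∀ (g : Fin K → GG d K → ℂ) x, |sqn g x| ^ (2:ℝ) = ∑ n, ‖g n x‖ ^ 2 := fun g x => by
    rw [abs_of_nonneg (sqn_nonneg _ _), ← sqn_sq, ← Real.rpow_natCast]; norm_num
  simp only [e]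
  rw [sum_comm, sum_comm (f := fun x n => ‖h n x‖ ^ 2)]
  refine sum_le_sum fun n _ => (sum_le_sum fun x _ => cv_sq_le (hS hk n) (h n) x).trans (le_of_eq ?_)
  have := cv_adj_real (hS hk n) (fun y => ‖h n y‖ ^ 2) (fun _ => 1)
  simpa only [mul_one, cv_const (hS hk n)] using this

lemma vall (hm : ∀ q, 1 < q → MaxOn S q) {p : ℝ} (hp : 1 < p) : VOn S p := by
  have gt : ∀ p, 2 < p → VOn S p := by
    intro p hp
    have h := (Real.HolderConjugate.conjExponent (by linarith : 1 < p / 2)).symm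
    have := vgt hS (hm _ h.lt) h
    rwa [mul_div_cancel₀ _ (by norm_num : (2:ℝ) ≠ 0)] at this
  rcases lt_trichotomy p 2 with h | h | h
  · have hh := Real.HolderConjugate.conjExponent hp
    refine vdual hS (gt _ ?_) hh.symm
    rw [Real.conjExponent, lt_div_iff₀ (by linarith)]; linarith
  · rw [h]; exact v2 hS
  · exact gt p h

end S

lemma cv_real {G : Type} [AddCommGroup G] [Fintype G] (k : G → ℝ) (f : G → ℝ) (x : G) :
    cv k (fun y => (f y : ℂ)) x = ((cv k f x : ℝ) : ℂ) := by
  simp [cv, Complex.real_smul]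

lemma maxF {q : ℝ} (hq : 1 < q) : MaxOn SF q := by
  obtain ⟨C, hC, H⟩ := FMax hq
  refine ⟨C, hC, fun d K k hk f _ => ?_⟩
  obtain ⟨W, h1, h2⟩ := H d K f
  rw [show k = _ from hk]
  exact ⟨W, fun n x => (le_abs_self _).trans (h1 n n.2.le x), h2⟩

lemma VF {p : ℝ} (hp : 1 < p) : VOn SF p := vall SF_PK (fun q hq => maxF hq) hp

lemma maxA {q : ℝ} (hq : 1 < q) (h : SqB q) : MaxOn SA q := by
  obtain ⟨C, hC, H⟩ := maxF hq
  obtain ⟨C', hC', H'⟩ := h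
  refine ⟨C + C', by positivity, ?_⟩
  rintro d K _ ⟨N, hN, rfl⟩ f hf
  obtain ⟨W, h1, h2⟩ := H d K _ rfl f hf
  have h3 := H' d K N hN (fun x => (f x : ℂ))
  set Q := sqn (fun n : Fin K => BF (N n) n (fun x : GG d K => (f x : ℂ))) with hQ
  refine ⟨fun x => W x + Q x, fun n x => ?_, ?_⟩
  · have := le_sqn (fun n : Fin K => BF (N n) n (fun x : GG d K => (f x : ℂ))) n x
    rw [← hQ, BF, LinearMap.sub_apply, Pi.sub_apply, cvL_apply, cvL_apply, cv_real, cv_real, ← Complex.ofReal_sub,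
      Complex.norm_real] at this
    have := le_of_abs_le this
    have := h1 n x
    dsimp only at *
    linarith
  · refine (nm_add hq.le _ _).trans ?_
    have e : nm q (fun x => ‖(f x : ℂ)‖) = nm q f := by unfold nm; simp
    rw [e] at h3; linarith

lemma step {p0 p θ : ℝ} (hp0 : 1 < p0) (hp : 1 < p) (h0 : 0 ≤ θ) (h1 : θ < 1) (hpp : 1 / p = (1 - θ) / 2 + θ / p0)
    (h : VOn SA p0) : SqB p := by
  obtain ⟨C, hC, H⟩ := h
  obtain ⟨C', hC', H'⟩ := VF hp0
  obtain ⟨C0, hC0, HS⟩ := FSq hp0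
  have hr : (rr ^ ((1:ℝ) / 2)) ^ (1 - θ) < 1 :=
    Real.rpow_lt_one (Real.rpow_nonneg rr_pos.le _) (Real.rpow_lt_one rr_pos.le rr_lt (by norm_num)) (by linarith)
  refine ⟨√(20 * 1 * 2 ^ ((2:ℝ) - 1)) ^ (1 - θ) * ((C + C') * C0) ^ θ * (2 / (1 - (rr ^ ((1:ℝ) / 2)) ^ (1 - θ))),
    mul_pos (by positivity) (div_pos (by norm_num) (by linarith)), fun d K N hN f => ?_⟩
  refine core (L := 1) (M := 2) (η := 1) (fun n => n) (fun n : Fin K => BF (N n) n)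
    (fun n ψ => aD (N n) (zz ψ) - (fD n (zz ψ) : ℂ)) ?_ ?_ ?_ ?_ (by norm_num) (by norm_num) (by norm_num) le_rfl
    ?_ hp0 hp h0 h1 hC0.le (by positivity) hpp (HS d K) ?_ f
  · intro n f ψ
    rw [sub_mul, ← ft_A, ← ft_F n.2.le]; exact ft_sub _ _ ψ
  · intro n c; funext x
    rw [BF, LinearMap.sub_apply, Pi.sub_apply, cvL_apply, cvL_apply, cv_const (kA_PK _), cv_const (kF_PK n.2.le), sub_self]; rfl
  · intro n; simp [filter_eq']
  · intro n ψ
    refine (norm_sub_le _ _).trans ?_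
    rw [Complex.norm_real, Real.norm_of_nonneg (fD_nonneg _)]
    linarith [aD_le_one (zz_norm ψ) (N n), fD_le_one (zz_norm ψ) n]
  · intro n m ψ
    have := sym_dec (zz_norm ψ) (m := m) (hN n).1 (hN n).2
    have h2 := pow_pos rr_pos ((m : ℤ) - n).natAbs
    linarith
  · intro h
    refine (nm_mono (by linarith) fun x => ?_).trans ((nm_add hp0.le _ _).trans ((add_le_add (H d K _ ⟨N, hN, rfl⟩ h) (H' d K _ rfl h)).trans_eq (add_mul _ _ _).symm))
    rw [abs_of_nonneg (sqn_nonneg _ _)]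
    exact sqn_sub _ _ x

lemma boot (k : ℕ) : ∀ p : ℝ, 1 < p → |1 / p - 1 / 2| ≤ 1 / 2 - 1 / 2 * (3 / 4) ^ k → SqB p := by
  induction k with
  | zero =>
    intro p hp h
    have h := abs_nonpos_iff.1 (h.trans (by norm_num))
    exact step (p0 := 2) (θ := 0) (by norm_num) hp le_rfl (by norm_num) (by linarith) (v2 SA_PK)
  | succ k ih =>
    intro p hp h
    set t : ℝ := (3 / 4) ^ k with ht
    have ht0 : 0 < t := by positivity
    have ht1 : t ≤ 1 := pow_le_one₀ (by norm_num) (by norm_num)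
    rw [pow_succ, ← ht] at h
    have hq : 1 < (1 - t / 2)⁻¹ := (one_lt_inv₀ (by linarith)).2 (by linarith)
    have hc := Real.HolderConjugate.conjExponent hq
    set q := (1 - t / 2)⁻¹
    have hsq : SqB q := by
      refine ih q hq (le_of_eq ?_)
      rw [one_div, inv_inv, abs_of_nonneg (by linarith)]; ring
    have hv := vgt SA_PK (maxA hq hsq) hc
    set q' := q.conjExponent
    have hq' : q'⁻¹ = t / 2 := by
      have := hc.inv_add_inv_eq_one
      rw [inv_inv] at this; linarith
    have hq'0 : q' = 2 / t := by rw [← inv_inv q', hq', inv_div]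
    have hp0 : 1 < 2 * q' := by linarith [hc.symm.lt]
    have hi : 1 / (2 * q') = t / 4 := by rw [one_div, mul_inv, hq']; ring
    have hs : 0 < 1 / 2 - t / 4 := by linarith
    have hab := abs_le.1 h
    rcases le_total p 2 with h2 | h2
    · have hc2 := Real.HolderConjugate.conjExponent hp0
      have h3 : 1 / 2 ≤ 1 / p := one_div_le_one_div_of_le (by linarith) h2
      have h4 := hc2.inv_add_inv_eq_one
      rw [← one_div, hi, ← one_div] at h4
      refine step (p0 := (2 * q').conjExponent) (θ := (1 / p - 1 / 2) / (1 / 2 - t / 4)) hc2.symm.lt hp (div_nonneg (by linarith) hs.le)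
        ((div_lt_one hs).2 (by linarith)) ?_ (vdual SA_PK hv hc2)
      rw [div_eq_mul_one_div _ (Real.conjExponent _), show 1 / (2 * q').conjExponent = 1 - t / 4 by linarith]
      have e := div_mul_cancel₀ (1 / p - 1 / 2) hs.ne'
      generalize (1 / p - 1 / 2) / (1 / 2 - t / 4) = θ at e ⊢
      linear_combination -e
    · have h3 : 1 / p ≤ 1 / 2 := one_div_le_one_div_of_le (by linarith) h2
      refine step (p0 := 2 * q') (θ := (1 / 2 - 1 / p) / (1 / 2 - t / 4)) hp0 hp (div_nonneg (by linarith) hs.le)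
        ((div_lt_one hs).2 (by linarith)) ?_ hv
      rw [div_eq_mul_one_div _ (2 * q'), hi]
      have e := div_mul_cancel₀ (1 / 2 - 1 / p) hs.ne'
      generalize (1 / 2 - 1 / p) / (1 / 2 - t / 4) = θ at e ⊢
      linear_combination e

lemma sqB {p : ℝ} (hp : 1 < p) : SqB p := by
  have h : |1 / p - 1 / 2| < 1 / 2 := by
    have h1 : 1 / p < 1 := (div_lt_one (by linarith)).2 hp
    have h2 : 0 < 1 / p := by positivity
    rw [abs_lt]; constructor <;> linarith
  obtain ⟨k, hk⟩ := exists_pow_lt_of_lt_one (sub_pos.2 h) (by norm_num : (3 / 4 : ℝ) < 1)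
  have : (0:ℝ) < (3 / 4) ^ k := by positivity
  exact boot k p hp (by linarith)

lemma VA {p : ℝ} (hp : 1 < p) : VOn SA p := vall SA_PK (fun q hq => maxA hq (sqB hq)) hp

end DF

namespace DF
open Finset
set_option linter.unusedVariables false
set_option linter.unusedSectionVars false

lemma dyad {p r : ℝ} (hp : 1 < p) (hr : 2 < r) : ∃ C : ℝ, 0 < C ∧ ∀ (d K : ℕ) (f : GG d K → ℂ),
    ∃ W : GG d K → ℝ, nm p W ≤ C * nm p (fun x => ‖f x‖) ∧ ∀ x, VDom r (fun n => cv (kA (2 ^ n)) f x) K (W x) := by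
  obtain ⟨C, hC, H⟩ := FVar hp hr
  obtain ⟨C', hC', H'⟩ := sqB hp
  refine ⟨C + 2 * C', by positivity, fun d K f => ?_⟩
  obtain ⟨W, h1, h2⟩ := H d K f
  have h3 := H' d K (fun n => 2 ^ n) (fun n => ⟨le_rfl, Nat.pow_le_pow_right (by norm_num) (by omega)⟩) f
  set Q := sqn (fun n : Fin K => (BF (2 ^ (n:ℕ)) n) f) with hQ
  refine ⟨fun x => W x + 2 * Q x, ?_, fun x => ?_⟩
  · refine (nm_add hp.le _ _).trans ?_
    rw [nm_smul (by linarith) (by norm_num)]; linarith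
  · have k1 : VDom r (fun n => cv (kF n) f x) K (W x) := (h2 x).comp id monotone_id fun n hn => by dsimp; omega
    have k2 : VDom r (fun n => BF (2 ^ n) n f x) K (2 * Q x) := by
      refine VDom.of_sq hr.le id monotone_id (fun n => BF (2 ^ n) n f x) (fun _ _ => rfl) (range K)
        (fun n hn => mem_range.2 hn) (mul_nonneg (by norm_num) (sqn_nonneg _ _)) ?_
      rw [mul_pow, sqn_sq, ← Fin.sum_univ_eq_sum_range (fun n => ‖BF (2 ^ n) n f x‖ ^ 2) K]; norm_num
    refine (k1.add (by linarith) k2).congr fun n _ => ?_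
    rw [BF, LinearMap.sub_apply, Pi.sub_apply, cvL_apply, cvL_apply]; ring

def R1 (l m n : ℕ) : ℕ := if l ≤ n then (2 ^ l + m) * 2 ^ (n - l) else 2 ^ n
def R0 (l m n : ℕ) : ℕ := if l ≤ n then (2 ^ l + m) / 2 * 2 ^ (n - l + 1) else 2 ^ n

lemma R_bd {l m n : ℕ} (hl : 1 ≤ l) (hm : m < 2 ^ l) :
    2 ^ n ≤ R0 l m n ∧ R1 l m n ≤ 2 ^ (n + 1) ∧ ∃ h, R1 l m n = R0 l m n + h ∧ h * 2 ^ l ≤ 2 ^ n := by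
  unfold R1 R0
  split_ifs with h
  · obtain ⟨k, rfl⟩ := Nat.exists_eq_add_of_le h
    obtain ⟨j, rfl⟩ := Nat.exists_eq_add_of_le hl
    rw [Nat.add_sub_cancel_left]
    set q := 2 ^ (1 + j) + m with hq
    have e2 : (2:ℕ) ^ (1 + j) = 2 * 2 ^ j := by rw [pow_add, pow_one]
    refine ⟨?_, ?_, (q % 2) * 2 ^ k, ?_, ?_⟩
    · calc 2 ^ (1 + j + k) = 2 ^ j * 2 ^ (k + 1) := by rw [← pow_add]; congr 1; omega
        _ ≤ _ := Nat.mul_le_mul_right _ (by omega)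
    · calc q * 2 ^ k ≤ 2 ^ (1 + j + 1) * 2 ^ k := Nat.mul_le_mul_right _ (by rw [pow_succ]; omega)
        _ = _ := by rw [← pow_add]; congr 1; omega
    · have := Nat.div_add_mod q 2
      calc q * 2 ^ k = (2 * (q / 2) + q % 2) * 2 ^ k := by rw [this]
        _ = _ := by rw [pow_succ]; ring
    · have : q % 2 ≤ 1 := by omega
      calc q % 2 * 2 ^ k * 2 ^ (1 + j) ≤ 1 * 2 ^ k * 2 ^ (1 + j) := by gcongr
        _ = _ := by rw [one_mul, ← pow_add]; congr 1; omega
  · exact ⟨le_rfl, Nat.pow_le_pow_right (by norm_num) (by omega), 0, rfl, by simp⟩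

lemma R1_adm {l m : ℕ} (hl : 1 ≤ l) (hm : m < 2 ^ l) : Adm (R1 l m) := fun n => by
  obtain ⟨h1, h2, h, h3, _⟩ := R_bd (n := n) hl hm; omega
lemma R0_adm {l m : ℕ} (hl : 1 ≤ l) (hm : m < 2 ^ l) : Adm (R0 l m) := fun n => by
  obtain ⟨h1, h2, h, h3, _⟩ := R_bd (n := n) hl hm; omega

/-- short-scale differences -/
noncomputable def BA {d K : ℕ} (l n m : ℕ) : (GG d K → ℂ) →ₗ[ℂ] (GG d K → ℂ) :=
  cvL (kA (R1 l m n)) - cvL (kA (R0 l m n))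

lemma BA_row {p0 : ℝ} (hp0 : 1 < p0) : ∃ C : ℝ, 0 < C ∧ ∀ (d K l m : ℕ), 1 ≤ l → m < 2 ^ l →
    ∀ h : Fin K → GG d K → ℂ, nm p0 (sqn (fun n : Fin K => BA l n m (h n))) ≤ C * nm p0 (sqn h) := by
  obtain ⟨C, hC, H⟩ := VA hp0
  refine ⟨C + C, by positivity, fun d K l m hl hm h => ?_⟩
  refine (nm_mono (by linarith) fun x => ?_).trans ((nm_add hp0.le _ _).trans ((add_le_add (H d K _ ⟨_, R1_adm hl hm, rfl⟩ h) (H d K _ ⟨_, R0_adm hl hm, rfl⟩ h)).trans_eq (add_mul _ _ _).symm))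
  rw [abs_of_nonneg (sqn_nonneg _ _)]
  exact sqn_sub _ _ x

lemma sqn_prod {Ω : Type} {K L : ℕ} (g : Fin K → Fin L → Ω → ℂ) (x : Ω) :
    sqn (fun k : Fin K × Fin L => g k.1 k.2) x ^ 2 = ∑ m : Fin L, sqn (fun n => g n m) x ^ 2 := by
  simp only [sqn_sq]; rw [Fintype.sum_prod_type, sum_comm]

/-- the off-diagonal vector bound with growth `2^{τ l}` -/
def HB (p0 τ : ℝ) : Prop := ∃ C : ℝ, 0 < C ∧ ∀ (d K l : ℕ), 1 ≤ l → ∀ h : Fin K → GG d K → ℂ,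
    nm p0 (sqn (fun k : Fin K × Fin (2 ^ l) => BA l k.1 k.2 (h k.1))) ≤ (C * ((2:ℝ) ^ l) ^ τ) * nm p0 (sqn h)

lemma le_of_sq_le_sq' {a b : ℝ} (h : a ^ 2 ≤ b ^ 2) (hb : 0 ≤ b) : a ≤ b := by
  by_contra! h2; nlinarith

lemma HB_one {p0 : ℝ} (hp0 : 1 < p0) : HB p0 1 := by
  obtain ⟨C, hC, H⟩ := BA_row hp0
  refine ⟨C, hC, fun d K l hl h => ?_⟩
  refine (nm_mono (by linarith) (g := fun x => ∑ m : Fin (2 ^ l), sqn (fun n : Fin K => BA l n m (h n)) x) fun x => ?_).trans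
    ((nm_sum hp0.le univ _).trans ((sum_le_sum fun (m : Fin (2 ^ l)) _ => H d K l m hl m.2 h).trans (le_of_eq ?_)))
  · rw [abs_of_nonneg (sqn_nonneg _ _)]
    refine le_of_sq_le_sq' ?_ (sum_nonneg fun _ _ => sqn_nonneg _ _)
    rw [sqn_prod (fun (n : Fin K) (m : Fin (2 ^ l)) => BA l n m (h n))]
    exact sum_sq_le_sq_sum_of_nonneg fun _ _ => sqn_nonneg _ _
  · rw [sum_const, card_univ, Fintype.card_fin, nsmul_eq_mul, Real.rpow_one]; push_cast; ring

lemma HB_half {p0 : ℝ} (hp0 : 2 ≤ p0) : HB p0 (1 / 2) := by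
  obtain ⟨C, hC, H⟩ := BA_row (by linarith : 1 < p0)
  refine ⟨C, hC, fun d K l hl h => ?_⟩
  have h0 := nm_nonneg p0 (sqn h)
  have e2 : 2 * (p0 / 2) = p0 := by ring
  refine le_of_sq_le_sq' ?_ (by positivity)
  have e := sqn_sq_nm (κ := Unit) (by linarith : 0 < p0 / 2) (sqn (fun k : Fin K × Fin (2 ^ l) => BA l k.1 k.2 (h k.1))) (fun x => sqn_nonneg _ x)
  rw [e2] at e
  rw [← e]
  simp only [sqn_prod (fun (n : Fin K) (m : Fin (2 ^ l)) => BA l n m (h n))]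
  refine (nm_sum (by linarith) univ _).trans ?_
  calc _ ≤ ∑ m : Fin (2 ^ l), (C * nm p0 (sqn h)) ^ 2 := by
        refine sum_le_sum fun m _ => ?_
        rw [sqn_sq_nm (κ := Unit) (by linarith : 0 < p0 / 2) _ (fun x => sqn_nonneg _ x), e2]
        exact pow_le_pow_left₀ (nm_nonneg _ _) (H d K l m hl m.2 h) 2
    _ = _ := by
        rw [sum_const, card_univ, Fintype.card_fin, nsmul_eq_mul, mul_pow, mul_pow, mul_pow, ← Real.rpow_natCast (_ ^ (1 / 2 : ℝ)),
          ← Real.rpow_mul (by positivity)]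
        push_cast; norm_num; ring

lemma short {p p0 τ θ : ℝ} (hp0 : 1 < p0) (hp : 1 < p) (h0 : 0 ≤ θ) (h1 : θ < 1)
    (hpp : 1 / p = (1 - θ) / 2 + θ / p0) (hτ : 2 * τ * θ < 1 - θ) (hB : HB p0 τ) :
    ∃ C σ : ℝ, 0 < C ∧ 0 < σ ∧ σ < 1 ∧ ∀ (d K l : ℕ) (f : GG d K → ℂ), 1 ≤ l →
      nm p (sqn (fun k : Fin K × Fin (2 ^ l) => BA l k.1 k.2 f)) ≤ C * σ ^ l * nm p (fun x => ‖f x‖) := by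
  obtain ⟨B, hB, H⟩ := hB
  obtain ⟨C0, hC0, HS⟩ := FSq hp0
  obtain ⟨η, hη, hη1, hη2⟩ : ∃ η : ℝ, 0 < η ∧ η ≤ 1 ∧ 2 * τ * θ < (1 - η) * (1 - θ) := by
    have hs : 0 < 1 - θ - 2 * τ * θ := by linarith
    refine ⟨min 1 ((1 - θ - 2 * τ * θ) / 2), by positivity, min_le_left _ _, ?_⟩
    have := min_le_right 1 ((1 - θ - 2 * τ * θ) / 2)
    have h3 : 0 < min 1 ((1 - θ - 2 * τ * θ) / 2) := by positivity
    nlinarith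
  have hr : (rr ^ (η / 2)) ^ (1 - θ) < 1 :=
    Real.rpow_lt_one (Real.rpow_nonneg rr_pos.le _) (Real.rpow_lt_one rr_pos.le rr_lt (by linarith)) (by linarith)
  set Q := 2 / (1 - (rr ^ (η / 2)) ^ (1 - θ)) with hQ
  have hQ0 : 0 < Q := div_pos (by norm_num) (by linarith)
  set e : ℝ := τ * θ - (1 - η) * (1 - θ) / 2 with he
  refine ⟨√(20 * 12288 ^ (2 - η)) ^ (1 - θ) * (B * C0) ^ θ * Q, 2 ^ e, by positivity, by positivity,
    Real.rpow_lt_one_of_one_lt_of_neg (by norm_num) (by rw [he]; linarith), fun d K l f hl => ?_⟩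
  set P : ℝ := 2 ^ l with hP
  have hP0 : 0 < P := by positivity
  have hcore := core (L := P) (M := 12288 / P) (η := η) (p := p) (B0 := B * P ^ τ) (C0 := C0)
    (fun k : Fin K × Fin (2 ^ l) => k.1) (fun k => BA l k.1 k.2)
    (fun k ψ => aD (R1 l k.2 k.1) (zz ψ) - aD (R0 l k.2 k.1) (zz ψ)) ?_ ?_ ?_ ?_ (by positivity) hP0.le hη hη1
    ?_ hp0 hp h0 h1 hC0.le (by positivity) hpp (HS d K) (H d K l hl) f
  · refine hcore.trans (le_of_eq ?_)
    rw [← hQ]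
    congr 1
    have e1 : √(20 * P * (12288 / P) ^ (2 - η)) = √(20 * 12288 ^ (2 - η)) * P ^ (-(1 - η) / 2) := by
      rw [Real.div_rpow (by norm_num) hP0.le, show 20 * P * (12288 ^ (2 - η) / P ^ (2 - η)) = 20 * 12288 ^ (2 - η) * (P / P ^ (2 - η)) by ring,
        Real.sqrt_mul (by positivity)]
      congr 1
      rw [Real.sqrt_eq_rpow]
      nth_rewrite 1 [← Real.rpow_one P]
      rw [← Real.rpow_sub hP0, ← Real.rpow_mul hP0.le]
      congr 1; ring
    have e2 : ((2:ℝ) ^ e) ^ l = P ^ e := by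
      rw [hP, ← Real.rpow_natCast, ← Real.rpow_natCast, ← Real.rpow_mul (by norm_num), ← Real.rpow_mul (by norm_num), mul_comm]
    rw [e1, e2, show B * P ^ τ * C0 = B * C0 * P ^ τ by ring, Real.mul_rpow (by positivity) (by positivity),
      Real.mul_rpow (by positivity) (by positivity), ← Real.rpow_mul hP0.le, ← Real.rpow_mul hP0.le, he,
      show τ * θ - (1 - η) * (1 - θ) / 2 = τ * θ + -(1 - η) / 2 * (1 - θ) by ring, Real.rpow_add hP0]
    ring
  · intro k f ψ
    rw [sub_mul, ← ft_A, ← ft_A]; exact ft_sub _ _ ψ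
  · intro n c; funext x
    rw [BA, LinearMap.sub_apply, Pi.sub_apply, cvL_apply, cvL_apply, cv_const (kA_PK _), cv_const (kA_PK _), sub_self]; rfl
  · intro n
    have : (univ.filter fun k : Fin K × Fin (2 ^ l) => k.1 = n) = (univ : Finset (Fin (2 ^ l))).image fun m => (n, m) := by
      ext ⟨a, b⟩; simp [eq_comm]
    rw [this, hP]
    refine (Nat.cast_le.2 card_image_le).trans ?_
    simp
  · intro k ψ
    obtain ⟨h3, h4, h, h5, h6⟩ := R_bd (n := k.1) hl k.2.2
    have hpos : 0 < 2 ^ (k.1 : ℕ) := by positivity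
    have hhn : h ≤ R0 l k.2 k.1 := by
      have : h * 1 ≤ h * 2 ^ l := Nat.mul_le_mul_left _ Nat.one_le_two_pow
      omega
    have := aD_diff (zz_norm ψ) (by omega : 1 ≤ R0 l k.2 k.1) hhn
    rw [norm_sub_rev, h5]
    refine this.trans ?_
    rw [mul_div_assoc', div_le_div_iff₀ (by exact_mod_cast (by omega : 0 < R0 l k.2 k.1)) hP0, mul_assoc]
    gcongr
    rw [hP]; exact_mod_cast h6.trans h3
  · intro k m ψ
    have a1 := R1_adm hl k.2.2 k.1
    have a0 := R0_adm hl k.2.2 k.1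
    have k1 := sym_dec (zz_norm ψ) (m := m) a1.1 a1.2
    have k0 := sym_dec (zz_norm ψ) (m := m) a0.1 a0.2
    have hD0 : 0 ≤ fD m (zz ψ) - fD (m + 1) (zz ψ) := by linarith [fD_anti (zz_norm ψ) m]
    have := norm_sub_le_norm_sub_add_norm_sub (aD (R1 l k.2 k.1) (zz ψ)) (fD k.1 (zz ψ) : ℂ) (aD (R0 l k.2 k.1) (zz ψ))
    rw [norm_sub_rev (fD k.1 (zz ψ) : ℂ)] at this
    have := mul_le_mul_of_nonneg_right this hD0
    rw [add_mul] at this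
    linarith

lemma short' {p : ℝ} (hp : 3 / 2 < p) (hp4 : p < 4) :
    ∃ C σ : ℝ, 0 < C ∧ 0 < σ ∧ σ < 1 ∧ ∀ (d K l : ℕ) (f : GG d K → ℂ), 1 ≤ l →
      nm p (sqn (fun k : Fin K × Fin (2 ^ l) => BA l k.1 k.2 f)) ≤ C * σ ^ l * nm p (fun x => ‖f x‖) := by
  rcases le_total p 2 with h | h
  · have h3 : 0 < 3 - p := by linarith
    have hθ : (2 - p) / (3 - p) < 1 / 3 := by rw [div_lt_iff₀ h3]; linarith
    exact short (p0 := 2 * p / 3) (θ := (2 - p) / (3 - p)) (τ := 1) (by linarith) (by linarith) (div_nonneg (by linarith) h3.le)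
      (by linarith) (by field_simp; ring) (by linarith) (HB_one (by linarith))
  · have h3 : 0 < 3 * p - 4 := by linarith
    have h4 : 0 < 4 - p := by linarith
    have hθ : (2 * p - 4) / (3 * p - 4) < 1 / 2 := by rw [div_lt_iff₀ h3]; linarith
    have hp1 : 2 ≤ 4 * p / (4 - p) := by rw [le_div_iff₀ h4]; linarith
    exact short (p0 := 4 * p / (4 - p)) (θ := (2 * p - 4) / (3 * p - 4)) (τ := 1 / 2) (by linarith) (by linarith)
      (div_nonneg (by linarith) h3.le) (by linarith) (by
        have h5 : (3 * p - 4) ≠ 0 := h3.ne'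
        have h6 : (4 - p) ≠ 0 := h4.ne'
        have h7 : p ≠ 0 := by linarith
        rw [one_sub_div h5, div_div_eq_mul_div, div_div, div_mul_eq_mul_div, div_div, div_add_div _ _ (by positivity) (by positivity), div_eq_div_iff h7 (by positivity)]
        ring) (by linarith) (HB_half hp1)

end DF

namespace DF
open Finset
set_option linter.unusedVariables false
set_option linter.unusedSectionVars false

/-- dyadic approximation of `N` to precision `2^(log N - l)` -/
def Nl (l N : ℕ) : ℕ := N / 2 ^ (Nat.log 2 N - l) * 2 ^ (Nat.log 2 N - l)
def mm (l N : ℕ) : ℕ := N / 2 ^ (Nat.log 2 N - l) - 2 ^ l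

lemma mm_lt (l N : ℕ) : mm l N < 2 ^ l := by
  have h0 : 0 < 2 ^ l := by positivity
  have h1 : N / 2 ^ (Nat.log 2 N - l) < 2 ^ l + 2 ^ l := by
    rw [Nat.div_lt_iff_lt_mul (by positivity), ← mul_two, ← pow_succ, ← pow_add]
    refine (Nat.lt_pow_succ_log_self (by norm_num) N).trans_le (Nat.pow_le_pow_right (by norm_num) (by omega))
  unfold mm; omega

lemma mm_ge {l N : ℕ} (hN : N ≠ 0) (h : l ≤ Nat.log 2 N) : 2 ^ l + mm l N = N / 2 ^ (Nat.log 2 N - l) := by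
  have : 2 ^ l ≤ N / 2 ^ (Nat.log 2 N - l) := by
    rw [Nat.le_div_iff_mul_le (by positivity), ← pow_add, Nat.add_sub_cancel' h]
    exact Nat.pow_log_le_self 2 hN
  unfold mm; omega

lemma Nl_R1 {l N : ℕ} (hN : N ≠ 0) (h : l ≤ Nat.log 2 N) : R1 l (mm l N) (Nat.log 2 N) = Nl l N := by
  rw [R1, if_pos h, mm_ge hN h, Nl]

lemma Nl_R0 {l N : ℕ} (hN : N ≠ 0) (h : l + 1 ≤ Nat.log 2 N) : R0 (l + 1) (mm (l + 1) N) (Nat.log 2 N) = Nl l N := by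
  rw [R0, if_pos h, mm_ge hN h, Nl, Nat.div_div_eq_div_mul, ← pow_succ, show Nat.log 2 N - (l + 1) + 1 = Nat.log 2 N - l by omega]

lemma Nl_big {l N : ℕ} (h : Nat.log 2 N ≤ l) : Nl l N = N := by
  rw [Nl, Nat.sub_eq_zero_of_le h]; simp

lemma Nl_zero {N : ℕ} (hN : N ≠ 0) : Nl 0 N = 2 ^ Nat.log 2 N := by
  have := mm_ge hN (Nat.zero_le _)
  have h2 := mm_lt 0 N
  rw [Nl, ← this]
  rw [pow_zero] at *
  rw [show mm 0 N = 0 by omega]; simp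

lemma phi_mono (l : ℕ) : Monotone fun N => Nat.log 2 N * 2 ^ l + mm l N := by
  intro N M h
  dsimp
  rcases (Nat.log_mono_right (b := 2) h).eq_or_lt with e | e
  · unfold mm; rw [e]
    exact Nat.add_le_add_left (Nat.sub_le_sub_right (Nat.div_le_div_right h) _) _
  · have h1 := mm_lt l N
    have h2 := Nat.mul_le_mul_right (2 ^ l) (Nat.succ_le_of_lt e)
    rw [Nat.succ_mul] at h2
    omega

lemma BA_Nl {d K l N : ℕ} (hN : N ≠ 0) (f : GG d K → ℂ) (x : GG d K) :
    cv (kA (Nl (l + 1) N)) f x - cv (kA (Nl l N)) f x = BA (l + 1) (Nat.log 2 N) (mm (l + 1) N) f x := by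
  rw [BA, LinearMap.sub_apply, Pi.sub_apply, cvL_apply, cvL_apply]
  by_cases h : l + 1 ≤ Nat.log 2 N
  · rw [Nl_R1 hN h, Nl_R0 hN h]
  · rw [Nl_big (by omega), Nl_big (by omega), R1, R0, if_neg h, if_neg h, sub_self, sub_self]

lemma full {p r : ℝ} (hp : 3 / 2 < p) (hp4 : p < 4) (hr : 2 < r) : ∃ C : ℝ, 0 < C ∧ ∀ (d K : ℕ) (f : GG d K → ℂ),
    ∃ W : GG d K → ℝ, nm p W ≤ C * nm p (fun x => ‖f x‖) ∧
      ∀ x, VDom r (fun i => cv (kA (i + 1)) f x) (2 ^ K - 1) (W x) := by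
  obtain ⟨C1, hC1, H1⟩ := dyad (p := p) (by linarith) hr
  obtain ⟨C, σ, hC, hσ, hσ1, H⟩ := short' hp hp4
  have hs : 0 < 1 - σ := by linarith
  refine ⟨C1 + 2 * C * (1 / (1 - σ)), by positivity, fun d K f => ?_⟩
  obtain ⟨W, h1, h2⟩ := H1 d K f
  set Q : ℕ → GG d K → ℝ := fun l => sqn (fun k : Fin K × Fin (2 ^ (l + 1)) => BA (l + 1) k.1 k.2 f) with hQ
  refine ⟨fun x => W x + ∑ l ∈ range K, 2 * Q l x, ?_, fun x => ?_⟩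
  · refine (nm_add (by linarith) _ _).trans ?_
    rw [add_mul]
    refine add_le_add h1 ((nm_sum (by linarith) _ _).trans ?_)
    have hf := nm_nonneg p (fun x => ‖f x‖)
    calc _ ≤ ∑ l ∈ range K, 2 * C * nm p (fun x => ‖f x‖) * σ ^ l := by
          refine sum_le_sum fun l _ => ?_
          rw [nm_smul (by linarith) (by norm_num)]
          have := H d K (l + 1) f (by omega)
          have h3 : σ ^ (l + 1) ≤ σ ^ l := pow_le_pow_of_le_one hσ.le hσ1.le (by omega)
          calc 2 * nm p (Q l) ≤ 2 * (C * σ ^ l * nm p (fun x => ‖f x‖)) := by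
                refine mul_le_mul_of_nonneg_left (this.trans ?_) (by norm_num)
                gcongr
            _ = _ := by ring
      _ = 2 * C * nm p (fun x => ‖f x‖) * ∑ l ∈ range K, σ ^ l := by rw [mul_sum]
      _ ≤ 2 * C * nm p (fun x => ‖f x‖) * (1 / (1 - σ)) := by
          refine mul_le_mul_of_nonneg_left ?_ (by positivity)
          rw [le_div_iff₀ hs, geom_sum_mul_neg]
          linarith [pow_pos hσ K]
      _ = _ := by ring
  · have hlog : ∀ i < 2 ^ K - 1, Nat.log 2 (i + 1) < K := fun i hi =>
      Nat.log_lt_of_lt_pow (by omega) (by omega)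
    have k1 : VDom r (fun i => cv (kA (2 ^ Nat.log 2 (i + 1))) f x) (2 ^ K - 1) (W x) :=
      (h2 x).comp (fun i => Nat.log 2 (i + 1)) (fun a b h => Nat.log_mono_right (by omega)) hlog
    have k2 : ∀ l ∈ range K, VDom r (fun i => cv (kA (Nl (l + 1) (i + 1))) f x - cv (kA (Nl l (i + 1))) f x) (2 ^ K - 1) (2 * Q l x) := by
      intro l _
      refine VDom.of_sq hr.le (fun i => Nat.log 2 (i + 1) * 2 ^ (l + 1) + mm (l + 1) (i + 1))
        (fun a b h => phi_mono (l + 1) (by omega : a + 1 ≤ b + 1))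
        (fun c => BA (l + 1) (c / 2 ^ (l + 1)) (c % 2 ^ (l + 1)) f x) (fun n hn => ?_) (range (K * 2 ^ (l + 1)))
        (fun n hn => mem_range.2 ?_) (mul_nonneg (by norm_num) (sqn_nonneg _ _)) ?_
      · have hm := mm_lt (l + 1) (n + 1)
        rw [BA_Nl (by omega), mul_comm (Nat.log _ _), Nat.mul_add_div (by positivity), Nat.div_eq_of_lt hm, add_zero,
          Nat.mul_add_mod, Nat.mod_eq_of_lt hm]
      · have hm := mm_lt (l + 1) (n + 1)
        have := Nat.mul_le_mul_right (2 ^ (l + 1)) (Nat.succ_le_of_lt (hlog n hn))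
        rw [Nat.succ_mul] at this
        omega
      · rw [mul_pow, sqn_sq, ← Fin.sum_univ_eq_sum_range (fun c => ‖BA (l + 1) (c / 2 ^ (l + 1)) (c % 2 ^ (l + 1)) f x‖ ^ 2),
          ← (finProdFinEquiv (m := K) (n := 2 ^ (l + 1))).sum_comp]
        refine le_of_eq ?_
        norm_num
        refine sum_congr rfl fun k _ => ?_
        rw [Nat.add_mul_div_left _ _ (by positivity), Nat.div_eq_of_lt k.2.2, zero_add, Nat.mod_eq_of_lt k.2.2]
    refine (k1.add (by linarith) (VDom.sum (by linarith) _ k2)).congr fun i hi => ?_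
    have h0 := Nl_zero (N := i + 1) (by omega)
    have hK := Nl_big (N := i + 1) (hlog i hi).le
    have := sum_range_sub (fun l => cv (kA (Nl l (i + 1))) f x) K
    rw [this, h0, hK]; ring

end DF

namespace DF
open Finset
set_option linter.unusedVariables false
set_option linter.unusedSectionVars false

/-- boxes in `ℤ^d` -/
noncomputable abbrev Bx (d N : ℕ) : Finset (Fin d → ℤ) := Icc (fun _ => -(N : ℤ)) (fun _ => (N : ℤ))

lemma mem_Bx {d N : ℕ} {y : Fin d → ℤ} : y ∈ Bx d N ↔ ∀ i, -(N:ℤ) ≤ y i ∧ y i ≤ N := by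
  simp only [Bx, Finset.mem_Icc, Pi.le_def, forall_and]

lemma card_Bx (d N : ℕ) : (Bx d N).card = (2 * N + 1) ^ d := by
  rw [Bx, Pi.card_Icc]; simp only [Int.card_Icc, prod_const, card_univ, Fintype.card_fin]
  congr 1; omega

def io (d K : ℕ) (y : Fin d → ℤ) : GG d K := fun i => (y i : ZMod (2 ^ K))
def vm {d K : ℕ} (g : GG d K) : Fin d → ℤ := fun i => (g i).valMinAbs

lemma vm_inj {d K : ℕ} : Function.Injective (vm (d := d) (K := K)) := fun a b h =>
  funext fun i => ZMod.injective_valMinAbs (congrFun h i)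

lemma vm_io {d K M : ℕ} (hK : 2 * M < 2 ^ K) {y : Fin d → ℤ} (hy : y ∈ Bx d M) : vm (io d K y) = y := by
  funext i
  have := mem_Bx.1 hy i
  refine (ZMod.valMinAbs_spec _ _).2 ⟨rfl, ?_, ?_⟩ <;> push_cast <;> zify at hK <;> linarith

lemma cv_kA {d K : ℕ} (N : ℕ) (f : GG d K → ℂ) (x : GG d K) :
    cv (kA N) f x = (((2 * N + 1) ^ d : ℕ) : ℂ)⁻¹ * ∑ y ∈ Bx d N, f (x + io d K y) := by
  have h : ∀ g : GG d K, kA N g = (((2 * N + 1) ^ d : ℕ) : ℝ)⁻¹ * ∑ y ∈ Bx d N, if io d K y = g then 1 else 0 := by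
    intro g
    simp only [kA, pk, wA, prod_mul_distrib, prod_const, card_univ, Fintype.card_fin]
    rw [prod_univ_sum]
    push_cast
    rw [inv_pow]
    congr 1
    refine sum_congr rfl fun y _ => ?_
    rw [prod_ite_zero]
    simp [io, funext_iff]
  simp only [cv, h, Complex.real_smul]
  push_cast
  simp only [mul_assoc, ← mul_sum, sum_mul]
  rw [sum_comm]
  congr 1
  refine sum_congr rfl fun y _ => ?_
  rw [sum_eq_single (io d K y) (fun b _ hb => by rw [if_neg hb.symm]; simp) (by simp), if_pos rfl]; simp

/-- the torus bound -/
def TB (p r : ℝ) (rad : ℕ → ℕ) (C : ℝ) : Prop := ∀ (d K L : ℕ), L ≤ K → ∀ f : GG d K → ℂ,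
    ∃ W : GG d K → ℝ, nm p W ≤ C * nm p (fun x => ‖f x‖) ∧ ∀ x, VDom r (fun n => cv (kA (rad n)) f x) L (W x)

/-- truncated variation -/
noncomputable def vT (r : ℝ) (L : ℕ) (a : ℕ → ℂ) : ℝ≥0∞ :=
  ⨆ (J : ℕ) (u : Fin (J + 1) → ℕ) (_ : StrictMono u ∧ u (Fin.last J) < L),
    (∑ j : Fin J, (‖a (u j.succ) - a (u j.castSucc)‖₊ : ℝ≥0∞) ^ r) ^ (1 / r)

lemma vT_mono (r : ℝ) (a : ℕ → ℂ) : Monotone fun L => vT r L a := fun L M h =>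
  iSup_mono fun J => iSup_mono fun u => iSup_mono' fun hu => ⟨⟨hu.1, hu.2.trans_le h⟩, le_rfl⟩

lemma vT_sup (r : ℝ) (a : ℕ → ℂ) : varSeqSem r a = ⨆ L, vT r L a := by
  refine le_antisymm (iSup_le fun J => iSup_le fun u => iSup_le fun hu => ?_) (iSup_le fun L => ?_)
  · refine le_iSup_of_le (u (Fin.last J) + 1) ?_
    exact le_iSup_of_le J (le_iSup_of_le u (le_iSup_of_le ⟨hu, by omega⟩ le_rfl))
  · exact iSup_mono fun J => iSup_mono fun u => iSup_mono' fun hu => ⟨hu.1, le_rfl⟩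

lemma vT_le {r : ℝ} (hr : 0 < r) {a : ℕ → ℂ} {L : ℕ} {w : ℝ} (h : VDom r a L w) : vT r L a ≤ ENNReal.ofReal w := by
  refine iSup_le fun J => iSup_le fun u => iSup_le fun hu => ?_
  have hm : Monotone fun j : ℕ => u ⟨min j J, by omega⟩ := fun i j hij => hu.1.monotone (by
    simp only [Fin.mk_le_mk]; omega)
  have := h.2 J _ hm (by convert hu.2 using 2; simp [Fin.ext_iff])
  rw [← Fin.sum_univ_eq_sum_range (fun j => ‖a (u ⟨min (j + 1) J, by omega⟩) - a (u ⟨min j J, by omega⟩)‖ ^ r)] at this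
  rw [one_div, ENNReal.rpow_inv_le_iff hr, ENNReal.ofReal_rpow_of_nonneg h.1 hr.le]
  refine le_trans (le_of_eq ?_) (ENNReal.ofReal_le_ofReal this)
  rw [ENNReal.ofReal_sum_of_nonneg fun _ _ => by positivity]
  refine sum_congr rfl fun j _ => ?_
  have e1 : (⟨min (j + 1) J, by omega⟩ : Fin (J + 1)) = j.succ := by
    have := j.2
    simp only [Fin.ext_iff, Fin.val_succ]; omega
  have e2 : (⟨min (j : ℕ) J, by omega⟩ : Fin (J + 1)) = j.castSucc := by
    have := j.2
    simp only [Fin.ext_iff, Fin.val_castSucc]; omega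
  rw [e1, e2, ← ENNReal.ofReal_rpow_of_nonneg (norm_nonneg _) hr.le, ofReal_norm]
  rfl

section tr
variable {d : ℕ} {X : Type} {T : (Fin d → ℤ) → X → X}

lemma pointwise {p r C : ℝ} (hp : 1 < p) (hr : 2 < r) (hC : 0 < C) {rad : ℕ → ℕ} (H : TB p r rad C)
    (hT : ∀ a b, T (a + b) = T a ∘ T b) (f : X → ℂ) (L N0 R : ℕ) (hN : ∀ n < L, rad n ≤ N0) (x : X) :
    ∑ z ∈ Bx d R, vT r L (fun n => ergAvg d T (rad n) f (T z x)) ^ p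
      ≤ ENNReal.ofReal (C ^ p) * ∑ y ∈ Bx d (R + N0), (‖f (T y x)‖₊ : ℝ≥0∞) ^ p := by
  classical
  have hp0 : 0 < p := by linarith
  set M := R + N0 with hM
  set K := L + 2 * M with hK
  have hK2 : 2 * M < 2 ^ K := lt_of_le_of_lt (by omega) Nat.lt_two_pow_self
  have hRM : Bx d R ⊆ Bx d M := fun y hy => mem_Bx.2 fun i => by
    have := mem_Bx.1 hy i; push_cast [hM]; omega
  set φ : GG d K → ℂ := fun g => if vm g ∈ Bx d M then f (T (vm g) x) else 0 with hφ
  have hφio : ∀ y ∈ Bx d M, φ (io d K y) = f (T y x) := fun y hy => by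
    simp only [hφ, vm_io hK2 hy, if_pos hy]
  obtain ⟨W, h1, h2⟩ := H d K L (by omega) φ
  have hW : ∀ g, 0 ≤ W g := fun g => (h2 g).1
  have hpt : ∀ z ∈ Bx d R, vT r L (fun n => ergAvg d T (rad n) f (T z x)) ≤ ENNReal.ofReal (W (io d K z)) := by
    intro z hz
    refine vT_le (by linarith) ((h2 (io d K z)).congr fun n hn => ?_)
    rw [cv_kA, ergAvg]
    congr 1
    refine sum_congr rfl fun y hy => ?_
    have : io d K z + io d K y = io d K (y + z) := by funext i; simp [io, add_comm]
    rw [this, hφio, hT]; rfl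
    refine mem_Bx.2 fun i => ?_
    have a := mem_Bx.1 hz i
    have b := mem_Bx.1 hy i
    have := hN n hn
    rw [Pi.add_apply]; push_cast [hM]; omega
  have hsum : ∑ z ∈ Bx d R, W (io d K z) ^ p ≤ C ^ p * ∑ y ∈ Bx d M, ‖f (T y x)‖ ^ p := by
    have hinj : Set.InjOn (io d K) (Bx d R) := fun a ha b hb hab => by
      rw [← vm_io hK2 (hRM ha), ← vm_io hK2 (hRM hb), hab]
    calc ∑ z ∈ Bx d R, W (io d K z) ^ p = ∑ g ∈ (Bx d R).image (io d K), W g ^ p := (sum_image (f := fun g => W g ^ p) hinj).symm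
      _ ≤ ∑ g, W g ^ p := sum_le_univ_sum_of_nonneg fun g => Real.rpow_nonneg (hW g) _
      _ = nm p W ^ p := by rw [nm_rpow hp0]; exact sum_congr rfl fun g _ => by rw [abs_of_nonneg (hW g)]
      _ ≤ (C * nm p (fun x => ‖φ x‖)) ^ p := Real.rpow_le_rpow (nm_nonneg _ _) h1 hp0.le
      _ = C ^ p * ∑ g, ‖φ g‖ ^ p := by
          rw [Real.mul_rpow hC.le (nm_nonneg _ _), nm_rpow hp0]; simp only [abs_norm]
      _ ≤ _ := by
          refine mul_le_mul_of_nonneg_left ?_ (by positivity)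
          have : ∀ g, ‖φ g‖ ^ p = if vm g ∈ Bx d M then ‖f (T (vm g) x)‖ ^ p else 0 := fun g => by
            simp only [hφ]; split_ifs <;> simp [hp0.ne']
          simp only [this]
          rw [← sum_filter, ← sum_image (f := fun y => ‖f (T y x)‖ ^ p) (g := vm) vm_inj.injOn]
          refine sum_le_sum_of_subset_of_nonneg (fun y hy => ?_) fun _ _ _ => by positivity
          obtain ⟨g, hg, rfl⟩ := mem_image.1 hy
          exact (mem_filter.1 hg).2
  calc _ ≤ ∑ z ∈ Bx d R, ENNReal.ofReal (W (io d K z) ^ p) := sum_le_sum fun z hz => by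
        rw [← ENNReal.ofReal_rpow_of_nonneg (hW _) hp0.le]
        exact ENNReal.rpow_le_rpow (hpt z hz) hp0.le
    _ = ENNReal.ofReal (∑ z ∈ Bx d R, W (io d K z) ^ p) :=
        (ENNReal.ofReal_sum_of_nonneg fun _ _ => Real.rpow_nonneg (hW _) _).symm
    _ ≤ _ := ENNReal.ofReal_le_ofReal hsum
    _ = _ := by
        rw [ENNReal.ofReal_mul (by positivity), ENNReal.ofReal_sum_of_nonneg fun _ _ => by positivity]
        congr 1
        refine sum_congr rfl fun y _ => ?_
        rw [← ENNReal.ofReal_rpow_of_nonneg (norm_nonneg _) hp0.le, ofReal_norm]; rfl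

lemma lim_le {A D : ℝ≥0∞} {d N0 : ℕ}
    (h : ∀ R : ℕ, (((2 * R + 1) ^ d : ℕ) : ℝ≥0∞) * A ≤ (((2 * (R + N0) + 1) ^ d : ℕ) : ℝ≥0∞) * D) : A ≤ D := by
  have h1 : Filter.Tendsto (fun R : ℕ => (1 + (2 * N0 : ℝ) / (2 * R + 1)) ^ d) Filter.atTop (nhds 1) := by
    have h2 : Filter.Tendsto (fun R : ℕ => (2 * (R:ℝ) + 1)) Filter.atTop Filter.atTop :=
      Filter.tendsto_atTop_add_const_right _ _ (tendsto_natCast_atTop_atTop.const_mul_atTop (by norm_num))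
    have := ((tendsto_const_nhds (x := (2 * N0 : ℝ))).div_atTop h2).const_add 1
    simpa using this.pow d
  have h2 := ENNReal.Tendsto.mul_const (b := D) (ENNReal.tendsto_ofReal h1) (Or.inl (by simp))
  rw [ENNReal.ofReal_one, one_mul] at h2
  refine ge_of_tendsto' h2 fun R => ?_
  have hpos : (0:ℝ) < (2 * R + 1) ^ d := by positivity
  have e : (1 + (2 * N0 : ℝ) / (2 * R + 1)) ^ d = ((2 * (R:ℝ) + 1) ^ d)⁻¹ * (2 * (R + N0) + 1) ^ d := by
    rw [← inv_pow, ← mul_pow]; congr 1; field_simp; ring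
  have h3 := mul_le_mul_right (h R) (ENNReal.ofReal ((2 * (R:ℝ) + 1) ^ d)⁻¹)
  have e3 : ENNReal.ofReal ((2 * (R:ℝ) + 1) ^ d)⁻¹ * (((2 * R + 1) ^ d : ℕ) : ℝ≥0∞) = 1 := by
    rw [← ENNReal.ofReal_natCast, ← ENNReal.ofReal_mul (by positivity)]
    push_cast
    rw [inv_mul_cancel₀ hpos.ne', ENNReal.ofReal_one]
  have e4 : ENNReal.ofReal ((2 * (R:ℝ) + 1) ^ d)⁻¹ * (((2 * (R + N0) + 1) ^ d : ℕ) : ℝ≥0∞) =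
      ENNReal.ofReal ((1 + (2 * N0 : ℝ) / (2 * R + 1)) ^ d) := by
    rw [← ENNReal.ofReal_natCast, ← ENNReal.ofReal_mul (by positivity), e]
    push_cast; rfl
  rwa [← mul_assoc, ← mul_assoc, e3, e4, one_mul] at h3

theorem transfer {p r C : ℝ} (hp : 1 < p) (hr : 2 < r) (hC : 0 < C) {rad : ℕ → ℕ} (H : TB p r rad C)
    [MeasurableSpace X] (μ : Measure X) (hT : ∀ a b, T (a + b) = T a ∘ T b)
    (hμ : ∀ a, MeasurePreserving (T a) μ μ) (f : X → ℂ) (hf : Measurable f) :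
    lpMeas μ p (fun x => varSeqSem r (fun n => ergAvg d T (rad n) f x))
          ≤ ENNReal.ofReal C * lpMeas μ p (fun x => (‖f x‖₊ : ℝ≥0∞)) := by
  have hp0 : 0 < p := by linarith
  have hfm : Measurable fun x => (‖f x‖₊ : ℝ≥0∞) ^ p := hf.nnnorm.coe_nnreal_ennreal.pow_const p
  have hEm : ∀ N, Measurable fun x => ergAvg d T N f x := fun N => by
    unfold ergAvg
    exact (Finset.measurable_sum _ fun y _ => hf.comp (hμ y).measurable).const_mul _
  have hVm : ∀ L, Measurable fun x => vT r L (fun n => ergAvg d T (rad n) f x) ^ p := fun L => by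
    refine Measurable.pow_const ?_ p
    unfold vT
    refine .iSup fun J => .iSup fun u => .iSup_Prop _ (Measurable.pow_const (Finset.measurable_sum _ fun j _ => Measurable.pow_const ?_ _) _)
    exact ((hEm _).sub (hEm _)).nnnorm.coe_nnreal_ennreal
  have key : ∀ L, ∫⁻ x, vT r L (fun n => ergAvg d T (rad n) f x) ^ p ∂μ ≤ ENNReal.ofReal (C ^ p) * ∫⁻ x, (‖f x‖₊ : ℝ≥0∞) ^ p ∂μ := by
    intro L
    set N0 := ∑ n ∈ range L, rad n with hN0
    refine lim_le (d := d) (N0 := N0) fun R => ?_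
    have := lintegral_mono (μ := μ) (pointwise hp hr hC H hT f L N0 R fun n hn => single_le_sum (fun _ _ => Nat.zero_le _) (mem_range.2 hn))
    have m1 : ∀ z, Measurable fun x => vT r L (fun n => ergAvg d T (rad n) f (T z x)) ^ p := fun z => (hVm L).comp (hμ z).measurable
    have m2 : ∀ z, Measurable fun x => (‖f (T z x)‖₊ : ℝ≥0∞) ^ p := fun z => hfm.comp (hμ z).measurable
    rw [lintegral_finsetSum _ fun z _ => m1 z, lintegral_const_mul _ (Finset.measurable_sum _ fun y _ => m2 y),
      lintegral_finsetSum _ fun y _ => m2 y] at this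
    simp only [fun z => (hμ z).lintegral_comp (hVm L), fun z => (hμ z).lintegral_comp hfm] at this
    rw [sum_const, sum_const, card_Bx, card_Bx, nsmul_eq_mul, nsmul_eq_mul] at this
    rwa [mul_left_comm]
  have : ∫⁻ x, varSeqSem r (fun n => ergAvg d T (rad n) f x) ^ p ∂μ ≤ ENNReal.ofReal (C ^ p) * ∫⁻ x, (‖f x‖₊ : ℝ≥0∞) ^ p ∂μ := by
    have e : ∀ x, varSeqSem r (fun n => ergAvg d T (rad n) f x) ^ p = ⨆ L, vT r L (fun n => ergAvg d T (rad n) f x) ^ p := fun x => by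
      rw [vT_sup]; exact (ENNReal.orderIsoRpow p hp0).map_iSup _
    simp only [e]
    rw [lintegral_iSup hVm fun L M h x => ENNReal.rpow_le_rpow (vT_mono r _ h) hp0.le]
    exact iSup_le key
  unfold _root_.lpMeas
  refine (ENNReal.rpow_le_rpow this (by positivity)).trans (le_of_eq ?_)
  rw [ENNReal.mul_rpow_of_nonneg _ _ (by positivity), ← ENNReal.ofReal_rpow_of_pos hC, ← ENNReal.rpow_mul, mul_one_div_cancel hp0.ne', ENNReal.rpow_one]

end tr

end DF

/-- dimension-free `r`-variational estimates for ergodic cube averages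
associated with `d` commuting invertible measure-preserving transformations, encoded as a
measure-preserving `ℤ^d`-action `T` (Theorem 1.7): full variations for `p ∈ (3/2,4)`,
long (dyadic) variations for `p ∈ (1,∞)`, in both cases `r ∈ (2,∞)`. -/
theorem statement7 :
    (∀ p r : ℝ, 3 / 2 < p → p < 4 → 2 < r →
      ∃ C : ℝ, 0 < C ∧ ∀ (d : ℕ) (X : Type) (_ : MeasurableSpace X) (μ : Measure X),
        SigmaFinite μ →
        ∀ T : (Fin d → ℤ) → X → X, T 0 = id → (∀ a b, T (a + b) = T a ∘ T b) →
        (∀ a, MeasurePreserving (T a) μ μ) →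
        ∀ f : X → ℂ, Measurable f → lpMeas μ p (fun x => (‖f x‖₊ : ℝ≥0∞)) ≠ ∞ →
        lpMeas μ p (fun x => varSeqSem r (fun n => ergAvg d T (n + 1) f x))
          ≤ ENNReal.ofReal C * lpMeas μ p (fun x => (‖f x‖₊ : ℝ≥0∞))) ∧
    (∀ p r : ℝ, 1 < p → 2 < r →
      ∃ C : ℝ, 0 < C ∧ ∀ (d : ℕ) (X : Type) (_ : MeasurableSpace X) (μ : Measure X),
        SigmaFinite μ →
        ∀ T : (Fin d → ℤ) → X → X, T 0 = id → (∀ a b, T (a + b) = T a ∘ T b) →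
        (∀ a, MeasurePreserving (T a) μ μ) →
        ∀ f : X → ℂ, Measurable f → lpMeas μ p (fun x => (‖f x‖₊ : ℝ≥0∞)) ≠ ∞ →
        lpMeas μ p (fun x => varSeqSem r (fun n => ergAvg d T (2 ^ n) f x))
          ≤ ENNReal.ofReal C * lpMeas μ p (fun x => (‖f x‖₊ : ℝ≥0∞))) := by
  refine ⟨fun p r hp hp4 hr => ?_, fun p r hp hr => ?_⟩
  · obtain ⟨C, hC, H⟩ := DF.full hp hp4 hr
    refine ⟨C, hC, fun d X _ μ _ T _ hT hμ f hf _ => ?_⟩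
    refine DF.transfer (by linarith) hr hC (rad := fun n => n + 1) (fun d K L hL f => ?_) μ hT hμ f hf
    obtain ⟨W, h1, h2⟩ := H d K f
    refine ⟨W, h1, fun x => (h2 x).comp id monotone_id fun n hn => ?_⟩
    have := (Nat.lt_two_pow_self (n := K))
    dsimp only [id]; omega
  · obtain ⟨C, hC, H⟩ := DF.dyad hp hr
    refine ⟨C, hC, fun d X _ μ _ T _ hT hμ f hf _ => ?_⟩
    refine DF.transfer (by linarith) hr hC (rad := fun n => 2 ^ n) (fun d K L hL f => ?_) μ hT hμ f hf
    obtain ⟨W, h1, h2⟩ := H d K f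
    exact ⟨W, h1, fun x => (h2 x).comp id monotone_id fun n hn => by dsimp only [id]; omega⟩
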